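/- (part of Theorem 1.2: isolated Levi-degenerate points are preserved) Under the stated hypotheses, let p ∈ M, let W be an open neighborhood of p in ℂ², and let F : W → ℂ² be holomorphic with F(z) = f(z) for all z ∈ W ∩ D. Suppose there is a relative neighborhood N of p in M such that every point of N is a pseudoconvex point of ∂D, p is a Levi-degenerate point of ∂D, and no point of N \ {p} is a Levi-degenerate point of ∂D. Then F(p) ∈ M', F(p) is a Levi-degenerate point of ∂D', and there is a relative neighborhood N' of F(p) in M' such that every point of N' is a pseudoconvex point of ∂D' and no point of N' \ {F(p)} is a Levi-degenerate point of ∂D'. -/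

import Mathlib

noncomputable section

open Complex Filter Metric Set

/-- `ℂ²`. -/
abbrev C2 := ℂ × ℂ

/-- Wirtinger derivative `∂g/∂z₁`. -/
def wd1 (g : C2 → ℂ) (p : C2) : ℂ :=
  (1 / 2 : ℂ) * (fderiv ℝ g p ((1 : ℂ), (0 : ℂ)) - Complex.I * fderiv ℝ g p (Complex.I, (0 : ℂ)))

/-- Wirtinger derivative `∂g/∂z₂`. -/
def wd2 (g : C2 → ℂ) (p : C2) : ℂ :=
  (1 / 2 : ℂ) * (fderiv ℝ g p ((0 : ℂ), (1 : ℂ)) - Complex.I * fderiv ℝ g p ((0 : ℂ), Complex.I))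

/-- Wirtinger derivative `∂g/∂z̄₁`. -/
def wdbar1 (g : C2 → ℂ) (p : C2) : ℂ :=
  (1 / 2 : ℂ) * (fderiv ℝ g p ((1 : ℂ), (0 : ℂ)) + Complex.I * fderiv ℝ g p (Complex.I, (0 : ℂ)))

/-- Wirtinger derivative `∂g/∂z̄₂`. -/
def wdbar2 (g : C2 → ℂ) (p : C2) : ℂ :=
  (1 / 2 : ℂ) * (fderiv ℝ g p ((0 : ℂ), (1 : ℂ)) + Complex.I * fderiv ℝ g p ((0 : ℂ), Complex.I))

/-- Complexification of a real-valued function. -/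
def oc (ρ : C2 → ℝ) : C2 → ℂ := fun p => ((ρ p : ℝ) : ℂ)

/-- Levi form `L_ρ(p)(t) = Σ_{j,k} ∂²ρ/∂z_j∂z̄_k (p) · t_j · conj t_k`. -/
def levi (ρ : C2 → ℝ) (p t : C2) : ℂ :=
  wd1 (wdbar1 (oc ρ)) p * t.1 * (starRingEnd ℂ) t.1 +
  wd1 (wdbar2 (oc ρ)) p * t.1 * (starRingEnd ℂ) t.2 +
  wd2 (wdbar1 (oc ρ)) p * t.2 * (starRingEnd ℂ) t.1 +
  wd2 (wdbar2 (oc ρ)) p * t.2 * (starRingEnd ℂ) t.2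

/-- `t` lies in the complex tangent space at `p` of the level set `{ρ = 0}`:
`∂ρ/∂z₁(p) t₁ + ∂ρ/∂z₂(p) t₂ = 0`. -/
def tangentVec (ρ : C2 → ℝ) (p t : C2) : Prop :=
  wd1 (oc ρ) p * t.1 + wd2 (oc ρ) p * t.2 = 0

/-- Strong pseudoconvexity at `p` w.r.t. the defining function `ρ`:
the Levi form is positive on all nonzero complex tangent vectors. -/
def StronglyPseudoconvexAt (ρ : C2 → ℝ) (p : C2) : Prop :=
  ∀ t : C2, tangentVec ρ p t → t ≠ 0 → 0 < (levi ρ p t).re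

/-- Pseudoconvexity at `p` w.r.t. the defining function `ρ`:
the Levi form is nonnegative on complex tangent vectors. -/
def PseudoconvexAt (ρ : C2 → ℝ) (p : C2) : Prop :=
  ∀ t : C2, tangentVec ρ p t → 0 ≤ (levi ρ p t).re

/-- Levi degeneracy at `p` w.r.t. the defining function `ρ`:
the Levi form vanishes identically on the complex tangent space. -/
def LeviDegenerateAt (ρ : C2 → ℝ) (p : C2) : Prop :=
  ∀ t : C2, tangentVec ρ p t → levi ρ p t = 0

open Topology

/-- A several-variable power series with geometrically bounded coefficients is analytic. -/
lemma analyticAt_of_coeffs {ι : Type} [Fintype ι] (κ : ℕ → Type) [∀ n, Fintype (κ n)]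
    (wd : ∀ n, κ n → Fin n → ι) (c : ∀ n, κ n → ℂ) (C a : ℝ)
    (hc : ∀ n, ∑ i, ‖c n i‖ ≤ C * a ^ n) :
    AnalyticAt ℂ (fun x : ι → ℂ => ∑' n, ∑ i : κ n, (∏ k, x (wd n i k)) * c n i) 0 := by
  let P : FormalMultilinearSeries ℂ (ι → ℂ) ℂ := fun n =>
    ∑ i : κ n, (((ContinuousMultilinearMap.mkPiAlgebra ℂ (Fin n) ℂ).compContinuousLinearMap
      (fun k => ContinuousLinearMap.proj (R := ℂ) (φ := fun _ : ι => ℂ) (wd n i k))).smulRight (c n i))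
  have hP : ∀ n, ‖P n‖ ≤ C * a ^ n := by
    intro n
    refine (norm_sum_le _ _).trans ((Finset.sum_le_sum ?_).trans (hc n))
    intro i _
    rw [ContinuousMultilinearMap.norm_smulRight]
    refine mul_le_of_le_one_left (norm_nonneg _) ?_
    refine ContinuousMultilinearMap.opNorm_le_bound zero_le_one ?_
    intro m
    simp only [ContinuousMultilinearMap.compContinuousLinearMap_apply,
      ContinuousMultilinearMap.mkPiAlgebra_apply, ContinuousLinearMap.proj_apply, norm_prod, one_mul]
    exact Finset.prod_le_prod (fun _ _ => norm_nonneg _) (fun k _ => norm_le_pi_norm _ _)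
  have hrad : 0 < P.radius := by
    have ha : ∃ s : NNReal, 0 < s ∧ |a| * s ≤ 1 := by
      refine ⟨⟨1 / (|a| + 1), by positivity⟩, ?_, ?_⟩
      · exact_mod_cast (show (0:ℝ) < 1 / (|a| + 1) by positivity)
      · show |a| * (1 / (|a| + 1)) ≤ 1
        rw [mul_one_div, div_le_one (by positivity)]; linarith
    obtain ⟨s, hs, has⟩ := ha
    refine lt_of_lt_of_le (by exact_mod_cast hs) (P.le_radius_of_bound |C| (r := s) ?_)
    intro n
    calc ‖P n‖ * (s:ℝ) ^ n ≤ (|C| * |a| ^ n) * (s:ℝ)^n := by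
          gcongr
          refine (hP n).trans ((le_abs_self _).trans ?_)
          rw [abs_mul, abs_pow]
      _ = |C| * (|a| * s) ^ n := by rw [mul_pow]; ring
      _ ≤ |C| * 1 := by
          gcongr
          exact pow_le_one₀ (by positivity) has
      _ = |C| := mul_one _
  have h := (P.hasFPowerSeriesOnBall hrad).analyticAt
  have he : P.sum = (fun x : ι → ℂ => ∑' n, ∑ i : κ n, (∏ k, x (wd n i k)) * c n i) := by
    funext x
    simp only [FormalMultilinearSeries.sum]
    congr 1
    funext n
    simp [P]
  rwa [he] at h

attribute [fun_prop] analyticAt_fst analyticAt_snd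



/-- Coordinatewise conjugation on `ℂ²`. -/
def cj (x : C2) : C2 := ((starRingEnd ℂ) x.1, (starRingEnd ℂ) x.2)

lemma cj_cj (x : C2) : cj (cj x) = x := by simp [cj]
lemma continuous_cj : Continuous cj := by unfold cj; fun_prop

/-- The real basis of `ℂ²`. -/
def bas : Fin 4 → C2 := ![(1, 0), (I, 0), (0, 1), (0, I)]

lemma norm_bas (j : Fin 4) : ‖bas j‖ ≤ 1 := by
  fin_cases j <;> simp [bas, Prod.norm_def]

/-- Real coordinates of a vector of `ℂ²`. -/
def rco (x : C2) : Fin 4 → ℝ := ![x.1.re, x.1.im, x.2.re, x.2.im]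

lemma rco_sum (x : C2) : x = ∑ j, rco x j • bas j := by
  simp [Fin.sum_univ_four, rco, bas]

/-- complexified coordinates -/
def cco (p : C2) (y : C2 × C2) : Fin 4 → ℂ :=
  ![((y.1.1 - p.1) + (y.2.1 - (starRingEnd ℂ) p.1)) / 2,
    -I * ((y.1.1 - p.1) - (y.2.1 - (starRingEnd ℂ) p.1)) / 2,
    ((y.1.2 - p.2) + (y.2.2 - (starRingEnd ℂ) p.2)) / 2,
    -I * ((y.1.2 - p.2) - (y.2.2 - (starRingEnd ℂ) p.2)) / 2]

/-- Polarization of a real analytic function. -/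
lemma polarize (r : C2 → ℝ) (p : C2) (hr : AnalyticAt ℝ r p) :
    ∃ R : C2 × C2 → ℂ, AnalyticAt ℂ R (p, cj p) ∧ (∀ᶠ x in 𝓝 p, R (x, cj x) = r x) ∧
      ∀ x ξ, R (cj ξ, cj x) = (starRingEnd ℂ) (R (x, ξ)) := by
  obtain ⟨P, s, hP⟩ := hr
  have hpos : 0 < P.radius := lt_of_lt_of_le hP.r_pos hP.r_le
  obtain ⟨t, ht0, htr⟩ := ENNReal.lt_iff_exists_nnreal_btwn.1 hpos
  have ht0' : (0:ℝ) < t := by exact_mod_cast ht0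
  obtain ⟨C, hC, hbd⟩ := P.norm_mul_pow_le_of_lt_radius htr
  let c : ∀ n, (Fin n → Fin 4) → ℂ := fun n i => ((P n (fun k => bas (i k)) : ℝ) : ℂ)
  let Rh : (Fin 4 → ℂ) → ℂ := fun x => ∑' n, ∑ i : (Fin n → Fin 4), (∏ k, x (i k)) * c n i
  have hRh : AnalyticAt ℂ Rh 0 := by
    refine analyticAt_of_coeffs (fun n => (Fin n → Fin 4)) (fun n i => i) c C (4 / t) ?_
    intro n
    calc ∑ i, ‖c n i‖ ≤ ∑ i : (Fin n → Fin 4), ‖P n‖ := by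
          refine Finset.sum_le_sum fun i _ => ?_
          simp only [c, Complex.norm_real]
          refine ((P n).le_opNorm _).trans (mul_le_of_le_one_right (norm_nonneg _) ?_)
          exact Finset.prod_le_one (fun _ _ => norm_nonneg _) (fun _ _ => norm_bas _)
      _ = 4 ^ n * ‖P n‖ := by simp
      _ ≤ 4 ^ n * (C / t ^ n) := by
          gcongr
          rw [le_div_iff₀ (by positivity)]
          exact hbd n
      _ = C * (4 / t) ^ n := by rw [div_pow]; ring
  have hA : AnalyticAt ℂ (cco p) (p, cj p) := by
    rw [analyticAt_pi_iff]
    intro j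
    fin_cases j <;> simp only [cco] <;> simp <;> fun_prop
  have hA0 : cco p (p, cj p) = 0 := by
    funext j; fin_cases j <;> simp [cco, cj]
  refine ⟨fun y => Rh (cco p y), ?_, ?_, ?_⟩
  · exact AnalyticAt.comp (by rw [hA0]; exact hRh) hA
  · have h1 : ∀ x, cco p (x, cj x) = fun j => ((rco (x - p) j : ℝ) : ℂ) := by
      intro x; funext j
      fin_cases j <;> simp [cco, cj, rco, Complex.ext_iff] <;> ring
    have h2 := hP.eventually_hasSum_sub
    filter_upwards [h2] with x hx
    rw [h1]
    simp only [Rh]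
    rw [← hx.tsum_eq, Complex.ofReal_tsum]
    congr 1
    funext n
    have : P n (fun _ => x - p) = ∑ i : (Fin n → Fin 4), (∏ k, rco (x-p) (i k)) • P n (fun k => bas (i k)) := by
      conv_lhs => rw [rco_sum (x - p)]
      rw [ContinuousMultilinearMap.map_sum]
      refine Finset.sum_congr rfl fun i _ => ?_
      exact (P n).map_smul_univ _ _
    rw [this]
    simp [c]
  · intro x ξ
    have h1 : cco p (cj ξ, cj x) = fun j => (starRingEnd ℂ) (cco p (x, ξ) j) := by
      funext j
      have h2 : (starRingEnd ℂ) (2:ℂ) = 2 := Complex.conj_ofNat 2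
      fin_cases j <;> simp [cco, cj, h2] <;> ring
    simp only [Rh]
    rw [h1, Complex.conj_tsum]
    congr 1
    funext n
    simp [c, map_sum, map_prod]


/-- Cauchy coefficient as a real integral. -/
def Kc (R : ℝ) (n : ℕ) (φ : ℝ → ℂ) : ℂ :=
  (2 * Real.pi : ℂ)⁻¹ * ∫ θ in (0:ℝ)..2 * Real.pi, ((circleMap 0 R θ)⁻¹) ^ n * φ θ

lemma Kc_hasSum {f : ℂ → ℂ} {R : ℝ} (hR : 0 < R) (hf : DiffContOnCl ℂ f (ball 0 R)) {w : ℂ}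
    (hw : ‖w‖ < R) : HasSum (fun n => w ^ n * Kc R n (fun θ => f (circleMap 0 R θ))) (f w) := by
  lift R to NNReal using hR.le
  have h := DiffContOnCl.hasFPowerSeriesOnBall hf (by exact_mod_cast hR)
  have h2 := h.hasSum (y := w) (by simpa [← coe_nnnorm] using hw)
  simp only [zero_add] at h2
  refine Eq.mp ?_ h2
  congr 1
  funext n
  symm
  rw [cauchyPowerSeries_apply, circleIntegral, Kc]
  rw [smul_eq_mul, ← intervalIntegral.integral_const_mul, ← intervalIntegral.integral_const_mul,
    ← intervalIntegral.integral_const_mul]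
  congr 1
  funext θ
  have : circleMap 0 (R:ℝ) θ ≠ 0 := by
    simp only [ne_eq, circleMap_eq_center_iff]; exact hR.ne'
  have hpi : (Real.pi : ℂ) ≠ 0 := by exact_mod_cast Real.pi_ne_zero
  simp only [deriv_circleMap, smul_eq_mul, sub_zero, div_pow, inv_pow]
  field_simp

lemma Kc_norm {R : ℝ} (hR : 0 < R) (n : ℕ) (φ : ℝ → ℂ) {B : ℝ} (h : ∀ θ, ‖φ θ‖ ≤ B) :
    ‖Kc R n φ‖ ≤ B * R⁻¹ ^ n := by
  have := intervalIntegral.norm_integral_le_of_norm_le_const (a := 0) (b := 2 * Real.pi)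
    (f := fun θ => ((circleMap 0 R θ)⁻¹) ^ n * φ θ) (C := B * R⁻¹ ^ n) (by
      intro θ _
      rw [norm_mul, norm_pow, norm_inv, norm_circleMap_zero, abs_of_pos hR, mul_comm]
      gcongr; exact h θ)
  rw [Kc, norm_mul]
  have h2 : ‖(2 * Real.pi : ℂ)⁻¹‖ = (2 * Real.pi)⁻¹ := by
    rw [norm_inv]; simp [abs_of_pos Real.pi_pos]
  rw [h2]
  rw [sub_zero, abs_of_pos (by positivity)] at this
  calc _ ≤ (2 * Real.pi)⁻¹ * (B * R⁻¹ ^ n * (2 * Real.pi)) := by gcongr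
    _ = _ := by field_simp

lemma Kc_hasSum_swap {R : ℝ} (hR : 0 < R) (n : ℕ) (ψ : ℕ → ℝ → ℂ) (φ : ℝ → ℂ)
    (hc : ∀ m, Continuous (ψ m)) (b : ℕ → ℝ) (hb : Summable b) (hψ : ∀ m θ, ‖ψ m θ‖ ≤ b m)
    (hs : ∀ θ, HasSum (fun m => ψ m θ) (φ θ)) :
    HasSum (fun m => Kc R n (ψ m)) (Kc R n φ) := by
  unfold Kc
  apply HasSum.mul_left
  have hcm : Continuous fun θ => (circleMap 0 R θ)⁻¹ := by
    refine (continuous_circleMap 0 R).inv₀ fun θ => ?_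
    simp only [ne_eq, circleMap_eq_center_iff]; exact hR.ne'
  apply intervalIntegral.hasSum_integral_of_dominated_convergence (fun m _ => R⁻¹ ^ n * b m)
  · intro m
    exact ((hcm.pow n).mul (hc m)).aestronglyMeasurable
  · intro m
    refine .of_forall fun θ _ => ?_
    rw [norm_mul, norm_pow, norm_inv, norm_circleMap_zero, abs_of_pos hR]
    gcongr; exact hψ m θ
  · exact .of_forall fun θ _ => hb.mul_left _
  · exact intervalIntegrable_const
  · exact .of_forall fun θ _ => (hs θ).mul_left _

lemma Kc_continuous {R : ℝ} (hR : 0 < R) (m : ℕ) (G : ℝ → ℝ → ℂ)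
    (hG : Continuous (Function.uncurry G)) : Continuous fun θ => Kc R m (G θ) := by
  unfold Kc
  refine continuous_const.mul ?_
  refine intervalIntegral.continuous_parametric_intervalIntegral_of_continuous ?_ continuous_const
  have hcm : Continuous fun θ => (circleMap 0 R θ)⁻¹ := by
    refine (continuous_circleMap 0 R).inv₀ fun θ => ?_
    simp only [ne_eq, circleMap_eq_center_iff]; exact hR.ne'
  exact ((hcm.comp continuous_snd).pow m).mul hG

lemma prod_word (N : ℕ) (i : Fin (N+1)) (x : Fin 2 → ℂ) :
    ∏ k : Fin N, x (if (k:ℕ) < i then 0 else 1) = x 0 ^ (i:ℕ) * x 1 ^ (N - i) := by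
  have : ∀ k : Fin N, x (if (k:ℕ) < i then 0 else 1) = if (k:ℕ) < i then x 0 else x 1 := by
    intro k; split_ifs <;> rfl
  simp_rw [this]
  rw [Fin.prod_univ_eq_prod_range (fun k => if k < (i:ℕ) then x 0 else x 1) N]
  obtain ⟨i, hi⟩ := i
  simp only
  obtain ⟨j, rfl⟩ : ∃ j, N = i + j := ⟨N - i, by omega⟩
  rw [Finset.prod_range_add, Nat.add_sub_cancel_left]
  congr 1
  · rw [Finset.prod_congr rfl (g := fun _ => x 0)]
    · simp
    · intro k hk; simp at hk; simp [hk]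
  · rw [Finset.prod_congr rfl (g := fun _ => x 1)]
    · simp
    · intro k hk; simp

lemma osgood0 (g : C2 → ℂ) (R : ℝ) (hR : 0 < R) (hg : DifferentiableOn ℂ g (closedBall 0 R)) :
    AnalyticAt ℂ g 0 := by
  have mem : ∀ {z w : ℂ}, ‖z‖ ≤ R → ‖w‖ ≤ R → (z, w) ∈ closedBall (0 : C2) R := by
    intro z w hz hw; rw [mem_closedBall_zero_iff, Prod.norm_def]; exact max_le hz hw
  have cmem : ∀ θ, ‖circleMap 0 R θ‖ ≤ R := fun θ => by
    rw [norm_circleMap_zero, abs_of_pos hR]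
  obtain ⟨B, hB⟩ := (isCompact_closedBall (0 : C2) R).exists_bound_of_continuousOn hg.continuousOn
  have hd1 : ∀ w, ‖w‖ ≤ R → DiffContOnCl ℂ (fun z => g (z, w)) (ball 0 R) := by
    intro w hw
    apply DifferentiableOn.diffContOnCl
    rw [closure_ball _ hR.ne']
    refine hg.comp (t := closedBall 0 R) (f := fun z : ℂ => ((z, w) : C2)) (by fun_prop) ?_
    intro z hz
    exact mem (by simpa using hz) hw
  have hd2 : ∀ z, ‖z‖ ≤ R → DiffContOnCl ℂ (fun w => g (z, w)) (ball 0 R) := by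
    intro z hz
    apply DifferentiableOn.diffContOnCl
    rw [closure_ball _ hR.ne']
    refine hg.comp (t := closedBall 0 R) (f := fun w : ℂ => ((z, w) : C2)) (by fun_prop) ?_
    intro w hw
    exact mem hz (by simpa using hw)
  set d : ℕ → ℝ → ℂ := fun m θ => Kc R m (fun η => g (circleMap 0 R θ, circleMap 0 R η)) with hdd
  have hdc : ∀ m, Continuous (d m) := by
    intro m
    refine Kc_continuous hR m (fun θ η => g (circleMap 0 R θ, circleMap 0 R η)) ?_
    refine hg.continuousOn.comp_continuous (f := fun x : ℝ × ℝ => ((circleMap 0 R x.1, circleMap 0 R x.2) : C2)) ?_ ?_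
    · exact ((continuous_circleMap 0 R).comp continuous_fst).prodMk
        ((continuous_circleMap 0 R).comp continuous_snd)
    · intro x; exact mem (cmem _) (cmem _)
  have hdn : ∀ m θ, ‖d m θ‖ ≤ B * R⁻¹ ^ m := fun m θ =>
    Kc_norm hR m _ fun η => hB _ (mem (cmem _) (cmem _))
  set c : ℕ → ℕ → ℂ := fun n m => Kc R n (d m) with hcd
  have hcn : ∀ n m, ‖c n m‖ ≤ B * R⁻¹ ^ m * R⁻¹ ^ n := fun n m => Kc_norm hR n _ (hdn m)
  have hB0 : 0 ≤ B := (norm_nonneg _).trans (hB 0 (by simp [hR.le]))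
  have hsw : ∀ n w, ‖w‖ < R → HasSum (fun m => w ^ m * c n m)
      (Kc R n (fun θ => g (circleMap 0 R θ, w))) := by
    intro n w hw
    have := Kc_hasSum_swap hR n (fun m θ => w ^ m * d m θ) (fun θ => g (circleMap 0 R θ, w))
      (fun m => continuous_const.mul (hdc m)) (fun m => B * (‖w‖ * R⁻¹) ^ m)
      ((summable_geometric_of_lt_one (by positivity) (by
        rw [← div_eq_mul_inv]; exact (div_lt_one hR).2 hw)).mul_left _)
      (by
        intro m θ
        rw [norm_mul, norm_pow, mul_pow]
        calc _ ≤ ‖w‖ ^ m * (B * R⁻¹ ^ m) := by gcongr; exact hdn m θ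
          _ = _ := by ring)
      (fun θ => Kc_hasSum hR (hd2 _ (cmem θ)) hw)
    convert this using 2 with m
    simp only [hcd, Kc, ← intervalIntegral.integral_const_mul]
    congr 1; funext θ; ring
  -- final formula
  have key : ∀ z w : ℂ, ‖z‖ < R → ‖w‖ < R →
      g (z, w) = ∑' N, ∑ i : Fin (N+1), (z ^ (i:ℕ) * w ^ (N - i)) * c i (N - i) := by
    intro z w hz hw
    have hsum : Summable fun x : ℕ × ℕ => z ^ x.1 * (w ^ x.2 * c x.1 x.2) := by
      have hs1 := summable_geometric_of_lt_one (r := ‖z‖ * R⁻¹) (by positivity) (by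
        rw [← div_eq_mul_inv]; exact (div_lt_one hR).2 hz)
      have hs2 := (summable_geometric_of_lt_one (r := ‖w‖ * R⁻¹) (by positivity) (by
        rw [← div_eq_mul_inv]; exact (div_lt_one hR).2 hw)).mul_left B
      refine Summable.of_norm_bounded (hs1.mul_of_nonneg hs2 (fun _ => by positivity)
        (fun _ => by positivity)) ?_
      rintro ⟨n, m⟩
      simp only [norm_mul, norm_pow, mul_pow]
      calc _ ≤ ‖z‖ ^ n * (‖w‖ ^ m * (B * R⁻¹ ^ m * R⁻¹ ^ n)) := by gcongr; exact hcn n m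
        _ = _ := by ring
    have h1 : HasSum (fun x : ℕ × ℕ => z ^ x.1 * (w ^ x.2 * c x.1 x.2)) (g (z, w)) := by
      have h2 := hsum.hasSum.prod_fiberwise (fun n => (hsw n w hw).mul_left (z ^ n))
      have h3 := Kc_hasSum hR (hd1 w hw.le) hz
      have := hsum.hasSum
      rwa [h2.unique h3] at this
    have h2 := (Finset.HasAntidiagonal.sigmaAntidiagonalEquivProd (A := ℕ)).hasSum_iff.2 h1
    have h3 := h2.sigma (fun N => hasSum_fintype _)
    rw [← h3.tsum_eq]
    congr 1; funext N
    have := Finset.sum_coe_sort (Finset.HasAntidiagonal.antidiagonal N)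
      (fun x : ℕ × ℕ => z ^ x.1 * (w ^ x.2 * c x.1 x.2))
    refine this.trans ?_
    rw [Finset.Nat.sum_antidiagonal_eq_sum_range_succ (fun i j => z ^ i * (w ^ j * c i j)) N,
      Finset.sum_range]
    refine Finset.sum_congr rfl fun i _ => by ring
  have hA := analyticAt_of_coeffs (ι := Fin 2) (fun N => Fin (N+1))
    (fun N i k => if (k:ℕ) < i then 0 else 1) (fun N i => c i (N - i)) B (2 * R⁻¹) (by
      intro N
      calc ∑ i : Fin (N+1), ‖c i (N - i)‖ ≤ ∑ i : Fin (N+1), B * R⁻¹ ^ N := by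
            refine Finset.sum_le_sum fun i _ => (hcn _ _).trans (le_of_eq ?_)
            rw [mul_assoc, ← pow_add]; congr 2; omega
        _ = (N+1) * (B * R⁻¹ ^ N) := by simp
        _ ≤ 2 ^ N * (B * R⁻¹ ^ N) := by
            gcongr
            exact_mod_cast Nat.lt_two_pow_self
        _ = _ := by rw [mul_pow]; ring)
  have hL : AnalyticAt ℂ (fun x : C2 => (![x.1, x.2] : Fin 2 → ℂ)) 0 := by
    rw [analyticAt_pi_iff]
    intro i; fin_cases i
    · exact analyticAt_fst
    · exact analyticAt_snd
  have h0 : (fun x : C2 => (![x.1, x.2] : Fin 2 → ℂ)) 0 = 0 := by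
    funext i; fin_cases i <;> simp
  have hA' := hA
  rw [← h0] at hA'
  have := AnalyticAt.comp (x := (0 : C2)) hA' hL
  refine this.congr ?_
  filter_upwards [ball_mem_nhds (0 : C2) hR] with x hx
  rw [mem_ball_zero_iff, Prod.norm_def, max_lt_iff] at hx
  obtain ⟨z, w⟩ := x
  rw [key z w hx.1 hx.2]
  simp only [Function.comp, prod_word]
  simp

lemma osgood {g : C2 → ℂ} {p : C2} (hg : ∀ᶠ x in 𝓝 p, DifferentiableAt ℂ g x) :
    AnalyticAt ℂ g p := by
  obtain ⟨R, hR, h⟩ := Metric.eventually_nhds_iff_ball.1 hg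
  have := osgood0 (fun x => g (x + p)) (R/2) (by positivity) (by
    intro x hx
    have : DifferentiableAt ℂ g (x + p) := h _ (by
      simp at hx ⊢; linarith)
    exact (this.comp (f := fun x => x + p) x (by fun_prop)).differentiableWithinAt)
  have h2 := AnalyticAt.comp (g := fun x => g (x + p)) (f := fun x : C2 => x - p) (x := p)
    (by simpa using this) (by fun_prop)
  simpa [Function.comp_def] using h2

lemma osgood2 {F : C2 → C2} {p : C2} (hF : ∀ᶠ x in 𝓝 p, DifferentiableAt ℂ F x) :
    AnalyticAt ℂ F p := by
  have h1 : AnalyticAt ℂ (fun x => (F x).1) p := osgood (hF.mono fun x hx => by fun_prop)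
  have h2 : AnalyticAt ℂ (fun x => (F x).2) p := osgood (hF.mono fun x hx => by fun_prop)
  exact h1.prod h2


/-- Coordinatewise conjugation as a real linear map. -/
def cjL : C2 →L[ℝ] C2 :=
  (Complex.conjCLE.toContinuousLinearMap.comp (ContinuousLinearMap.fst ℝ ℂ ℂ)).prod
    (Complex.conjCLE.toContinuousLinearMap.comp (ContinuousLinearMap.snd ℝ ℂ ℂ))

lemma cjL_apply (x : C2) : cjL x = cj x := by simp [cjL, cj]

lemma clm_c2 (L : C2 →L[ℂ] ℂ) (v : C2) : L v = L (1, 0) * v.1 + L (0, 1) * v.2 := by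
  have : v = v.1 • ((1, 0) : C2) + v.2 • ((0, 1) : C2) := by ext <;> simp
  conv_lhs => rw [this, map_add, map_smul, map_smul]
  simp [mul_comm]

/-- conjugate functional -/
def conjF (L : C2 →L[ℂ] ℂ) : C2 →L[ℂ] ℂ :=
  ((starRingEnd ℂ) (L (1, 0))) • (ContinuousLinearMap.fst ℂ ℂ ℂ) +
    ((starRingEnd ℂ) (L (0, 1))) • (ContinuousLinearMap.snd ℂ ℂ ℂ)

lemma hasFDerivAt_conj {g : C2 → ℂ} {ξ : C2} {L : C2 →L[ℂ] ℂ} (h : HasFDerivAt g L (cj ξ)) :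
    HasFDerivAt (fun ξ => (starRingEnd ℂ) (g (cj ξ))) (conjF L) ξ := by
  have h1 : HasFDerivAt cj cjL ξ := by
    have := cjL.hasFDerivAt (x := ξ)
    exact this.congr_of_eventuallyEq (.of_forall fun x => (cjL_apply x).symm)
  have h2 := (h.restrictScalars ℝ).comp ξ h1
  have h3 := (Complex.conjCLE.toContinuousLinearMap.hasFDerivAt (x := g (cj ξ))).comp ξ h2
  refine hasFDerivAt_of_restrictScalars ℝ h3 ?_
  ext v
  · simp [conjF, cjL_apply, cj]
    rw [clm_c2 L ((starRingEnd ℂ) v, 0)]; simp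
  · simp [conjF, cjL_apply, cj]
    rw [clm_c2 L (0, (starRingEnd ℂ) v)]; simp

lemma analyticAt_conj {g : C2 → ℂ} {ξ : C2} (h : AnalyticAt ℂ g (cj ξ)) :
    AnalyticAt ℂ (fun ξ => (starRingEnd ℂ) (g (cj ξ))) ξ := by
  apply osgood
  have := h.eventually_analyticAt
  have h2 := (continuous_cj.tendsto ξ).eventually this
  filter_upwards [h2] with x hx
  exact (hasFDerivAt_conj hx.differentiableAt.hasFDerivAt).differentiableAt

lemma analyticAt_conj2 {F : C2 → C2} {ξ : C2} (h : AnalyticAt ℂ F (cj ξ)) :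
    AnalyticAt ℂ (fun ξ => cj (F (cj ξ))) ξ := by
  have h1 : AnalyticAt ℂ (fun x => (F x).1) (cj ξ) := by fun_prop
  have h2 : AnalyticAt ℂ (fun x => (F x).2) (cj ξ) := by fun_prop
  exact (analyticAt_conj h1).prod (analyticAt_conj h2)


/-- Analytic inverse function theorem, for endomaps of finite dimensional spaces. -/
lemma inv_fn {𝕜 E : Type*} [NontriviallyNormedField 𝕜] [CompleteSpace 𝕜]
    [NormedAddCommGroup E] [NormedSpace 𝕜 E] [CompleteSpace E] [FiniteDimensional 𝕜 E]
    {Φ : E → E} {a : E} (hΦ : AnalyticAt 𝕜 Φ a) (hinj : ∀ v, fderiv 𝕜 Φ a v = 0 → v = 0) :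
    ∃ Θ : E → E, AnalyticAt 𝕜 Θ (Φ a) ∧ Θ (Φ a) = a ∧ (∀ᶠ x in 𝓝 a, Θ (Φ x) = x) ∧
      (∀ᶠ y in 𝓝 (Φ a), Φ (Θ y) = y) := by
  have hi : Function.Injective (fderiv 𝕜 Φ a : E →ₗ[𝕜] E) :=
    (injective_iff_map_eq_zero _).2 hinj
  set e := (LinearEquiv.ofInjectiveEndo _ hi).toContinuousLinearEquiv with he
  have hee : (e : E →L[𝕜] E) = fderiv 𝕜 Φ a := by ext v; simp [he]
  have hs : HasStrictFDerivAt Φ (e : E →L[𝕜] E) a := by rw [hee]; exact hΦ.hasStrictFDerivAt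
  set H := hs.toOpenPartialHomeomorph Φ with hH
  have hc : (H : E → E) = Φ := hs.toOpenPartialHomeomorph_coe
  have hm : a ∈ H.source := hs.mem_toOpenPartialHomeomorph_source
  refine ⟨H.symm, ?_, ?_, ?_, ?_⟩
  · have := H.analyticAt_symm' hm (by rw [hc]; exact hΦ) (i := e) (by rw [hc, hee])
    rwa [hc] at this
  · have := H.left_inv hm
    rwa [hc] at this
  · filter_upwards [H.open_source.mem_nhds hm] with x hx
    have := H.left_inv hx
    rwa [hc] at this
  · have : Φ a ∈ H.target := by have := H.map_source hm; rwa [hc] at this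
    filter_upwards [H.open_target.mem_nhds this] with y hy
    have := H.right_inv hy
    rwa [hc] at this

/-- Analytic implicit function theorem. -/
lemma ift {X : Type*} [NormedAddCommGroup X] [NormedSpace ℂ X] [FiniteDimensional ℂ X]
    [CompleteSpace X] {φ : X × ℂ → ℂ}
    (hφ : AnalyticAt ℂ φ 0) (h0 : φ 0 = 0) (hu : fderiv ℂ φ 0 (0, 1) ≠ 0) :
    ∃ g : X → ℂ, AnalyticAt ℂ g 0 ∧ g 0 = 0 ∧ ∀ᶠ y : X × ℂ in 𝓝 0, (φ y = 0 ↔ y.2 = g y.1) := by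
  set Φ : X × ℂ → X × ℂ := fun y => (y.1, φ y) with hΦd
  have hΦ : AnalyticAt ℂ Φ 0 := analyticAt_fst.prod hφ
  have hΦ0 : Φ 0 = 0 := by simp only [hΦd, h0]; rfl
  have hd : HasFDerivAt Φ ((ContinuousLinearMap.fst ℂ X ℂ).prod (fderiv ℂ φ 0)) 0 :=
    hasFDerivAt_fst.prodMk hφ.differentiableAt.hasFDerivAt
  obtain ⟨Θ, hΘ, hΘ0, hl, hr⟩ := inv_fn hΦ (by
    intro v hv
    rw [hd.fderiv] at hv
    obtain ⟨x, u⟩ := v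
    simp only [ContinuousLinearMap.prod_apply, ContinuousLinearMap.coe_fst', Prod.mk_eq_zero] at hv
    obtain ⟨rfl, hv⟩ := hv
    have : ((0 : X), u) = u • ((0 : X), (1:ℂ)) := by simp
    rw [this, map_smul, smul_eq_mul, mul_eq_zero] at hv
    rcases hv with h | h
    · simp [h]
    · exact absurd h hu)
  rw [hΦ0] at hΘ hΘ0 hr
  have ha : AnalyticAt ℂ (fun x : X => ((x, 0) : X × ℂ)) 0 := analyticAt_id.prod analyticAt_const
  refine ⟨fun x => (Θ (x, 0)).2, ?_, ?_, ?_⟩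
  · have : AnalyticAt ℂ (fun x : X => Θ (x, 0)) 0 := AnalyticAt.comp (g := Θ) (f := fun x : X => ((x, 0) : X × ℂ)) hΘ ha
    exact analyticAt_snd.comp this
  · show (Θ 0).2 = 0; rw [hΘ0]; rfl
  · have hpr : Tendsto (fun y : X × ℂ => ((y.1, 0) : X × ℂ)) (𝓝 0) (𝓝 0) := by
      have : Continuous (fun y : X × ℂ => ((y.1, 0) : X × ℂ)) := by fun_prop
      exact this.tendsto' 0 0 rfl
    filter_upwards [hl, hpr.eventually hr] with y h1 h2
    constructor
    · intro h
      have : Φ y = (y.1, 0) := by simp [hΦd, h]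
      rw [this] at h1
      rw [h1]
    · intro h
      have h3 : (Θ (y.1, 0)).1 = y.1 := by
        have := congrArg Prod.fst h2; simpa [hΦd] using this
      have h4 : Θ (y.1, 0) = y := Prod.ext h3 h.symm
      rw [h4] at h2
      have := congrArg Prod.snd h2; simpa [hΦd] using this

lemma real_vanish1 {h : ℂ → ℂ} {ε : ℝ} (hε : 0 < ε) (ha : AnalyticOnNhd ℂ h (ball 0 ε))
    (hz : ∀ s : ℝ, |s| < ε → h s = 0) : ∀ z ∈ ball (0:ℂ) ε, h z = 0 := by
  refine ha.eqOn_zero_of_preconnected_of_frequently_eq_zero (convex_ball 0 ε).isPreconnected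
    (mem_ball_self hε) ?_
  have ht : Tendsto (fun s : ℝ => (s : ℂ)) (𝓝[≠] 0) (𝓝[≠] 0) := by
    refine tendsto_nhdsWithin_iff.2 ⟨?_, ?_⟩
    · exact (Complex.continuous_ofReal.tendsto' 0 0 (by simp)).mono_left nhdsWithin_le_nhds
    · filter_upwards [self_mem_nhdsWithin] with s hs
      simpa using hs
  refine ht.frequently (Eventually.frequently ?_)
  filter_upwards [nhdsWithin_le_nhds (ball_mem_nhds (0:ℝ) hε)] with s hs
  exact hz s (by simpa using hs)

/-- A holomorphic function on `ℂ³` vanishing at real points vanishes. -/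
lemma real_vanish {H : ℂ × ℂ × ℂ → ℂ} (hH : AnalyticAt ℂ H 0)
    (hz : ∀ᶠ y : ℝ × ℝ × ℝ in 𝓝 0, H ((y.1 : ℂ), (y.2.1 : ℂ), (y.2.2 : ℂ)) = 0) :
    ∀ᶠ y in 𝓝 0, H y = 0 := by
  obtain ⟨ε1, h1, hA⟩ := Metric.eventually_nhds_iff_ball.1 hH.eventually_analyticAt
  obtain ⟨ε2, h2, hB⟩ := Metric.eventually_nhds_iff_ball.1 hz
  set ε := min ε1 ε2 with hεd
  have hε : 0 < ε := lt_min h1 h2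
  have A : ∀ a b c : ℂ, ‖a‖ < ε → ‖b‖ < ε → ‖c‖ < ε → AnalyticAt ℂ H (a, b, c) := by
    intro a b c ha hb hc
    refine hA _ ?_
    rw [mem_ball_zero_iff, Prod.norm_def, Prod.norm_def]
    exact lt_of_lt_of_le (max_lt ha (max_lt hb hc)) (min_le_left _ _)
  have s1 : ∀ s t v : ℝ, |s| < ε → |t| < ε → |v| < ε → H (s, t, v) = 0 := by
    intro a b c ha hb hc
    refine hB (a, b, c) ?_
    rw [mem_ball_zero_iff, Prod.norm_def, Prod.norm_def]
    exact lt_of_lt_of_le (max_lt ha (max_lt hb hc)) (min_le_right _ _)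
  have s2 : ∀ (s : ℂ) (t v : ℝ), ‖s‖ < ε → |t| < ε → |v| < ε → H (s, t, v) = 0 := by
    intro s t v hs ht hv
    refine real_vanish1 (h := fun s => H (s, t, v)) hε ?_ (fun s' hs' => s1 s' t v hs' ht hv) s
      (by simpa using hs)
    intro z hz
    have := A z t v (by simpa using hz) (by simpa using ht) (by simpa using hv)
    exact AnalyticAt.comp (g := H) (f := fun s : ℂ => (s, (t:ℂ), (v:ℂ))) this (by fun_prop)
  have s3 : ∀ (s t : ℂ) (v : ℝ), ‖s‖ < ε → ‖t‖ < ε → |v| < ε → H (s, t, v) = 0 := by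
    intro s t v hs ht hv
    refine real_vanish1 (h := fun t => H (s, t, v)) hε ?_ (fun s' hs' => s2 s s' v hs hs' hv) t
      (by simpa using ht)
    intro z hz
    have := A s z v hs (by simpa using hz) (by simpa using hv)
    exact AnalyticAt.comp (g := H) (f := fun t : ℂ => (s, t, (v:ℂ))) this (by fun_prop)
  have s4 : ∀ (s t v : ℂ), ‖s‖ < ε → ‖t‖ < ε → ‖v‖ < ε → H (s, t, v) = 0 := by
    intro s t v hs ht hv
    refine real_vanish1 (h := fun v => H (s, t, v)) hε ?_ (fun s' hs' => s3 s t s' hs ht hs') v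
      (by simpa using hv)
    intro z hz
    have := A s t z hs ht (by simpa using hz)
    exact AnalyticAt.comp (g := H) (f := fun v : ℂ => (s, t, v)) this (by fun_prop)
  filter_upwards [ball_mem_nhds 0 hε] with y hy
  rw [mem_ball_zero_iff, Prod.norm_def, Prod.norm_def, max_lt_iff, max_lt_iff] at hy
  exact s4 _ _ _ hy.1 hy.2.1 hy.2.2

/-- Persistence of isolated zeros. -/
lemma root_persist {X : Type*} [NormedAddCommGroup X] [NormedSpace ℂ X] {k : ℂ × X → ℂ} {z0 : ℂ}
    {ξ0 : X} (hk : AnalyticAt ℂ k (z0, ξ0)) (h0 : k (z0, ξ0) = 0)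
    (hn : ¬ ∀ᶠ z in 𝓝 z0, k (z, ξ0) = 0) {δ : ℝ} (hδ : 0 < δ) :
    ∀ᶠ ξ in 𝓝 ξ0, ∃ z, ‖z - z0‖ < δ ∧ k (z, ξ) = 0 := by
  have hk1 : AnalyticAt ℂ (fun z => k (z, ξ0)) z0 :=
    AnalyticAt.comp (g := k) (f := fun z : ℂ => (z, ξ0)) hk (by fun_prop)
  have hne := hk1.eventually_eq_zero_or_eventually_ne_zero.resolve_left hn
  rw [eventually_nhdsWithin_iff] at hne
  obtain ⟨ε1, e1, hA⟩ := Metric.eventually_nhds_iff_ball.1 hk.eventually_analyticAt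
  obtain ⟨ε2, e2, hB⟩ := Metric.eventually_nhds_iff_ball.1 hne
  obtain ⟨ρ, hρ0, hρ⟩ : ∃ ρ, 0 < ρ ∧ ρ < min (min ε1 ε2) δ :=
    exists_between (lt_min (lt_min e1 e2) hδ)
  have r1 : ρ < ε1 := hρ.trans_le ((min_le_left _ _).trans (min_le_left _ _))
  have r2 : ρ < ε2 := hρ.trans_le ((min_le_left _ _).trans (min_le_right _ _))
  have r3 : ρ < δ := hρ.trans_le (min_le_right _ _)
  have hcont : ∀ z ∈ closedBall z0 ρ, ∀ ξ ∈ ball ξ0 ε1, AnalyticAt ℂ k (z, ξ) := by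
    intro z hz ξ hξ
    apply hA
    rw [← ball_prod_same]
    exact ⟨lt_of_le_of_lt hz r1, hξ⟩
  have hS : (sphere z0 ρ).Nonempty := NormedSpace.sphere_nonempty.2 hρ0.le
  have hnz : ∀ z ∈ sphere z0 ρ, k (z, ξ0) ≠ 0 := by
    intro z hz
    refine hB z ?_ ?_
    · rw [mem_ball, mem_sphere.1 hz]; exact r2
    · intro h; rw [mem_singleton_iff] at h; rw [h] at hz; simp at hz; exact hρ0.ne hz
  obtain ⟨m, hm0, hm⟩ : ∃ m > 0, ∀ z ∈ sphere z0 ρ, m < ‖k (z, ξ0)‖ := by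
    have hc : ContinuousOn (fun z => ‖k (z, ξ0)‖) (sphere z0 ρ) := by
      intro z hz
      have := (hcont z (sphere_subset_closedBall hz) ξ0 (mem_ball_self e1)).continuousAt
      exact (ContinuousAt.comp (g := fun y => ‖k y‖) (f := fun z : ℂ => (z, ξ0)) this.norm
        (by fun_prop)).continuousWithinAt
    obtain ⟨z1, hz1, hmin⟩ := (isCompact_sphere z0 ρ).exists_isMinOn hS hc
    refine ⟨‖k (z1, ξ0)‖ / 2, by have := norm_pos_iff.2 (hnz z1 hz1); positivity, fun z hz => ?_⟩
    have := norm_pos_iff.2 (hnz z1 hz1)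
    have h2 : ‖k (z1, ξ0)‖ ≤ ‖k (z, ξ0)‖ := hmin hz
    linarith
  have hbig : ∀ᶠ ξ in 𝓝 ξ0, ∀ z ∈ sphere z0 ρ, m < ‖k (z, ξ)‖ := by
    refine (isCompact_sphere z0 ρ).eventually_forall_of_forall_eventually
      (P := fun ξ z => m < ‖k (z, ξ)‖) fun z hz => ?_
    have := (hcont z (sphere_subset_closedBall hz) ξ0 (mem_ball_self e1)).continuousAt
    have h2 : ContinuousAt (fun y : X × ℂ => ‖k (y.2, y.1)‖) (ξ0, z) :=
      ContinuousAt.comp (g := fun y => ‖k y‖) (f := fun y : X × ℂ => (y.2, y.1)) this.norm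
        (by fun_prop)
    exact h2.eventually_const_lt (hm z hz)
  have hsmall : ∀ᶠ ξ in 𝓝 ξ0, ‖k (z0, ξ)‖ < m := by
    have h2 : ContinuousAt (fun ξ : X => ‖k (z0, ξ)‖) ξ0 :=
      ContinuousAt.comp (g := fun y => ‖k y‖) (f := fun ξ : X => (z0, ξ)) hk.continuousAt.norm
        (by fun_prop)
    exact h2.eventually_lt_const (by simpa [h0] using hm0)
  filter_upwards [hbig, hsmall, ball_mem_nhds ξ0 e1] with ξ hb hs hξ
  by_contra hcon
  push Not at hcon
  have hnz2 : ∀ z ∈ closedBall z0 ρ, k (z, ξ) ≠ 0 := fun z hz =>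
    hcon z (lt_of_le_of_lt (by simpa [dist_eq_norm] using hz) r3)
  have hd : DiffContOnCl ℂ (fun z => (k (z, ξ))⁻¹) (ball z0 ρ) := by
    apply DifferentiableOn.diffContOnCl
    rw [closure_ball _ hρ0.ne']
    intro z hz
    have := (hcont z hz ξ hξ)
    have h3 : AnalyticAt ℂ (fun z => k (z, ξ)) z :=
      AnalyticAt.comp (g := k) (f := fun z : ℂ => (z, ξ)) this (by fun_prop)
    exact (h3.differentiableAt.inv (hnz2 z hz)).differentiableWithinAt
  have := Complex.norm_le_of_forall_mem_frontier_norm_le isBounded_ball hd (C := m⁻¹) (by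
    intro z hz
    rw [frontier_ball _ hρ0.ne'] at hz
    rw [norm_inv]
    exact inv_anti₀ hm0 (hb z hz).le) (z := z0) (subset_closure (mem_ball_self hρ0))
  rw [norm_inv] at this
  have hp := norm_pos_iff.2 (hnz2 z0 (mem_closedBall_self hρ0.le))
  have := (inv_le_inv₀ hp hm0).1 this
  linarith


/-- The complexified real coordinates. -/
def AL : ((ℂ × ℂ × ℂ) × ℂ) →L[ℂ] C2 × C2 := LinearMap.toContinuousLinearMap
  { toFun := fun y => ((y.1.1 + I * y.1.2.1, y.2 + I * y.1.2.2),
      (y.1.1 - I * y.1.2.1, y.2 - I * y.1.2.2))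
    map_add' := by intro a b; ext <;> simp <;> ring
    map_smul' := by intro a b; ext <;> simp <;> ring }

lemma AL_apply (y) : AL y = ((y.1.1 + I * y.1.2.1, y.2 + I * y.1.2.2),
      (y.1.1 - I * y.1.2.1, y.2 - I * y.1.2.2)) := rfl

/-- Inverse of `AL`. -/
def ALi (y : C2 × C2) : (ℂ × ℂ × ℂ) × ℂ :=
  (((y.1.1 + y.2.1) / 2, -I * (y.1.1 - y.2.1) / 2, -I * (y.1.2 - y.2.2) / 2), (y.1.2 + y.2.2) / 2)

lemma AL_ALi (y) : AL (ALi y) = y := by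
  rw [AL_apply, ALi]
  ext <;> simp <;> ring_nf <;> simp only [I_sq] <;> ring

lemma pol_vanish {R G : C2 × C2 → ℂ} (hR : AnalyticAt ℂ R 0) (hG : AnalyticAt ℂ G 0)
    (hRs : ∀ x ξ, R (cj ξ, cj x) = (starRingEnd ℂ) (R (x, ξ))) (hR0 : R 0 = 0)
    (hRu : fderiv ℂ R 0 ((0, 1), (0, 1)) ≠ 0)
    (hv : ∀ᶠ x in 𝓝 (0 : C2), R (x, cj x) = 0 → G (x, cj x) = 0) :
    ∀ᶠ y in 𝓝 (0 : C2 × C2), R y = 0 → G y = 0 := by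
  have hAa : AnalyticAt ℂ AL 0 := AL.analyticAt 0
  have hRA : AnalyticAt ℂ (fun y => R (AL y)) 0 :=
    AnalyticAt.comp (g := R) (f := AL) (by simpa using hR) hAa
  obtain ⟨g, hg, hg0, hgi⟩ := ift hRA (by simpa using hR0) (by
    have h1 : HasFDerivAt R (fderiv ℂ R 0) (AL 0) := by
      rw [map_zero]; exact hR.differentiableAt.hasFDerivAt
    have h2 := h1.comp (0 : (ℂ × ℂ × ℂ) × ℂ) AL.hasFDerivAt
    have h3 : fderiv ℂ (fun y => R (AL y)) 0 = (fderiv ℂ R 0).comp AL := h2.fderiv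
    rw [h3]
    simpa [AL_apply] using hRu)
  -- real points
  set ι : ℝ × ℝ × ℝ → ℂ × ℂ × ℂ := fun y => ((y.1 : ℂ), (y.2.1 : ℂ), (y.2.2 : ℂ)) with hι
  have hιc : Continuous ι := by fun_prop
  have hι0 : ι 0 = 0 := by simp [hι]
  have hgt : Tendsto (fun y => g (ι y)) (𝓝 0) (𝓝 0) := by
    have : ContinuousAt g (ι 0) := by rw [hι0]; exact hg.continuousAt
    have := this.tendsto.comp (hιc.tendsto 0)
    rwa [hι0, hg0] at this
  have hιt : Tendsto ι (𝓝 0) (𝓝 0) := by have := hιc.tendsto 0; rwa [hι0] at this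
  have hgt' : Tendsto (fun y => (starRingEnd ℂ) (g (ι y))) (𝓝 0) (𝓝 0) := by
    have := (Complex.continuous_conj.tendsto 0).comp hgt
    simpa [Function.comp_def] using this
  have t1 : Tendsto (fun y => (ι y, g (ι y))) (𝓝 0) (𝓝 0) := hιt.prodMk_nhds hgt
  have t2 : Tendsto (fun y => (ι y, (starRingEnd ℂ) (g (ι y)))) (𝓝 0) (𝓝 0) :=
    hιt.prodMk_nhds hgt'
  have t3 : Tendsto (fun y : (ℂ × ℂ × ℂ) × ℂ => (AL y).1) (𝓝 0) (𝓝 0) := by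
    have : Continuous (fun y : (ℂ × ℂ × ℂ) × ℂ => (AL y).1) := by fun_prop
    exact this.tendsto' 0 0 (by simp)
  have hreal : ∀ᶠ y in 𝓝 (0 : ℝ × ℝ × ℝ), G (AL (ι y, g (ι y))) = 0 := by
    filter_upwards [t1.eventually hgi, t2.eventually hgi, t1.eventually (t3.eventually hv)]
      with y h1 h2 h3
    have hz : R (AL (ι y, g (ι y))) = 0 := h1.2 rfl
    have hz2 : R (AL (ι y, (starRingEnd ℂ) (g (ι y)))) = 0 := by
      have := hRs (AL (ι y, g (ι y))).1 (AL (ι y, g (ι y))).2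
      rw [Prod.mk.eta, hz, map_zero] at this
      rw [← this]
      congr 1
      simp [AL_apply, cj, hι, ← sub_eq_add_neg]
    have hreal : (starRingEnd ℂ) (g (ι y)) = g (ι y) := h2.1 hz2
    have hcj : AL (ι y, g (ι y)) = ((AL (ι y, g (ι y))).1, cj (AL (ι y, g (ι y))).1) := by
      simp [AL_apply, cj, hι, ← sub_eq_add_neg]
      simpa [hι] using hreal.symm
    rw [hcj]
    exact h3 (by rw [← hcj]; exact hz)
  have hH : AnalyticAt ℂ (fun x => G (AL (x, g x))) 0 := by
    have h1 : AnalyticAt ℂ (fun x : ℂ × ℂ × ℂ => AL (x, g x)) 0 :=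
      (AL.analyticAt _).comp (analyticAt_id.prod hg)
    refine AnalyticAt.comp (g := G) (f := fun x : ℂ × ℂ × ℂ => AL (x, g x)) ?_ h1
    have : AL (0, g 0) = 0 := by rw [hg0]; exact map_zero AL
    rw [this]; exact hG
  have hall := real_vanish hH hreal
  have t4 : Tendsto ALi (𝓝 0) (𝓝 0) := by
    have : Continuous ALi := by unfold ALi; fun_prop
    exact this.tendsto' 0 0 (by simp [ALi])
  have t5 : Tendsto (fun y => (ALi y).1) (𝓝 0) (𝓝 0) := (continuous_fst.tendsto' 0 0 rfl).comp t4
  filter_upwards [t4.eventually hgi, t5.eventually hall] with y h1 h2 h3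
  rw [AL_ALi] at h1
  have h4 := h1.1 h3
  rw [← h4, Prod.mk.eta, AL_ALi] at h2
  exact h2


lemma fderiv_swap {R : C2 × C2 → ℂ} (hR : AnalyticAt ℂ R 0) : 
    fderiv ℂ (fun y : (ℂ × C2) × ℂ => R ((y.1.1, y.2), y.1.2)) 0 (0, 1) =
      fderiv ℂ R 0 ((0, 1), 0) := by
  have hL : HasFDerivAt (fun y : (ℂ × C2) × ℂ => (((y.1.1, y.2), y.1.2) : C2 × C2))
      ((((ContinuousLinearMap.fst ℂ ℂ C2).comp (ContinuousLinearMap.fst ℂ (ℂ × C2) ℂ)).prod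
        (ContinuousLinearMap.snd ℂ (ℂ × C2) ℂ)).prod
        ((ContinuousLinearMap.snd ℂ ℂ C2).comp (ContinuousLinearMap.fst ℂ (ℂ × C2) ℂ))) 0 :=
    ((hasFDerivAt_fst.comp _ hasFDerivAt_fst).prodMk hasFDerivAt_snd).prodMk
      (hasFDerivAt_snd.comp _ hasFDerivAt_fst)
  have h1 : HasFDerivAt R (fderiv ℂ R 0)
      ((fun y : (ℂ × C2) × ℂ => (((y.1.1, y.2), y.1.2) : C2 × C2)) 0) :=
    hR.differentiableAt.hasFDerivAt
  have := (h1.comp (0 : (ℂ × C2) × ℂ) hL).fderiv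
  rw [Function.comp_def] at this
  rw [this]
  simp

/-- Segre varieties as graphs. -/
lemma segre {R : C2 × C2 → ℂ} (hR : AnalyticAt ℂ R 0) (hR0 : R 0 = 0)
    (hRw : fderiv ℂ R 0 ((0, 1), 0) ≠ 0) :
    ∃ Q : ℂ × C2 → ℂ, AnalyticAt ℂ Q 0 ∧ Q 0 = 0 ∧
      ∀ᶠ y in 𝓝 (0 : C2 × C2), (R y = 0 ↔ y.1.2 = Q (y.1.1, y.2)) := by
  have h1 : AnalyticAt ℂ (fun y : (ℂ × C2) × ℂ => R ((y.1.1, y.2), y.1.2)) 0 :=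
    AnalyticAt.comp (g := R) (f := fun y : (ℂ × C2) × ℂ => (((y.1.1, y.2), y.1.2) : C2 × C2))
      hR (by fun_prop)
  obtain ⟨Q, hQ, hQ0, h⟩ := ift h1 hR0 (by rw [fderiv_swap hR]; exact hRw)
  refine ⟨Q, hQ, hQ0, ?_⟩
  have t : Tendsto (fun y : C2 × C2 => (((y.1.1, y.2), y.1.2) : (ℂ × C2) × ℂ)) (𝓝 0) (𝓝 0) := by
    have : Continuous (fun y : C2 × C2 => (((y.1.1, y.2), y.1.2) : (ℂ × C2) × ℂ)) := by fun_prop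
    exact this.tendsto' 0 0 rfl
  exact t.eventually h

/-- The curve of conjugates of points of the Segre variety of `0`. -/
def Ec (Q : ℂ × C2 → ℂ) (ζ : ℂ) : C2 := (ζ, (starRingEnd ℂ) (Q ((starRingEnd ℂ) ζ, 0)))

lemma Ec_eq (Q : ℂ × C2 → ℂ) (z : ℂ) : cj (z, Q (z, 0)) = Ec Q ((starRingEnd ℂ) z) := by
  simp [cj, Ec]

lemma Ec_zero {Q : ℂ × C2 → ℂ} (hQ0 : Q 0 = 0) : Ec Q 0 = 0 := by
  have : Q (0, 0) = 0 := hQ0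
  simp [Ec, this]

lemma Ec_analytic {Q : ℂ × C2 → ℂ} (hQ : AnalyticAt ℂ Q 0) : AnalyticAt ℂ (Ec Q) 0 := by
  have h1 : AnalyticAt ℂ (fun x : C2 => Q (x.1, 0)) (cj 0) := by
    have h0 : cj 0 = 0 := by simp [cj]
    rw [h0]
    exact AnalyticAt.comp (g := Q) (f := fun x : C2 => ((x.1, 0) : ℂ × C2)) hQ (by fun_prop)
  have h2 := analyticAt_conj h1
  have h3 := AnalyticAt.comp (f := fun ζ : ℂ => ((ζ, 0) : C2)) (x := 0) h2 (by fun_prop)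
  exact analyticAt_id.prod h3

section
variable {R : C2 × C2 → ℂ} {Q : ℂ × C2 → ℂ}

lemma tendsto_graph (hQ : AnalyticAt ℂ Q 0) (hQ0 : Q 0 = 0) :
    Tendsto (fun u : ℂ × C2 => (((u.1, Q u), u.2) : C2 × C2)) (𝓝 0) (𝓝 0) := by
  have : ContinuousAt (fun u : ℂ × C2 => (((u.1, Q u), u.2) : C2 × C2)) 0 := by
    have := hQ.continuousAt; fun_prop
  have h := this.tendsto
  simp only [hQ0] at h
  exact h

lemma Q_zero_Ec (hQ : AnalyticAt ℂ Q 0) (hQ0 : Q 0 = 0)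
    (hRs : ∀ x ξ, R (cj ξ, cj x) = (starRingEnd ℂ) (R (x, ξ)))
    (hQi : ∀ᶠ y in 𝓝 (0 : C2 × C2), (R y = 0 ↔ y.1.2 = Q (y.1.1, y.2))) :
    ∀ᶠ ζ in 𝓝 (0:ℂ), Q (0, Ec Q ζ) = 0 := by
  have t1 : Tendsto (fun ζ : ℂ => (((starRingEnd ℂ) ζ, 0) : ℂ × C2)) (𝓝 0) (𝓝 0) := by
    have : Continuous (fun ζ : ℂ => (((starRingEnd ℂ) ζ, 0) : ℂ × C2)) := by fun_prop
    exact this.tendsto' 0 0 (by simp)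
  have t2 : Tendsto (fun ζ : ℂ => ((0, Ec Q ζ) : C2 × C2)) (𝓝 0) (𝓝 0) := by
    have : ContinuousAt (fun ζ : ℂ => ((0, Ec Q ζ) : C2 × C2)) 0 := by
      have := (Ec_analytic hQ).continuousAt; fun_prop
    have h := this.tendsto
    rwa [Ec_zero hQ0] at h
  filter_upwards [t1.eventually ((tendsto_graph hQ hQ0).eventually hQi), t2.eventually hQi]
    with ζ h1 h2
  have h3 := h1.2 rfl
  have h4 := hRs ((starRingEnd ℂ) ζ, Q ((starRingEnd ℂ) ζ, 0)) 0
  rw [h3, Ec_eq, conj_conj, map_zero] at h4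
  have : cj 0 = 0 := by simp [cj]
  rw [this] at h4
  exact (h2.1 h4).symm

lemma step3 (hQ : AnalyticAt ℂ Q 0) (hQ0 : Q 0 = 0)
    (hQi : ∀ᶠ y in 𝓝 (0 : C2 × C2), (R y = 0 ↔ y.1.2 = Q (y.1.1, y.2)))
    (hnd : ¬ ∀ᶠ z in 𝓝 (0:ℂ), R ((z, Q (z, 0)), cj (z, Q (z, 0))) = 0)
    {Φ : C2 → ℂ} (hΦ : AnalyticAt ℂ Φ 0)
    (hv : ∀ᶠ u : ℂ × ℂ in 𝓝 0, Φ (u.1, Q (u.1, Ec Q u.2)) = 0) :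
    ∀ᶠ x in 𝓝 0, Φ x = 0 := by
  have hE := Ec_analytic hQ
  set S : ℂ × ℂ → ℂ := fun u => Q (u.1, Ec Q u.2) with hS
  have hSa : AnalyticAt ℂ S 0 := by
    have h1 : AnalyticAt ℂ (fun u : ℂ × ℂ => ((u.1, Ec Q u.2) : ℂ × C2)) 0 :=
      analyticAt_fst.prod (AnalyticAt.comp (g := Ec Q) (f := fun u : ℂ × ℂ => u.2) hE analyticAt_snd)
    refine AnalyticAt.comp (g := Q) ?_ h1
    show AnalyticAt ℂ Q (0, Ec Q 0)
    rw [Ec_zero hQ0]; exact hQ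
  have hS0 : S 0 = 0 := by
    show Q (0, Ec Q 0) = 0
    rw [Ec_zero hQ0]; exact hQ0
  obtain ⟨η, hη, hA⟩ := Metric.eventually_nhds_iff_ball.1 hΦ.eventually_analyticAt
  have hSs : ∀ᶠ u in 𝓝 (0 : ℂ × ℂ), ‖S u‖ < η := by
    have := hSa.continuousAt.norm
    refine this.eventually_lt_const ?_
    simpa [hS0] using hη
  obtain ⟨ε', hε', hB⟩ := Metric.eventually_nhds_iff_ball.1
    ((hSa.eventually_analyticAt.and hv).and hSs)
  set ε := min ε' η with hεd
  have hε : 0 < ε := lt_min hε' hη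
  have mem : ∀ {a b : ℂ}, ‖a‖ < ε → ‖b‖ < ε → (a, b) ∈ ball (0 : ℂ × ℂ) ε' := by
    intro a b ha hb
    rw [mem_ball_zero_iff, Prod.norm_def]
    exact lt_of_lt_of_le (max_lt ha hb) (min_le_left _ _)
  have memη : ∀ {a b : ℂ}, ‖a‖ < η → ‖b‖ < η → (a, b) ∈ ball (0 : ℂ × ℂ) η := by
    intro a b ha hb
    rw [mem_ball_zero_iff, Prod.norm_def]
    exact max_lt ha hb
  -- nonconstancy
  obtain ⟨z0, ζ0, hz0, hζ0, hne⟩ : ∃ z0 ζ0 : ℂ, ‖z0‖ < ε ∧ ‖ζ0‖ < ε ∧ S (z0, ζ0) ≠ S (z0, 0) := by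
    by_contra hcon
    push Not at hcon
    apply hnd
    have t1 : Tendsto (fun z : ℂ => ((z, 0) : ℂ × C2)) (𝓝 0) (𝓝 0) :=
      (by fun_prop : Continuous fun z : ℂ => ((z, 0) : ℂ × C2)).tendsto' 0 0 rfl
    have t2 : Tendsto (fun z : ℂ => (((z, Q (z, 0)), cj (z, Q (z, 0))) : C2 × C2)) (𝓝 0) (𝓝 0) := by
      have h1 := (tendsto_graph hQ hQ0).comp t1
      have h2 : Tendsto (fun z : ℂ => ((z, Q (z, 0)) : C2)) (𝓝 0) (𝓝 0) :=
        (continuous_fst.tendsto' (0 : C2 × C2) 0 rfl).comp h1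
      exact h2.prodMk_nhds ((continuous_cj.tendsto' 0 0 (by simp [cj])).comp h2)
    filter_upwards [t2.eventually hQi, ball_mem_nhds 0 hε] with z h1 h2
    rw [h1, Ec_eq]
    have h3 := hcon z ((starRingEnd ℂ) z) (by simpa using h2) (by simpa using h2)
    simp only [hS, Ec_zero hQ0] at h3
    exact h3.symm
  -- vanishing
  have hslice : ∀ z, ‖z‖ < ε → S (z, ζ0) ≠ S (z, 0) → ∀ w, ‖w‖ < η → Φ (z, w) = 0 := by
    intro z hz hzne
    have hz0' : ‖(0:ℂ)‖ < ε := by simpa using hε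
    have hh : AnalyticOnNhd ℂ (fun ζ => S (z, ζ)) (ball 0 ε) := by
      intro ζ hζ
      exact AnalyticAt.comp (g := S) (f := fun ζ : ℂ => (z, ζ))
        (hB _ (mem hz (by simpa using hζ))).1.1 (by fun_prop)
    have hop : 𝓝 (S (z, 0)) ≤ map (fun ζ => S (z, ζ)) (𝓝 0) := by
      refine ((hh 0 (mem_ball_self hε)).eventually_constant_or_nhds_le_map_nhds).resolve_left ?_
      intro hc
      have h2 : AnalyticOnNhd ℂ (fun ζ => S (z, ζ) - S (z, 0)) (ball 0 ε) :=
        hh.sub analyticOnNhd_const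
      have h3 := h2.eqOn_zero_of_preconnected_of_eventuallyEq_zero
        (convex_ball 0 ε).isPreconnected (mem_ball_self hε)
        (by filter_upwards [hc] with ζ hζ; simp [hζ])
      exact hzne (sub_eq_zero.1 (h3 (by simpa using hζ0 : ζ0 ∈ ball (0:ℂ) ε)))
    have hev : ∀ᶠ w in 𝓝 (S (z, 0)), Φ (z, w) = 0 := by
      refine hop ?_
      rw [mem_map]
      filter_upwards [ball_mem_nhds 0 hε] with ζ hζ
      exact (hB _ (mem hz (by simpa using hζ))).1.2
    have hΦs : AnalyticOnNhd ℂ (fun w => Φ (z, w)) (ball 0 η) := by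
      intro w hw
      exact AnalyticAt.comp (g := Φ) (f := fun w : ℂ => (z, w))
        (hA _ (memη (lt_of_lt_of_le hz (min_le_right _ _)) (by simpa using hw))) (by fun_prop)
    have h4 := hΦs.eqOn_zero_of_preconnected_of_eventuallyEq_zero
        (convex_ball 0 η).isPreconnected (z₀ := S (z, 0))
        (by simpa using (hB _ (mem hz hz0')).2) hev
    intro w hw
    exact h4 (by simpa using hw : w ∈ ball (0:ℂ) η)
  have hcont : ∀ ζ, ‖ζ‖ < ε → ContinuousAt (fun z => S (z, ζ)) z0 := fun ζ hζ =>
    ContinuousAt.comp (g := S) (f := fun z : ℂ => (z, ζ)) (hB _ (mem hz0 hζ)).1.1.continuousAt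
      (by fun_prop)
  have hnev : ∀ᶠ z in 𝓝 z0, S (z, ζ0) ≠ S (z, 0) :=
    (((hcont ζ0 hζ0).sub (hcont 0 (by simpa using hε))).eventually_ne (sub_ne_zero.2 hne)).mono
      fun z hz => sub_ne_zero.1 hz
  have hzev : ∀ᶠ z in 𝓝 z0, ‖z‖ < ε := continuous_norm.continuousAt.eventually_lt_const hz0
  have hnear : ∀ᶠ x in 𝓝 ((z0, 0) : C2), Φ x = 0 := by
    have h1 : ∀ᶠ x in 𝓝 ((z0, 0) : C2), ‖x.2‖ < η :=
      (continuous_norm.comp continuous_snd).continuousAt.eventually_lt_const (by simpa using hη)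
    have h2 := (continuous_fst.tendsto ((z0, 0) : C2)).eventually (hnev.and hzev)
    filter_upwards [h1, h2] with x h1 h2
    exact hslice x.1 h2.2 h2.1 x.2 h1
  have hfin := AnalyticOnNhd.eqOn_zero_of_preconnected_of_eventuallyEq_zero (f := Φ)
    (fun x hx => hA x hx) (convex_ball 0 η).isPreconnected
    (memη (lt_of_lt_of_le hz0 (min_le_right _ _)) (by simpa using hη)) hnear
  filter_upwards [ball_mem_nhds 0 hη] with x hx using hfin hx
end


section
variable {R G : C2 × C2 → ℂ} {Q : ℂ × C2 → ℂ}

/-- The graph chart of the complexified hypersurface. -/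
def th (Q : ℂ × C2 → ℂ) (u : ℂ × C2) : C2 × C2 := ((u.1, Q u), u.2)

lemma th_zero (hQ0 : Q 0 = 0) : th Q 0 = 0 := by
  show ((0, Q 0), 0) = _; rw [hQ0]; rfl

lemma th_hasFDerivAt {u : ℂ × C2} (hQ : DifferentiableAt ℂ Q u) :
    HasFDerivAt (th Q) (((ContinuousLinearMap.fst ℂ ℂ C2).prod (fderiv ℂ Q u)).prod
      (ContinuousLinearMap.snd ℂ ℂ C2)) u :=
  (hasFDerivAt_fst.prodMk hQ.hasFDerivAt).prodMk hasFDerivAt_snd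

lemma th_analytic {u : ℂ × C2} (hQ : AnalyticAt ℂ Q u) : AnalyticAt ℂ (th Q) u := by
  unfold th; fun_prop

lemma th_deriv_zero {u : ℂ × C2} (hQ : DifferentiableAt ℂ Q u) (hG : DifferentiableAt ℂ G (th Q u))
    (hz : ∀ᶠ u' in 𝓝 u, G (th Q u') = 0) (v : ℂ × C2) :
    fderiv ℂ G (th Q u) ((v.1, fderiv ℂ Q u v), v.2) = 0 := by
  have h1 := hG.hasFDerivAt.comp u (th_hasFDerivAt hQ)
  have h2 : HasFDerivAt (G ∘ th Q) (0 : ℂ × C2 →L[ℂ] ℂ) u :=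
    (hasFDerivAt_const (0:ℂ) u).congr_of_eventuallyEq hz
  have := congrArg (fun L : ℂ × C2 →L[ℂ] ℂ => L v) (h1.unique h2)
  simpa using this

lemma th_ker {u : ℂ × C2} (hQ : DifferentiableAt ℂ Q u) (hG : DifferentiableAt ℂ G (th Q u))
    (hz : ∀ᶠ u' in 𝓝 u, G (th Q u') = 0) (hw : fderiv ℂ G (th Q u) ((0, 1), 0) = 0) :
    fderiv ℂ G (th Q u) = 0 := by
  refine ContinuousLinearMap.ext fun v => ?_
  have h := th_deriv_zero hQ hG hz (v.1.1, v.2)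
  have : v = ((v.1.1, fderiv ℂ Q u (v.1.1, v.2)), v.2) +
      (v.1.2 - fderiv ℂ Q u (v.1.1, v.2)) • (((0, 1), 0) : C2 × C2) := by
    ext <;> simp
  rw [this, map_add, map_smul, hw]
  simpa using h

lemma jac_b (hR : AnalyticAt ℂ R 0) (hG : AnalyticAt ℂ G 0)
    (hRw : fderiv ℂ R 0 ((0, 1), 0) ≠ 0)
    (hQ : AnalyticAt ℂ Q 0) (hQ0 : Q 0 = 0)
    (hQi : ∀ᶠ y in 𝓝 (0 : C2 × C2), (R y = 0 ↔ y.1.2 = Q (y.1.1, y.2)))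
    (hRG : ∀ᶠ y in 𝓝 (0 : C2 × C2), R y = 0 → G y = 0)
    {f : C2 → ℂ} (hf : AnalyticAt ℂ f 0)
    (hfG : ∀ᶠ y in 𝓝 (0 : C2 × C2), ∀ e m, fderiv ℂ f y.1 e ≠ 0 → fderiv ℂ f y.1 m = 0 →
      fderiv ℂ G y (m, 0) = 0)
    (hGn : ¬ ∀ᶠ y in 𝓝 (0 : C2 × C2), G y = 0) :
    ∀ᶠ u in 𝓝 (0 : ℂ × C2), fderiv ℂ f (th Q u).1 (1, fderiv ℂ Q u (1, 0)) = 0 := by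
  by_contra hcon
  apply hGn
  have hfr : ∃ᶠ u in 𝓝 (0 : ℂ × C2), fderiv ℂ f (th Q u).1 (1, fderiv ℂ Q u (1, 0)) ≠ 0 := not_eventually.1 hcon
  have tt : Tendsto (th Q) (𝓝 0) (𝓝 0) := tendsto_graph hQ hQ0
  -- good ball
  obtain ⟨ε, hε, hGA⟩ := Metric.eventually_nhds_iff_ball.1 hG.eventually_analyticAt
  have hRw' : ∀ᶠ y in 𝓝 (0 : C2 × C2), fderiv ℂ R y ((0, 1), 0) ≠ 0 := by
    have : ContinuousAt (fun y => fderiv ℂ R y ((0, 1), 0)) 0 :=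
      (hR.fderiv.continuousAt).clm_apply continuousAt_const
    exact this.eventually_ne hRw
  have hfa : ∀ᶠ y in 𝓝 (0 : C2 × C2), AnalyticAt ℂ f y.1 :=
    (continuous_fst.tendsto' (0 : C2 × C2) 0 rfl).eventually hf.eventually_analyticAt
  have hall := (((((hR.eventually_analyticAt.and hRw').and hfa).and hQi).and hRG).and hfG).and
    (ball_mem_nhds (0 : C2 × C2) hε)
  obtain ⟨u0, hu0, ⟨hQa, hall0⟩⟩ := (hfr.and_eventually
    (hQ.eventually_analyticAt.and (tt.eventually hall.eventually_nhds))).exists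
  set y0 := th Q u0 with hy0
  obtain ⟨⟨⟨⟨⟨⟨r1, r2⟩, r3⟩, r4⟩, r5⟩, r6⟩, r7⟩ := hall0.self_of_nhds
  have r7' : y0 ∈ ball (0 : C2 × C2) ε := r7
  set Ψ : C2 × C2 → C2 × C2 := fun y => ((f y.1, R y), y.2) with hΨ
  have hΨd : ∀ y, AnalyticAt ℂ f y.1 → AnalyticAt ℂ R y → HasFDerivAt Ψ
      ((((fderiv ℂ f y.1).comp (ContinuousLinearMap.fst ℂ C2 C2)).prod (fderiv ℂ R y)).prod
        (ContinuousLinearMap.snd ℂ C2 C2)) y := by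
    intro y h1 h2
    exact ((h1.differentiableAt.hasFDerivAt.comp y hasFDerivAt_fst).prodMk
      h2.differentiableAt.hasFDerivAt).prodMk hasFDerivAt_snd
  have hΨa : AnalyticAt ℂ Ψ y0 :=
    ((AnalyticAt.comp (g := f) (f := fun y : C2 × C2 => y.1) r3 analyticAt_fst).prod r1).prod
      analyticAt_snd
  have hthc : Tendsto (th Q) (𝓝 u0) (𝓝 y0) := (th_analytic hQa).continuousAt
  have hRth : ∀ᶠ u in 𝓝 u0, R (th Q u) = 0 := by
    filter_upwards [hthc.eventually hall0] with u hu
    exact hu.1.1.1.2.2 rfl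
  have hdR := th_deriv_zero (G := R) hQa.differentiableAt r1.differentiableAt hRth (1, 0)
  obtain ⟨Θ, hΘ, hΘ0, hl, hr⟩ := inv_fn hΨa (by
    intro v hv
    rw [(hΨd y0 r3 r1).fderiv] at hv
    obtain ⟨⟨v1, v2⟩, v3⟩ := v
    simp only [ContinuousLinearMap.prod_apply, ContinuousLinearMap.comp_apply,
      ContinuousLinearMap.coe_fst', ContinuousLinearMap.coe_snd', Prod.mk_eq_zero] at hv
    obtain ⟨⟨hv1, hv2⟩, rfl⟩ := hv
    have e1 : (((v1, v2), 0) : C2 × C2) = v1 • (((1, fderiv ℂ Q u0 (1, 0)), 0) : C2 × C2) +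
        (v2 - v1 * fderiv ℂ Q u0 (1, 0)) • (((0, 1), 0) : C2 × C2) := by
      ext <;> simp
    rw [e1, map_add, map_smul, map_smul] at hv2
    have e2 : fderiv ℂ R y0 ((1, fderiv ℂ Q u0 (1, 0)), 0) = 0 := hdR
    rw [e2, smul_zero, zero_add, smul_eq_mul, mul_eq_zero] at hv2
    have hc := hv2.resolve_right r2
    have e3 : ((v1, v2) : C2) = v1 • ((1, fderiv ℂ Q u0 (1, 0)) : C2) := by
      ext
      · simp
      · simp; exact sub_eq_zero.1 hc
    rw [e3, map_smul, smul_eq_mul, mul_eq_zero] at hv1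
    have := hv1.resolve_right hu0
    subst this
    rw [e3]; simp)
  -- G ∘ Θ does not depend on the second variable
  have hΨ0 : Ψ y0 = ((f y0.1, 0), y0.2) := by
    simp only [hΨ, hRth.self_of_nhds, hy0]
  have hΘc : Tendsto Θ (𝓝 (Ψ y0)) (𝓝 y0) := by
    have := hΘ.continuousAt.tendsto; rwa [hΘ0] at this
  have hfne : ∀ᶠ y in 𝓝 y0, fderiv ℂ f y.1 (1, fderiv ℂ Q u0 (1, 0)) ≠ 0 := by
    have h1 : ContinuousAt (fun y : C2 × C2 => fderiv ℂ f y.1) y0 :=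
      ContinuousAt.comp (g := fderiv ℂ f) (f := fun y : C2 × C2 => y.1) r3.fderiv.continuousAt
        continuousAt_fst
    exact (h1.clm_apply continuousAt_const).eventually_ne hu0
  have hder : ∀ᶠ y' in 𝓝 (Ψ y0), fderiv ℂ (fun y => G (Θ y)) y' ((0, 1), 0) = 0 := by
    filter_upwards [hr.eventually_nhds, hΘ.eventually_analyticAt, hΘc.eventually hall0,
      hΘc.eventually hfne] with y' h1 h2 h3 h4
    obtain ⟨⟨⟨⟨⟨⟨q1, q2⟩, q3⟩, q4⟩, q5⟩, q6⟩, q7⟩ := h3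
    have hGd := (hGA (Θ y') q7).differentiableAt.hasFDerivAt
    have hΘd := h2.differentiableAt.hasFDerivAt
    have e1 : fderiv ℂ (fun y => G (Θ y)) y' = (fderiv ℂ G (Θ y')).comp (fderiv ℂ Θ y') :=
      (hGd.comp y' hΘd).fderiv
    have e2 := (hΨd (Θ y') q3 q1).comp y' hΘd
    have e3 := e2.unique ((hasFDerivAt_id (𝕜 := ℂ) y').congr_of_eventuallyEq h1)
    set m := fderiv ℂ Θ y' ((0, 1), 0) with hm
    have e4 := congrArg (fun L : C2 × C2 →L[ℂ] C2 × C2 => L ((0, 1), 0)) e3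
    simp only [ContinuousLinearMap.comp_apply, ContinuousLinearMap.prod_apply, ← hm,
      ContinuousLinearMap.coe_fst', ContinuousLinearMap.coe_snd', ContinuousLinearMap.id_apply,
      Prod.mk.injEq] at e4
    rw [e1, ContinuousLinearMap.comp_apply, ← hm]
    have : m = (m.1, 0) := Prod.ext rfl e4.2
    rw [this]
    exact q6 _ _ h4 e4.1.1
  obtain ⟨δ, hδ, hD⟩ := Metric.eventually_nhds_iff_ball.1
    ((hder.and (hΘ.eventually_analyticAt)).and ((hΘc.eventually hall0).and hr))
  have hnear' : ∀ y' ∈ ball (Ψ y0) δ, G (Θ y') = 0 := by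
    rintro ⟨⟨a, b⟩, ξ⟩ hy'
    rw [hΨ0, ← ball_prod_same, ← ball_prod_same] at hy'
    obtain ⟨⟨ha, hb⟩, hξ⟩ := hy'
    have hin : ∀ b' ∈ ball (0:ℂ) δ, (((a, b'), ξ) : C2 × C2) ∈ ball (Ψ y0) δ := by
      intro b' hb'
      rw [hΨ0, ← ball_prod_same, ← ball_prod_same]
      exact ⟨⟨ha, hb'⟩, hξ⟩
    have hd : ∀ b' ∈ ball (0:ℂ) δ, HasDerivAt (fun b => G (Θ ((a, b), ξ))) 0 b' := by
      intro b' hb'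
      obtain ⟨⟨p1, p2⟩, p3, -⟩ := hD _ (hin b' hb')
      have hGd := (hGA _ p3.2).differentiableAt
      have h5 : HasFDerivAt (fun y => G (Θ y)) (fderiv ℂ (fun y => G (Θ y)) ((a, b'), ξ))
          (((a, b'), ξ) : C2 × C2) :=
        (hGd.comp _ p2.differentiableAt).hasFDerivAt
      have h6 : HasDerivAt (fun b : ℂ => (((a, b), ξ) : C2 × C2)) ((0, 1), 0) b' :=
        ((hasDerivAt_const b' a).prodMk (hasDerivAt_id b')).prodMk (hasDerivAt_const b' ξ)
      have h7 := h5.comp_hasDerivAt b' h6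
      rw [p1] at h7
      exact h7
    have hconst := isOpen_ball.is_const_of_deriv_eq_zero (s := ball (0:ℂ) δ)
      (convex_ball 0 δ).isPreconnected
      (fun b' hb' => (hd b' hb').differentiableAt.differentiableWithinAt)
      (fun b' hb' => (hd b' hb').deriv) hb (mem_ball_self hδ)
    have h8 := hconst
    simp only at h8
    rw [h8]
    obtain ⟨-, p3, p4⟩ := hD _ (hin 0 (mem_ball_self hδ))
    apply p3.1.1.2
    have := congrArg (fun y : C2 × C2 => y.1.2) p4
    exact this
  have hGy0 : ∀ᶠ y in 𝓝 y0, G y = 0 := by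
    filter_upwards [hl, hΨa.continuousAt.eventually (ball_mem_nhds (Ψ y0) hδ)] with y h1 h2
    rw [← h1]; exact hnear' _ h2
  have hfin := AnalyticOnNhd.eqOn_zero_of_preconnected_of_eventuallyEq_zero (f := G)
    (fun x hx => hGA x hx) (convex_ball 0 ε).isPreconnected r7' hGy0
  filter_upwards [ball_mem_nhds 0 hε] with x hx using hfin hx
end


section
variable {R G : C2 × C2 → ℂ} {Q : ℂ × C2 → ℂ}

lemma const_of_seg 
    (hRs : ∀ x ξ, R (cj ξ, cj x) = (starRingEnd ℂ) (R (x, ξ)))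
    (hQ : AnalyticAt ℂ Q 0) (hQ0 : Q 0 = 0)
    (hQi : ∀ᶠ y in 𝓝 (0 : C2 × C2), (R y = 0 ↔ y.1.2 = Q (y.1.1, y.2)))
    (hnd : ¬ ∀ᶠ z in 𝓝 (0:ℂ), R ((z, Q (z, 0)), cj (z, Q (z, 0))) = 0)
    {f : C2 → ℂ} (hf : AnalyticAt ℂ f 0)
    (hfd : ∀ᶠ u in 𝓝 (0 : ℂ × C2), fderiv ℂ f (th Q u).1 (1, fderiv ℂ Q u (1, 0)) = 0) :
    ∀ᶠ x in 𝓝 0, f x = f 0 := by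
  have tt : Tendsto (th Q) (𝓝 0) (𝓝 0) := tendsto_graph hQ hQ0
  have hfa : ∀ᶠ y in 𝓝 (0 : C2 × C2), AnalyticAt ℂ f y.1 :=
    (continuous_fst.tendsto' (0 : C2 × C2) 0 rfl).eventually hf.eventually_analyticAt
  obtain ⟨ε, hε, hB⟩ := Metric.eventually_nhds_iff_ball.1
    ((hfd.and hQ.eventually_analyticAt).and (tt.eventually hfa))
  have hconst : ∀ z ξ, ‖z‖ < ε → ‖ξ‖ < ε → f (z, Q (z, ξ)) = f (0, Q (0, ξ)) := by
    intro z ξ hz hξ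
    have hd : ∀ z' ∈ ball (0:ℂ) ε, HasDerivAt (fun z => f (z, Q (z, ξ))) 0 z' := by
      intro z' hz'
      obtain ⟨⟨h1, h2⟩, h3⟩ := hB (z', ξ) (by
        rw [← Prod.mk_zero_zero, ← ball_prod_same]; exact ⟨hz', by simpa using hξ⟩)
      have e1 : HasDerivAt (fun z : ℂ => ((z, ξ) : ℂ × C2)) (1, 0) z' :=
        (hasDerivAt_id z').prodMk (hasDerivAt_const z' ξ)
      have e2 := h2.differentiableAt.hasFDerivAt.comp_hasDerivAt z' e1
      have e3 : HasDerivAt (fun z : ℂ => ((z, Q (z, ξ)) : C2)) (1, fderiv ℂ Q (z', ξ) (1, 0)) z' :=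
        (hasDerivAt_id z').prodMk e2
      have h3' : HasFDerivAt f (fderiv ℂ f (z', Q (z', ξ))) ((fun z : ℂ => ((z, Q (z, ξ)) : C2)) z') :=
        h3.differentiableAt.hasFDerivAt
      have e4 := h3'.comp_hasDerivAt z' e3
      have h1' : fderiv ℂ f (z', Q (z', ξ)) (1, fderiv ℂ Q (z', ξ) (1, 0)) = 0 := h1
      rw [h1'] at e4
      exact e4
    exact isOpen_ball.is_const_of_deriv_eq_zero (s := ball (0:ℂ) ε)
      (convex_ball 0 ε).isPreconnected
      (fun b' hb' => (hd b' hb').differentiableAt.differentiableWithinAt)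
      (fun b' hb' => (hd b' hb').deriv) (by simpa using hz) (mem_ball_self hε)
  have hE := Ec_analytic hQ
  have h1 : ∀ᶠ u in 𝓝 (0 : ℂ × ℂ), ‖u.1‖ < ε :=
    (continuous_norm.comp continuous_fst).continuousAt.eventually_lt_const (by simpa using hε)
  have h2 : ∀ᶠ ζ in 𝓝 (0:ℂ), ‖Ec Q ζ‖ < ε :=
    hE.continuousAt.norm.eventually_lt_const (by simpa [Ec_zero hQ0] using hε)
  have t2 : Tendsto (fun u : ℂ × ℂ => u.2) (𝓝 0) (𝓝 0) := continuous_snd.tendsto' 0 0 rfl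
  have := step3 hQ hQ0 hQi hnd (Φ := fun x => f x - f 0) (hf.sub analyticAt_const) (by
    filter_upwards [h1, t2.eventually h2, t2.eventually (Q_zero_Ec hQ hQ0 hRs hQi)]
      with u h1 h2 h3
    rw [hconst _ _ h1 h2, h3]
    exact sub_self _)
  filter_upwards [this] with x hx using sub_eq_zero.1 hx

/-- The conjugation swap as a real linear map. -/
def sgL : C2 × C2 →L[ℝ] C2 × C2 :=
  (cjL.comp (ContinuousLinearMap.snd ℝ C2 C2)).prod (cjL.comp (ContinuousLinearMap.fst ℝ C2 C2))

lemma sgL_apply (y : C2 × C2) : sgL y = (cj y.2, cj y.1) := by simp [sgL, cjL_apply]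

lemma sgL_sgL (y : C2 × C2) : sgL (sgL y) = y := by simp [sgL_apply, cj_cj]

lemma sym_deriv (hGs : ∀ x ξ, G (cj ξ, cj x) = (starRingEnd ℂ) (G (x, ξ))) {y : C2 × C2}
    (h1 : DifferentiableAt ℂ G y) (h2 : DifferentiableAt ℂ G (sgL y)) (h0 : fderiv ℂ G y = 0) :
    fderiv ℂ G (sgL y) = 0 := by
  have e1 : HasFDerivAt G (0 : C2 × C2 →L[ℝ] ℂ) y := by
    have := h1.hasFDerivAt.restrictScalars ℝ
    rw [h0] at this
    exact this
  have e2 : HasFDerivAt (fun x => (starRingEnd ℂ) (G (sgL x))) (0 : C2 × C2 →L[ℝ] ℂ) (sgL y) := by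
    have e1' : HasFDerivAt G (0 : C2 × C2 →L[ℝ] ℂ) (sgL (sgL y)) := by rwa [sgL_sgL]
    have := (Complex.conjCLE.toContinuousLinearMap.hasFDerivAt (x := G (sgL (sgL y)))).comp (sgL y)
      (e1'.comp (sgL y) sgL.hasFDerivAt)
    exact HasFDerivAt.congr_fderiv this (by ext <;> simp)
  have e3 : (fun x => (starRingEnd ℂ) (G (sgL x))) = G := by
    funext x
    rw [sgL_apply, hGs]; simp
  rw [e3] at e2
  have e4 := e2.unique (h2.hasFDerivAt.restrictScalars ℝ)
  refine ContinuousLinearMap.ext fun v => ?_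
  have := congrArg (fun L : C2 × C2 →L[ℝ] ℂ => L v) e4
  simpa using this.symm

lemma core (hG : AnalyticAt ℂ G 0)
    (hRs : ∀ x ξ, R (cj ξ, cj x) = (starRingEnd ℂ) (R (x, ξ)))
    (hQ : AnalyticAt ℂ Q 0) (hQ0 : Q 0 = 0)
    (hQi : ∀ᶠ y in 𝓝 (0 : C2 × C2), (R y = 0 ↔ y.1.2 = Q (y.1.1, y.2)))
    (hnd : ¬ ∀ᶠ z in 𝓝 (0:ℂ), R ((z, Q (z, 0)), cj (z, Q (z, 0))) = 0)
    (hRG : ∀ᶠ y in 𝓝 (0 : C2 × C2), R y = 0 → G y = 0)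
    (hGs : ∀ x ξ, G (cj ξ, cj x) = (starRingEnd ℂ) (G (x, ξ)))
    {J : C2 → ℂ} (hJ : AnalyticAt ℂ J 0) (hJn : ¬ ∀ᶠ x in 𝓝 0, J x = 0)
    (hGJ : ∀ᶠ y in 𝓝 (0 : C2 × C2), fderiv ℂ G y = 0 → J y.1 = 0) :
    fderiv ℂ G 0 ≠ 0 := by
  intro hG00
  apply hJn
  have tt : Tendsto (th Q) (𝓝 0) (𝓝 0) := tendsto_graph hQ hQ0
  have ts : Tendsto sgL (𝓝 0) (𝓝 0) := sgL.continuous.tendsto' 0 0 (map_zero _)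
  set k : ℂ × C2 → ℂ := fun u => fderiv ℂ G (th Q u) ((0, 1), 0) with hk
  have hka : AnalyticAt ℂ k 0 := by
    have h1 : AnalyticAt ℂ (fun u => fderiv ℂ G (th Q u)) 0 := by
      refine AnalyticAt.comp (g := fderiv ℂ G) ?_ (th_analytic hQ)
      rw [th_zero hQ0]; exact hG.fderiv
    exact ((ContinuousLinearMap.apply ℂ ℂ (((0, 1), 0) : C2 × C2)).analyticAt _).comp h1
  obtain ⟨η, hη, hJA⟩ := Metric.eventually_nhds_iff_ball.1 hJ.eventually_analyticAt
  have hGa2 := hG.eventually_analyticAt.and ((ts.eventually hG.eventually_analyticAt).and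
    (hGJ.and (ts.eventually hGJ)))
  have hGth : ∀ᶠ u in 𝓝 (0 : ℂ × C2), G (th Q u) = 0 := by
    filter_upwards [tt.eventually (hQi.and hRG)] with u hu
    exact hu.2 (hu.1.2 rfl)
  obtain ⟨ε', hε', hB⟩ := Metric.eventually_nhds_iff_ball.1
    ((hka.eventually_analyticAt.and hQ.eventually_analyticAt).and
      ((tt.eventually hGa2).and hGth.eventually_nhds))
  set ε := min ε' η with hεd
  have hε : 0 < ε := lt_min hε' hη
  have mem : ∀ {z : ℂ} {ξ : C2}, ‖z‖ < ε → ‖ξ‖ < ε → (z, ξ) ∈ ball (0 : ℂ × C2) ε' := by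
    intro a b ha hb
    rw [mem_ball_zero_iff, Prod.norm_def]
    exact lt_of_lt_of_le (max_lt ha hb) (min_le_left _ _)
  have hker : ∀ {z : ℂ} {ξ : C2}, ‖z‖ < ε → ‖ξ‖ < ε → k (z, ξ) = 0 →
      fderiv ℂ G (th Q (z, ξ)) = 0 := by
    intro z ξ hz hξ h0
    obtain ⟨⟨h1, h2⟩, h3, h4⟩ := hB _ (mem hz hξ)
    exact th_ker h2.differentiableAt h3.1.differentiableAt h4 h0
  have hsym : ∀ {z : ℂ} {ξ : C2}, ‖z‖ < ε → ‖ξ‖ < ε → k (z, ξ) = 0 →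
      fderiv ℂ G (sgL (th Q (z, ξ))) = 0 := by
    intro z ξ hz hξ h0
    obtain ⟨⟨h1, h2⟩, h3, h4⟩ := hB _ (mem hz hξ)
    exact sym_deriv hGs h3.1.differentiableAt h3.2.1.differentiableAt (hker hz hξ h0)
  have hk00 : k 0 = 0 := by
    simp only [hk]
    rw [th_zero hQ0, hG00]; rfl
  by_contra hJn'
  have P1 : ∀ z0 ξ0, ‖z0‖ < ε → ‖ξ0‖ < ε → k (z0, ξ0) = 0 → ∀ z, ‖z‖ < ε → k (z, ξ0) = 0 := by
    intro z0 ξ0 hz0 hξ0 h0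
    by_contra hcon
    push Not at hcon
    obtain ⟨z1, hz1, hne⟩ := hcon
    have hnev : ¬ ∀ᶠ z in 𝓝 z0, k (z, ξ0) = 0 := by
      intro hev
      have han : AnalyticOnNhd ℂ (fun z => k (z, ξ0)) (ball 0 ε) := fun z hz =>
        AnalyticAt.comp (g := k) (f := fun z : ℂ => (z, ξ0))
          (hB _ (mem (by simpa using hz) hξ0)).1.1 (by fun_prop)
      exact hne (han.eqOn_zero_of_preconnected_of_eventuallyEq_zero (convex_ball 0 ε).isPreconnected
        (by simpa using hz0 : z0 ∈ ball (0:ℂ) ε) hev (by simpa using hz1 : z1 ∈ ball (0:ℂ) ε))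
    have hrp := root_persist (hB _ (mem hz0 hξ0)).1.1 h0 hnev (sub_pos.2 hz0)
    have hJ0 : ∀ᶠ ξ in 𝓝 ξ0, J (cj ξ) = 0 := by
      filter_upwards [hrp, continuous_norm.continuousAt.eventually_lt_const hξ0] with ξ h1 h2
      obtain ⟨z, hz, hkz⟩ := h1
      have hz' : ‖z‖ < ε := by
        have := norm_add_le (z - z0) z0
        simp only [sub_add_cancel] at this
        linarith
      have h5 := (hB _ (mem hz' h2)).2.1.2.2.2 (hsym hz' h2 hkz)
      rw [sgL_apply] at h5
      exact h5
    have hJ1 : ∀ᶠ x in 𝓝 (cj ξ0), J x = 0 := by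
      have : Tendsto cj (𝓝 (cj ξ0)) (𝓝 ξ0) := by
        have := continuous_cj.tendsto (cj ξ0); rwa [cj_cj] at this
      filter_upwards [this.eventually hJ0] with x hx
      rwa [cj_cj] at hx
    apply hJn'
    have hc : cj ξ0 ∈ ball (0:C2) η := by
      rw [mem_ball_zero_iff]
      have : ‖cj ξ0‖ = ‖ξ0‖ := by simp [cj, Prod.norm_def]
      rw [this]; exact lt_of_lt_of_le hξ0 (min_le_right _ _)
    have hfin := AnalyticOnNhd.eqOn_zero_of_preconnected_of_eventuallyEq_zero (f := J)
      (fun x hx => hJA x hx) (convex_ball 0 η).isPreconnected hc hJ1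
    filter_upwards [ball_mem_nhds 0 hη] with x hx using hfin hx
  have n0 : ‖(0:C2)‖ < ε := by simpa using hε
  have n0' : ‖(0:ℂ)‖ < ε := by simpa using hε
  have hz0 : ∀ z, ‖z‖ < ε → k (z, 0) = 0 := P1 0 0 n0' n0 hk00
  apply hJn'
  have hE := Ec_analytic hQ
  have h1 : ∀ᶠ u in 𝓝 (0 : ℂ × ℂ), ‖u.1‖ < ε :=
    (continuous_norm.comp continuous_fst).continuousAt.eventually_lt_const (by simpa using hε)
  have h1' : ∀ᶠ ζ in 𝓝 (0 : ℂ), ‖ζ‖ < ε :=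
    continuous_norm.continuousAt.eventually_lt_const (by simpa using hε)
  have h2 : ∀ᶠ ζ in 𝓝 (0:ℂ), ‖Ec Q ζ‖ < ε :=
    hE.continuousAt.norm.eventually_lt_const (by simpa [Ec_zero hQ0] using hε)
  have t2 : Tendsto (fun u : ℂ × ℂ => u.2) (𝓝 0) (𝓝 0) := continuous_snd.tendsto' 0 0 rfl
  refine step3 hQ hQ0 hQi hnd hJ ?_
  filter_upwards [h1, t2.eventually h2, t2.eventually h1',
    t2.eventually (Q_zero_Ec hQ hQ0 hRs hQi)] with u h1 h2 h3 h4
  have e1 : sgL (th Q ((starRingEnd ℂ) u.2, 0)) = th Q (0, Ec Q u.2) := by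
    have hc : cj 0 = 0 := by simp [cj]
    rw [sgL_apply]
    simp only [th, Ec_eq, h4, conj_conj, hc]
    rfl
  have n1 : ‖(starRingEnd ℂ) u.2‖ < ε := by simpa using h3
  have e2 := hsym n1 n0 (hz0 _ n1)
  rw [e1] at e2
  have e3 : k (0, Ec Q u.2) = 0 := by simp only [hk]; rw [e2]; rfl
  have e4 := P1 0 (Ec Q u.2) n0' h2 e3 u.1 h1
  exact (hB _ (mem h1 h2)).2.1.2.2.1 (hker h1 h2 e4)
end


lemma cj_zero : cj 0 = 0 := by simp [cj]

lemma clm22 (A : C2 →L[ℂ] C2) (v : C2) : A v = v.1 • A (1, 0) + v.2 • A (0, 1) := by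
  have : v = v.1 • ((1, 0) : C2) + v.2 • ((0, 1) : C2) := by ext <;> simp
  conv_lhs => rw [this, map_add, map_smul, map_smul]

/-- Determinant of a linear endomorphism of `ℂ²`. -/
def det2 (A : C2 →L[ℂ] C2) : ℂ := (A (1, 0)).1 * (A (0, 1)).2 - (A (0, 1)).1 * (A (1, 0)).2

lemma det2_surj {A : C2 →L[ℂ] C2} (h : det2 A ≠ 0) (e : C2) : ∃ m, A m = e := by
  refine ⟨(((A (0, 1)).2 * e.1 - (A (0, 1)).1 * e.2) / det2 A,
    ((A (1, 0)).1 * e.2 - (A (1, 0)).2 * e.1) / det2 A), ?_⟩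
  rw [clm22]
  have hd : (A (1, 0)).1 * (A (0, 1)).2 - (A (0, 1)).1 * (A (1, 0)).2 = det2 A := rfl
  generalize det2 A = Δ at *
  ext
  · simp only [Prod.fst_add, Prod.smul_fst, smul_eq_mul]
    rw [div_mul_eq_mul_div, div_mul_eq_mul_div, ← add_div, div_eq_iff h, ← hd]
    ring
  · simp only [Prod.snd_add, Prod.smul_snd, smul_eq_mul]
    rw [div_mul_eq_mul_div, div_mul_eq_mul_div, ← add_div, div_eq_iff h, ← hd]
    ring

lemma det2_ker1 {A : C2 →L[ℂ] C2} (h : det2 A = 0) {e m : C2} (he : (A e).1 ≠ 0)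
    (hm : (A m).1 = 0) : A m = 0 := by
  refine Prod.ext hm ?_
  rw [clm22] at he hm ⊢
  simp only [det2, Prod.fst_add, Prod.smul_fst, Prod.snd_add, Prod.smul_snd, smul_eq_mul,
    Prod.snd_zero] at *
  generalize (A (1, 0)).1 = a at *
  generalize (A (1, 0)).2 = c at *
  generalize (A (0, 1)).1 = b at *
  generalize (A (0, 1)).2 = d at *
  by_cases ha : a = 0
  · have hb : b ≠ 0 := by rintro rfl; simp [ha] at he
    apply mul_left_cancel₀ hb
    linear_combination d * hm - m.1 * h
  · apply mul_left_cancel₀ ha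
    linear_combination c * hm + m.2 * h

lemma det2_ker2 {A : C2 →L[ℂ] C2} (h : det2 A = 0) {e m : C2} (he : (A e).2 ≠ 0)
    (hm : (A m).2 = 0) : A m = 0 := by
  refine Prod.ext ?_ hm
  rw [clm22] at he hm ⊢
  simp only [det2, Prod.fst_add, Prod.smul_fst, Prod.snd_add, Prod.smul_snd, smul_eq_mul,
    Prod.fst_zero] at *
  generalize (A (1, 0)).1 = a at *
  generalize (A (1, 0)).2 = c at *
  generalize (A (0, 1)).1 = b at *
  generalize (A (0, 1)).2 = d at *
  by_cases ha : c = 0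
  · have hb : d ≠ 0 := by rintro rfl; simp [ha] at he
    apply mul_left_cancel₀ hb
    linear_combination b * hm + m.1 * h
  · apply mul_left_cancel₀ ha
    linear_combination a * hm - m.2 * h

section
variable {R : C2 × C2 → ℂ} {r : C2 → ℝ} {p : C2}

lemma sym_fix (hs : ∀ x ξ, R (cj ξ, cj x) = (starRingEnd ℂ) (R (x, ξ))) {y : C2 × C2}
    (hy : sgL y = y) (h : DifferentiableAt ℂ R y) (v : C2 × C2) :
    fderiv ℂ R y (sgL v) = (starRingEnd ℂ) (fderiv ℂ R y v) := by
  have e1 := h.hasFDerivAt.restrictScalars ℝ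
  have e1' : HasFDerivAt R ((fderiv ℂ R y).restrictScalars ℝ) (sgL y) := by rwa [hy]
  have e2 := (Complex.conjCLE.toContinuousLinearMap.hasFDerivAt (x := R (sgL y))).comp y
      (e1'.comp y sgL.hasFDerivAt)
  have e3 : Complex.conjCLE.toContinuousLinearMap ∘ R ∘ sgL = R := by
    funext x
    simp only [Function.comp]
    rw [sgL_apply, hs]; simp
  rw [e3] at e2
  have := congrArg (fun L : C2 × C2 →L[ℝ] ℂ => L v) (e2.unique e1)
  simp at this
  rw [← this]; simp

lemma pol_d1 (hR : DifferentiableAt ℂ R (p, cj p)) (hr : DifferentiableAt ℝ r p)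
    (he : ∀ᶠ x in 𝓝 p, R (x, cj x) = r x) (v : C2) :
    fderiv ℂ R (p, cj p) (v, cj v) = (fderiv ℝ r p v : ℝ) := by
  have h1 : HasFDerivAt (fun x : C2 => ((x, cj x) : C2 × C2))
      ((ContinuousLinearMap.id ℝ C2).prod cjL) p := by
    have hc : HasFDerivAt cj cjL p :=
      (cjL.hasFDerivAt (x := p)).congr_of_eventuallyEq (.of_forall fun x => (cjL_apply x).symm)
    exact (hasFDerivAt_id p).prodMk hc
  have hR' : HasFDerivAt R ((fderiv ℂ R (p, cj p)).restrictScalars ℝ)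
      ((fun x : C2 => ((x, cj x) : C2 × C2)) p) := hR.hasFDerivAt.restrictScalars ℝ
  have h2 := hR'.comp p h1
  have h3 := (Complex.ofRealCLM.hasFDerivAt (x := r p)).comp p hr.hasFDerivAt
  have h4 := h2.unique (h3.congr_of_eventuallyEq he)
  have := congrArg (fun L : C2 →L[ℝ] ℂ => L v) h4
  simpa [cjL_apply] using this

lemma pol_d2 (hs : ∀ x ξ, R (cj ξ, cj x) = (starRingEnd ℂ) (R (x, ξ)))
    (hR : DifferentiableAt ℂ R (p, cj p)) (v : C2) :
    fderiv ℂ R (p, cj p) (0, cj v) = (starRingEnd ℂ) (fderiv ℂ R (p, cj p) (v, 0)) := by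
  rw [← sym_fix hs (by simp [sgL_apply, cj_cj]) hR, sgL_apply]
  simp [cj_zero]

lemma pol_zero_of (hs : ∀ x ξ, R (cj ξ, cj x) = (starRingEnd ℂ) (R (x, ξ)))
    (hR : DifferentiableAt ℂ R (p, cj p)) (h0 : ∀ v, fderiv ℂ R (p, cj p) (v, 0) = 0) :
    fderiv ℂ R (p, cj p) = 0 := by
  refine ContinuousLinearMap.ext fun v => ?_
  have : v = (v.1, 0) + (0, cj (cj v.2)) := by simp [cj_cj]
  rw [this, map_add, h0, pol_d2 hs hR, h0]; simp

lemma pol_zero (hs : ∀ x ξ, R (cj ξ, cj x) = (starRingEnd ℂ) (R (x, ξ)))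
    (hR : DifferentiableAt ℂ R (p, cj p)) (hr : DifferentiableAt ℝ r p)
    (he : ∀ᶠ x in 𝓝 p, R (x, cj x) = r x) (h0 : fderiv ℝ r p = 0) :
    fderiv ℂ R (p, cj p) = 0 := by
  have hre : ∀ v, (fderiv ℂ R (p, cj p) (v, 0)).re = 0 := by
    intro v
    have h1 := pol_d1 hR hr he v
    have h2 := pol_d2 hs hR v
    have : (v, cj v) = ((v, 0) : C2 × C2) + (0, cj v) := by simp
    rw [this, map_add, h2, h0, Complex.add_conj] at h1
    simpa using h1
  apply pol_zero_of hs hR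
  intro v
  apply Complex.ext
  · simpa using hre v
  · have := hre (I • v)
    have e : ((I • v, 0) : C2 × C2) = I • ((v, 0) : C2 × C2) := by simp
    rw [e, map_smul] at this
    simpa using this
end

theorem propC0 {r : C2 → ℝ} {F : C2 → C2} {r' : C2 → ℝ} (hr : AnalyticAt ℝ r 0) (hr0 : r 0 = 0)
    (hd : fderiv ℝ r 0 (0, 1) ≠ 0) (hF : AnalyticAt ℂ F 0) (hr' : AnalyticAt ℝ r' (F 0))
    (hd' : fderiv ℝ r' (F 0) ≠ 0) (hm : ∀ᶠ x in 𝓝 0, r x = 0 → r' (F x) = 0)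
    (hn : ¬ ∀ᶠ x in 𝓝 0, r' (F x) = 0)
    (hft : ∀ φ : ℂ → ℂ, AnalyticAt ℂ φ 0 → φ 0 = 0 → ¬ ∀ᶠ z in 𝓝 0, r (z, φ z) = 0) :
    fderiv ℝ (fun x => r' (F x)) 0 ≠ 0 := by
  obtain ⟨R, hR, hRe, hRs⟩ := polarize r 0 hr
  obtain ⟨R', hR', hRe', hRs'⟩ := polarize r' (F 0) hr'
  have z0 : ((0, cj 0) : C2 × C2) = 0 := by rw [cj_zero]; rfl
  have hR1 := pol_d1 hR.differentiableAt hr.differentiableAt hRe (0, 1)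
  have hR2 := pol_d2 hRs hR.differentiableAt (0, 1)
  have c1 : cj (0, 1) = (0, 1) := by simp [cj]
  rw [c1, z0] at hR1 hR2
  rw [z0] at hR
  have hR0 : R 0 = 0 := by have := hRe.self_of_nhds; rw [z0, hr0] at this; simpa using this
  have hRu : fderiv ℂ R 0 ((0, 1), (0, 1)) ≠ 0 := by
    rw [hR1]; exact_mod_cast hd
  have hRw : fderiv ℂ R 0 ((0, 1), 0) ≠ 0 := by
    intro h
    apply hRu
    have : (((0, 1), (0, 1)) : C2 × C2) = ((0, 1), 0) + (0, (0, 1)) := by simp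
    rw [this, map_add, hR2, h]; simp
  set Fs : C2 → C2 := fun ξ => cj (F (cj ξ)) with hFsd
  have hFs : AnalyticAt ℂ Fs 0 := analyticAt_conj2 (by rwa [cj_zero])
  set G : C2 × C2 → ℂ := fun y => R' (F y.1, Fs y.2) with hGd
  have hb : (F (0 : C2 × C2).1, Fs (0 : C2 × C2).2) = (F 0, cj (F 0)) := by
    simp [hFsd, cj_zero]
  have hF1 : AnalyticAt ℂ (fun y : C2 × C2 => F y.1) 0 :=
    AnalyticAt.comp (g := F) (f := fun y : C2 × C2 => y.1) hF (by fun_prop)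
  have hF2 : AnalyticAt ℂ (fun y : C2 × C2 => Fs y.2) 0 :=
    AnalyticAt.comp (g := Fs) (f := fun y : C2 × C2 => y.2) hFs (by fun_prop)
  have hFF : AnalyticAt ℂ (fun y : C2 × C2 => (F y.1, Fs y.2)) 0 := hF1.prod hF2
  have hG : AnalyticAt ℂ G 0 := by
    refine AnalyticAt.comp (g := R') (f := fun y : C2 × C2 => (F y.1, Fs y.2)) ?_ hFF
    show AnalyticAt ℂ R' (F (0 : C2 × C2).1, Fs (0 : C2 × C2).2)
    rw [hb]; exact hR'
  have hGs : ∀ x ξ, G (cj ξ, cj x) = (starRingEnd ℂ) (G (x, ξ)) := by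
    intro x ξ
    simp only [hGd, hFsd]
    rw [← hRs', cj_cj, cj_cj]
  have hρan : AnalyticAt ℝ (fun x => r' (F x)) 0 :=
    AnalyticAt.comp (g := r') hr' hF.restrictScalars
  have hGe : ∀ᶠ x in 𝓝 (0 : C2), G (x, cj x) = ((r' (F x) : ℝ) : ℂ) := by
    filter_upwards [hF.continuousAt.eventually hRe'] with x hx
    simp only [hGd, hFsd, cj_cj]; exact hx
  have hRG : ∀ᶠ y in 𝓝 (0 : C2 × C2), R y = 0 → G y = 0 := by
    refine pol_vanish hR hG hRs hR0 hRu ?_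
    filter_upwards [hRe, hGe, hm] with x h1 h2 h3 h4
    rw [h2, h3 (by rw [h1] at h4; exact_mod_cast h4)]; simp
  have tc : Tendsto (fun x : C2 => (x, cj x)) (𝓝 0) (𝓝 (0 : C2 × C2)) := by
    have : Continuous (fun x : C2 => (x, cj x)) := continuous_id.prodMk continuous_cj
    exact this.tendsto' _ _ z0
  obtain ⟨Q, hQ, hQ0, hQi⟩ := segre hR hR0 hRw
  have hnd : ¬ ∀ᶠ z in 𝓝 (0:ℂ), R ((z, Q (z, 0)), cj (z, Q (z, 0))) = 0 := by
    intro h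
    have hQa : AnalyticAt ℂ (fun z : ℂ => Q (z, 0)) 0 :=
      AnalyticAt.comp (g := Q) (f := fun z : ℂ => ((z, 0) : ℂ × C2)) hQ (by fun_prop)
    refine hft (fun z => Q (z, 0)) hQa hQ0 ?_
    have tz : Tendsto (fun z : ℂ => (z, Q (z, 0))) (𝓝 0) (𝓝 (0 : C2)) := by
      have : ContinuousAt (fun z : ℂ => (z, Q (z, 0))) 0 := continuousAt_id.prodMk hQa.continuousAt
      have h2 := this.tendsto
      have e : Q (0, 0) = 0 := hQ0
      simp only [e] at h2
      exact h2
    filter_upwards [h, tz.eventually hRe] with z h1 h2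
    rw [h1] at h2; exact_mod_cast h2.symm
  -- derivative of `G`
  have hGd' : ∀ᶠ y in 𝓝 (0 : C2 × C2), ∀ v : C2, fderiv ℂ G y (v, 0) =
      fderiv ℂ R' (F y.1, Fs y.2) (fderiv ℂ F y.1 v, 0) := by
    have t1 : Tendsto (fun y : C2 × C2 => (F y.1, Fs y.2)) (𝓝 0) (𝓝 (F 0, cj (F 0))) := by
      have := hFF.continuousAt.tendsto; rwa [hb] at this
    filter_upwards [t1.eventually hR'.eventually_analyticAt,
      (continuous_fst.tendsto (0 : C2 × C2)).eventually hF.eventually_analyticAt,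
      (continuous_snd.tendsto (0 : C2 × C2)).eventually hFs.eventually_analyticAt] with y h1 h2 h3 v
    have e1 := h2.differentiableAt.hasFDerivAt.comp y (hasFDerivAt_fst (𝕜 := ℂ) (p := y))
    have e2 := h3.differentiableAt.hasFDerivAt.comp y (hasFDerivAt_snd (𝕜 := ℂ) (p := y))
    have h1' : HasFDerivAt R' (fderiv ℂ R' (F y.1, Fs y.2)) ((F ∘ Prod.fst) y, (Fs ∘ Prod.snd) y) :=
      h1.differentiableAt.hasFDerivAt
    have e3 := h1'.comp y (e1.prodMk e2)
    have e4 : fderiv ℂ G y = _ := HasFDerivAt.fderiv e3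
    rw [e4]; simp
  obtain ⟨e0, he0⟩ : ∃ e0, fderiv ℂ R' (F 0, cj (F 0)) (e0, 0) ≠ 0 := by
    by_contra hcon
    push Not at hcon
    have h1 := pol_zero_of hRs' hR'.differentiableAt hcon
    apply hd'
    refine ContinuousLinearMap.ext fun v => ?_
    have := pol_d1 hR'.differentiableAt hr'.differentiableAt hRe' v
    rw [h1] at this
    have h2 : (0:ℂ) = ((fderiv ℝ r' (F 0) v : ℝ) : ℂ) := this
    exact_mod_cast h2.symm
  have he0' : ∀ᶠ y in 𝓝 (0 : C2 × C2), fderiv ℂ R' (F y.1, Fs y.2) (e0, 0) ≠ 0 := by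
    have h1 : AnalyticAt ℂ (fun y : C2 × C2 => fderiv ℂ R' (F y.1, Fs y.2)) 0 := by
      refine AnalyticAt.comp (g := fderiv ℂ R') (f := fun y : C2 × C2 => (F y.1, Fs y.2)) ?_ hFF
      show AnalyticAt ℂ (fderiv ℂ R') (F (0 : C2 × C2).1, Fs (0 : C2 × C2).2)
      rw [hb]; exact hR'.fderiv
    have h2 : ContinuousAt (fun y : C2 × C2 => fderiv ℂ R' (F y.1, Fs y.2) (e0, 0)) 0 :=
      h1.continuousAt.clm_apply continuousAt_const
    refine h2.eventually_ne ?_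
    show fderiv ℂ R' (F (0 : C2 × C2).1, Fs (0 : C2 × C2).2) (e0, 0) ≠ 0
    rw [hb]; exact he0
  set J : C2 → ℂ := fun x => det2 (fderiv ℂ F x) with hJd
  have hJ : AnalyticAt ℂ J 0 := by
    have hdF := hF.fderiv
    have ha : ∀ v, AnalyticAt ℂ (fun x => fderiv ℂ F x v) 0 := fun v =>
      ((ContinuousLinearMap.apply ℂ C2 v).analyticAt _).comp hdF
    have h1 := ha (1, 0)
    have h2 := ha (0, 1)
    simp only [hJd, det2]
    fun_prop
  have hGJ : ∀ᶠ y in 𝓝 (0 : C2 × C2), fderiv ℂ G y = 0 → J y.1 = 0 := by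
    filter_upwards [hGd', he0'] with y h1 h2 h3
    by_contra hJ0
    obtain ⟨m, hm⟩ := det2_surj hJ0 e0
    have := h1 m
    rw [h3, hm] at this
    exact h2 this.symm
  have hGn : ¬ ∀ᶠ y in 𝓝 0, G y = 0 := by
    intro h
    apply hn
    filter_upwards [tc.eventually h, hGe] with x h1 h2
    rw [h1] at h2; exact_mod_cast h2.symm
  have hJn : ¬ ∀ᶠ x in 𝓝 0, J x = 0 := by
    intro h
    have hJ' : ∀ᶠ y in 𝓝 (0 : C2 × C2), J y.1 = 0 :=
      (continuous_fst.tendsto' (0 : C2 × C2) 0 rfl).eventually h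
    have hFd : ∀ᶠ y in 𝓝 (0 : C2 × C2), DifferentiableAt ℂ F y.1 :=
      (continuous_fst.tendsto' (0 : C2 × C2) 0 rfl).eventually
        (hF.eventually_analyticAt.mono fun x hx => hx.differentiableAt)
    have f1 : ∀ x, DifferentiableAt ℂ F x → ∀ v, fderiv ℂ (fun x => (F x).1) x v = (fderiv ℂ F x v).1 := by
      intro x hx v
      rw [fderiv.fst hx]; rfl
    have f2 : ∀ x, DifferentiableAt ℂ F x → ∀ v, fderiv ℂ (fun x => (F x).2) x v = (fderiv ℂ F x v).2 := by
      intro x hx v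
      rw [fderiv.snd hx]; rfl
    have a1 : AnalyticAt ℂ (fun x => (F x).1) 0 := by fun_prop
    have a2 : AnalyticAt ℂ (fun x => (F x).2) 0 := by fun_prop
    have k1 := jac_b hR hG hRw hQ hQ0 hQi hRG (f := fun x => (F x).1) a1 (by
      filter_upwards [hJ', hFd, hGd'] with y h1 h2 h3 e m he hm
      rw [f1 _ h2] at he hm
      rw [h3, det2_ker1 h1 he hm]; exact map_zero _) hGn
    have k2 := jac_b hR hG hRw hQ hQ0 hQi hRG (f := fun x => (F x).2) a2 (by
      filter_upwards [hJ', hFd, hGd'] with y h1 h2 h3 e m he hm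
      rw [f2 _ h2] at he hm
      rw [h3, det2_ker2 h1 he hm]; exact map_zero _) hGn
    have q1 := const_of_seg hRs hQ hQ0 hQi hnd a1 k1
    have q2 := const_of_seg hRs hQ hQ0 hQi hnd a2 k2
    apply hn
    filter_upwards [q1, q2] with x h1 h2
    have : F x = F 0 := Prod.ext h1 h2
    rw [this]; exact hm.self_of_nhds hr0
  have hcore := core hG hRs hQ hQ0 hQi hnd hRG hGs hJ hJn hGJ
  intro h0
  apply hcore
  have := pol_zero (p := 0) hGs (by rw [z0]; exact hG.differentiableAt) hρan.differentiableAt hGe h0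
  rwa [z0] at this


theorem propC {r : C2 → ℝ} {F : C2 → C2} {r' : C2 → ℝ} {p : C2} (hr : AnalyticAt ℝ r p)
    (hr0 : r p = 0)
    (hd : fderiv ℝ r p ≠ 0) (hF : AnalyticAt ℂ F p) (hr' : AnalyticAt ℝ r' (F p))
    (hd' : fderiv ℝ r' (F p) ≠ 0) (hm : ∀ᶠ x in 𝓝 p, r x = 0 → r' (F x) = 0)
    (hn : ¬ ∀ᶠ x in 𝓝 p, r' (F x) = 0)
    (hft : ∀ φ : ℂ → C2, AnalyticAt ℂ φ 0 → φ 0 = p → (∀ᶠ z in 𝓝 0, r (φ z) = 0) →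
      ∀ᶠ z in 𝓝 0, φ z = p) :
    fderiv ℝ (fun x => r' (F x)) p ≠ 0 := by
  obtain ⟨v, hv⟩ : ∃ v, fderiv ℝ r p v ≠ 0 := by
    by_contra h
    push Not at h
    exact hd (ContinuousLinearMap.ext h)
  have hv0 : v ≠ 0 := by rintro rfl; simp at hv
  obtain ⟨T, hT⟩ := SeparatingDual.exists_continuousLinearEquiv_apply_eq (R := ℂ)
    (x := ((0, 1) : C2)) (y := v) (by simp) hv0
  set τ : C2 → C2 := fun x => p + T x with hτ
  have hτ0 : τ 0 = p := by simp [hτ]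
  have hτa : ∀ x, AnalyticAt ℂ τ x := fun x =>
    analyticAt_const.add (T.toContinuousLinearMap.analyticAt x)
  have hτaR : AnalyticAt ℝ τ 0 := (hτa 0).restrictScalars
  have hτd : HasFDerivAt τ (T.toContinuousLinearMap.restrictScalars ℝ) 0 :=
    ((T.toContinuousLinearMap.hasFDerivAt (x := 0)).restrictScalars ℝ).const_add p
  have hτt : Tendsto τ (𝓝 0) (𝓝 p) := by
    have := (hτa 0).continuousAt.tendsto; rwa [hτ0] at this
  have hσt : Tendsto (fun x => T.symm (x - p)) (𝓝 p) (𝓝 0) := by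
    have : Continuous fun x => T.symm (x - p) := by fun_prop
    exact this.tendsto' _ _ (by simp)
  have hστ : ∀ x, τ (T.symm (x - p)) = x := by intro x; simp [hτ]
  have h := propC0 (r := fun x => r (τ x)) (F := fun x => F (τ x)) (r' := r')
    (AnalyticAt.fun_comp (g := r) (by rwa [hτ0]) hτaR) (by simp [hτ0, hr0])
    (by
      have h1 : HasFDerivAt r (fderiv ℝ r p) (τ 0) := by
        rw [hτ0]; exact hr.differentiableAt.hasFDerivAt
      have h2 := h1.comp 0 hτd
      have h3 : fderiv ℝ (fun x => r (τ x)) 0 = _ := HasFDerivAt.fderiv h2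
      rw [h3]
      simpa [hT] using hv)
    (AnalyticAt.fun_comp (g := F) (by rwa [hτ0]) (hτa 0)) (by simpa only [hτ0] using hr')
    (by simpa only [hτ0] using hd') (hτt.eventually hm)
    (by
      intro hcon
      apply hn
      filter_upwards [hσt.eventually hcon] with x hx
      rwa [hστ] at hx)
    (by
      intro φ hφ hφ0 hcon
      have a1 : AnalyticAt ℂ (fun z => τ (z, φ z)) 0 :=
        AnalyticAt.fun_comp (g := τ) (f := fun z : ℂ => (z, φ z)) (hτa _) (by fun_prop)
      have := hft (fun z => τ (z, φ z)) a1 (by rw [hφ0]; exact hτ0) hcon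
      have h2 : ∀ᶠ z in 𝓝 (0:ℂ), z = 0 := by
        filter_upwards [this] with z hz
        have : T (z, φ z) = 0 := by simpa [hτ] using hz
        have := (map_eq_zero_iff T T.injective).1 this
        exact congrArg Prod.fst this
      have h3 : ∀ᶠ z in 𝓝[≠] (0:ℂ), False := by
        filter_upwards [h2.filter_mono nhdsWithin_le_nhds, self_mem_nhdsWithin] with z h1 h2
        exact h2 h1
      exact h3.exists.elim fun _ h => h)
  intro h0
  apply h
  have hρd : DifferentiableAt ℝ (fun x => r' (F x)) (τ 0) := by
    rw [hτ0]
    exact (AnalyticAt.fun_comp (g := r') hr' hF.restrictScalars).differentiableAt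
  have h1 : HasFDerivAt (fun x => r' (F x)) (0 : C2 →L[ℝ] ℝ) (τ 0) := by
    have h4 : fderiv ℝ (fun x => r' (F x)) (τ 0) = 0 := by rw [hτ0]; exact h0
    rw [← h4]
    exact hρd.hasFDerivAt
  have h2 := h1.comp 0 hτd
  have h3 : fderiv ℝ (fun x => r' (F (τ x))) 0 = _ := HasFDerivAt.fderiv h2
  rw [h3]; simp


section
variable {ρ r : C2 → ℝ} {p q : C2}

/-- Second derivative. -/
def D2 (ρ : C2 → ℝ) (p v w : C2) : ℝ := fderiv ℝ (fderiv ℝ ρ) p v w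

lemma D2_add_left (v v' w : C2) : D2 ρ p (v + v') w = D2 ρ p v w + D2 ρ p v' w := by simp [D2]
lemma D2_add_right (v w w' : C2) : D2 ρ p v (w + w') = D2 ρ p v w + D2 ρ p v w' := by simp [D2]
lemma D2_smul_left (a : ℝ) (v w : C2) : D2 ρ p (a • v) w = a * D2 ρ p v w := by simp [D2]
lemma D2_smul_right (a : ℝ) (v w : C2) : D2 ρ p v (a • w) = a * D2 ρ p v w := by simp [D2]

lemma D2_symm (hρ : AnalyticAt ℝ ρ p) (v w : C2) : D2 ρ p v w = D2 ρ p w v := by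
  have := (hρ.contDiffAt (n := 2)).isSymmSndFDerivAt (by simp)
  exact this v w

lemma fderiv_oc {x : C2} (h : DifferentiableAt ℝ ρ x) (v : C2) :
    fderiv ℝ (oc ρ) x v = ((fderiv ℝ ρ x v : ℝ) : ℂ) := by
  have := (Complex.ofRealCLM.hasFDerivAt (x := ρ x)).comp x h.hasFDerivAt
  have h2 : fderiv ℝ (oc ρ) x = _ := HasFDerivAt.fderiv this
  rw [h2]; simp

lemma hasFDerivAt_D2 (hρ : AnalyticAt ℝ ρ p) (w : C2) :
    HasFDerivAt (fun x => fderiv ℝ ρ x w) ((fderiv ℝ (fderiv ℝ ρ) p).flip w) p := by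
  have h1 := hρ.fderiv.differentiableAt.hasFDerivAt
  have := h1.clm_apply (hasFDerivAt_const w p)
  exact this.congr_fderiv (by ext <;> simp)

lemma fderiv_wb (hρ : AnalyticAt ℝ ρ p) (e e' : C2) (g : C2 → ℂ)
    (hg : ∀ᶠ x in 𝓝 p, g x = (1 / 2 : ℂ) * (((fderiv ℝ ρ x e : ℝ) : ℂ) + I * ((fderiv ℝ ρ x e' : ℝ) : ℂ)))
    (v : C2) : fderiv ℝ g p v = (1 / 2 : ℂ) * ((D2 ρ p v e : ℝ) + I * (D2 ρ p v e' : ℝ)) := by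
  have h1 := (Complex.ofRealCLM.hasFDerivAt (x := fderiv ℝ ρ p e)).comp p (hasFDerivAt_D2 hρ e)
  have h2 := (Complex.ofRealCLM.hasFDerivAt (x := fderiv ℝ ρ p e')).comp p (hasFDerivAt_D2 hρ e')
  have h3 := (h1.add (h2.const_mul I)).const_mul (1 / 2 : ℂ)
  have h4 := (h3.congr_of_eventuallyEq (f₁ := g) hg).fderiv
  rw [h4]; simp [D2]; ring

lemma wdbar_ev (hρ : AnalyticAt ℝ ρ p) : ∀ᶠ x in 𝓝 p, DifferentiableAt ℝ ρ x :=
  hρ.eventually_analyticAt.mono fun _ h => h.differentiableAt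

lemma c2_expand (t : C2) : t = t.1.re • ((1, 0) : C2) + t.1.im • ((I, 0) : C2) +
    (t.2.re • ((0, 1) : C2) + t.2.im • ((0, I) : C2)) := by
  ext <;> simp

lemma c2_expand' (t : C2) : I • t = (-t.1.im) • ((1, 0) : C2) + t.1.re • ((I, 0) : C2) +
    ((-t.2.im) • ((0, 1) : C2) + t.2.re • ((0, I) : C2)) := by
  apply Prod.ext <;> apply Complex.ext <;> simp

lemma levi_eq (hρ : AnalyticAt ℝ ρ p) (t : C2) :
    levi ρ p t = ((1 / 4 * (D2 ρ p t t + D2 ρ p (I • t) (I • t)) : ℝ) : ℂ) := by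
  have k1 := fderiv_wb hρ (1, 0) (I, 0) (wdbar1 (oc ρ)) (by
    filter_upwards [wdbar_ev hρ] with x hx
    rw [wdbar1, fderiv_oc hx, fderiv_oc hx])
  have k2 := fderiv_wb hρ (0, 1) (0, I) (wdbar2 (oc ρ)) (by
    filter_upwards [wdbar_ev hρ] with x hx
    rw [wdbar2, fderiv_oc hx, fderiv_oc hx])
  have s1 := D2_symm hρ (I, 0) (1, 0)
  have s2 := D2_symm hρ (0, 1) (1, 0)
  have s3 := D2_symm hρ (0, I) (1, 0)
  have s4 := D2_symm hρ (0, 1) (I, 0)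
  have s5 := D2_symm hρ (0, I) (I, 0)
  have s6 := D2_symm hρ (0, I) (0, 1)
  have e1 := congrArg (fun u => D2 ρ p u u) (c2_expand t)
  simp only [D2_add_left, D2_add_right, D2_smul_left, D2_smul_right, s1, s2, s3, s4, s5, s6] at e1
  have e2 := congrArg (fun u => D2 ρ p u u) (c2_expand' t)
  simp only [D2_add_left, D2_add_right, D2_smul_left, D2_smul_right, s1, s2, s3, s4, s5, s6] at e2
  rw [e1, e2]
  simp only [levi, wd1, wd2, k1, k2, s1, s2, s3, s4, s5, s6]
  apply Complex.ext
  · simp; ring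
  · simp; ring

lemma tangent_iff (hρ : DifferentiableAt ℝ ρ p) (t : C2) :
    tangentVec ρ p t ↔ fderiv ℝ ρ p t = 0 ∧ fderiv ℝ ρ p (I • t) = 0 := by
  have rsm : ∀ (a : ℝ) (v : C2), fderiv ℝ ρ p (a • v) = a * fderiv ℝ ρ p v := fun a v => by simp
  have e1 := congrArg (fderiv ℝ ρ p) (c2_expand t)
  simp only [map_add, rsm] at e1
  have e2 := congrArg (fderiv ℝ ρ p) (c2_expand' t)
  simp only [map_add, rsm] at e2
  have e3 : wd1 (oc ρ) p * t.1 + wd2 (oc ρ) p * t.2 =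
      ⟨1 / 2 * fderiv ℝ ρ p t, - (1 / 2 * fderiv ℝ ρ p (I • t))⟩ := by
    rw [e1, e2]
    simp only [wd1, wd2, fderiv_oc hρ]
    apply Complex.ext
    · simp; ring
    · simp; ring
  rw [tangentVec, e3, Complex.ext_iff]
  simp
end


lemma levi_comp {r' : C2 → ℝ} {F : C2 → C2} {q : C2} (hF : AnalyticAt ℂ F q)
    (hr' : AnalyticAt ℝ r' (F q)) (t : C2) :
    levi (fun x => r' (F x)) q t = levi r' (F q) (fderiv ℂ F q t) := by
  have hρ : AnalyticAt ℝ (fun x => r' (F x)) q :=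
    AnalyticAt.fun_comp (g := r') hr' hF.restrictScalars
  have hFR : HasFDerivAt F ((fderiv ℂ F q).restrictScalars ℝ) q :=
    hF.differentiableAt.hasFDerivAt.restrictScalars ℝ
  have key : ∀ v w : C2, D2 (fun x => r' (F x)) q v w =
      D2 r' (F q) (fderiv ℂ F q v) (fderiv ℂ F q w) +
        fderiv ℝ r' (F q) (fderiv ℂ (fderiv ℂ F) q v w) := by
    intro v w
    have e1 : ∀ᶠ x in 𝓝 q, fderiv ℝ (fun x => r' (F x)) x w =
        fderiv ℝ r' (F x) (fderiv ℂ F x w) := by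
      filter_upwards [hF.eventually_analyticAt,
        hF.continuousAt.eventually hr'.eventually_analyticAt] with x h1 h2
      have := h2.differentiableAt.hasFDerivAt.comp x
        (h1.differentiableAt.hasFDerivAt.restrictScalars ℝ)
      have h3 : fderiv ℝ (fun x => r' (F x)) x = _ := HasFDerivAt.fderiv this
      rw [h3]; rfl
    have h1 : HasFDerivAt (fun x => fderiv ℝ r' (F x)) _ q :=
      hr'.fderiv.differentiableAt.hasFDerivAt.comp q hFR
    have h2 : HasFDerivAt (fun x => fderiv ℂ F x w)
        (((fderiv ℂ (fderiv ℂ F) q).flip w).restrictScalars ℝ) q := by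
      have := hF.fderiv.differentiableAt.hasFDerivAt.clm_apply (hasFDerivAt_const w q)
      exact (this.congr_fderiv (f' := _) (g' := (fderiv ℂ (fderiv ℂ F) q).flip w)
        (by ext <;> simp)).restrictScalars ℝ
    have h3 := (h1.clm_apply h2).congr_of_eventuallyEq e1
    have h4 := h3.unique (hasFDerivAt_D2 hρ w)
    have h5 := congrArg (fun L : C2 →L[ℝ] ℝ => L v) h4
    simp at h5
    rw [D2, ← h5, D2, add_comm]
  rw [levi_eq hρ, levi_eq hr', key, key]
  have h6 : fderiv ℂ (fderiv ℂ F) q (I • t) (I • t) = - fderiv ℂ (fderiv ℂ F) q t t := by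
    rw [map_smul, map_smul, smul_apply, smul_smul, I_mul_I]; simp
  rw [h6, map_smul, map_neg]
  congr 1
  ring

lemma straight {r : C2 → ℝ} {q t : C2} (hr : AnalyticAt ℝ r q) (hr0 : r q = 0)
    (hd : fderiv ℝ r q ≠ 0) (ht : fderiv ℝ r q t = 0) :
    ∃ γ : ℝ → C2, AnalyticAt ℝ γ 0 ∧ γ 0 = q ∧ deriv γ 0 = t ∧ ∀ᶠ s in 𝓝 0, r (γ s) = 0 := by
  obtain ⟨v0, hv0⟩ : ∃ v, fderiv ℝ r q v ≠ 0 := by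
    by_contra h
    push Not at h
    exact hd (ContinuousLinearMap.ext h)
  set v := (fderiv ℝ r q v0)⁻¹ • v0 with hvd
  have hv : fderiv ℝ r q v = 1 := by rw [hvd, map_smul]; simp [hv0]
  set Ψ : C2 → C2 := fun x => x + (r x - fderiv ℝ r q (x - q)) • v with hΨ
  have hΨa : AnalyticAt ℝ Ψ q := by
    have h1 : AnalyticAt ℝ (fun x => fderiv ℝ r q (x - q)) q :=
      AnalyticAt.fun_comp (g := fderiv ℝ r q) (ContinuousLinearMap.analyticAt _ _)
        (by fun_prop)
    exact analyticAt_id.add ((hr.sub h1).smul analyticAt_const)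
  have hΨq : Ψ q = q := by simp [hΨ, hr0]
  have hΨd : HasFDerivAt Ψ (ContinuousLinearMap.id ℝ C2) q := by
    have h1 : HasFDerivAt (fun x => fderiv ℝ r q (x - q)) (fderiv ℝ r q) q := by
      have := (fderiv ℝ r q).hasFDerivAt.comp q ((hasFDerivAt_id q).sub_const q)
      exact this.congr_fderiv (by ext <;> simp)
    have := (hasFDerivAt_id q).add ((hr.differentiableAt.hasFDerivAt.sub h1).smul_const v)
    exact this.congr_fderiv (by ext <;> simp)
  have hrΨ : ∀ x, fderiv ℝ r q (Ψ x - q) = r x := by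
    intro x
    have : Ψ x - q = (x - q) + (r x - fderiv ℝ r q (x - q)) • v := by simp only [hΨ]; abel
    rw [this, map_add, map_smul, hv]; simp
  obtain ⟨Θ, hΘ, hΘq, hl, hri⟩ := inv_fn (𝕜 := ℝ) hΨa (by
    intro w hw; rw [hΨd.fderiv] at hw; exact hw)
  rw [hΨq] at hΘ hΘq hri
  have hΘd : HasFDerivAt Θ (ContinuousLinearMap.id ℝ C2) q := by
    have h1 : HasFDerivAt Θ (fderiv ℝ Θ q) (Ψ q) := by
      rw [hΨq]; exact hΘ.differentiableAt.hasFDerivAt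
    have h2 := (h1.comp q hΨd).unique ((hasFDerivAt_id q).congr_of_eventuallyEq hl)
    have h3 : fderiv ℝ Θ q = ContinuousLinearMap.id ℝ C2 := by simpa using h2
    rw [← h3]; exact hΘ.differentiableAt.hasFDerivAt
  have hline : HasDerivAt (fun s : ℝ => q + s • t) t 0 := by
    simpa using ((hasDerivAt_id (0:ℝ)).smul_const t).const_add q
  have l0 : q + (0:ℝ) • t = q := by simp
  have hla : AnalyticAt ℝ (fun s : ℝ => q + s • t) 0 :=
    analyticAt_const.add (analyticAt_id.smul analyticAt_const)
  refine ⟨fun s => Θ (q + s • t), AnalyticAt.fun_comp (g := Θ) (by rwa [l0]) hla,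
    by simp [hΘq], ?_, ?_⟩
  · have h1 : HasFDerivAt Θ (ContinuousLinearMap.id ℝ C2) ((fun s : ℝ => q + s • t) 0) := by
      simpa using hΘd
    exact (h1.comp_hasDerivAt 0 hline).deriv
  · have : Tendsto (fun s : ℝ => q + s • t) (𝓝 0) (𝓝 q) := by
      have := hla.continuousAt.tendsto; simpa using this
    filter_upwards [this.eventually hri] with s hs
    rw [← hrΨ, hs]; simp [ht]

lemma vanish_deriv {r g : C2 → ℝ} {q : C2} (hr : AnalyticAt ℝ r q) (hr0 : r q = 0)
    (hd : fderiv ℝ r q ≠ 0) (hg : AnalyticAt ℝ g q) (hv : ∀ᶠ x in 𝓝 q, r x = 0 → g x = 0)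
    {t : C2} (ht : fderiv ℝ r q t = 0) :
    fderiv ℝ g q t = 0 ∧ (fderiv ℝ g q = 0 → D2 g q t t = 0) := by
  obtain ⟨γ, hγ, hγ0, hγd, hγr⟩ := straight hr hr0 hd ht
  have tγ : Tendsto γ (𝓝 0) (𝓝 q) := by have := hγ.continuousAt.tendsto; rwa [hγ0] at this
  have hz : ∀ᶠ s in 𝓝 (0:ℝ), g (γ s) = 0 := by
    filter_upwards [hγr, tγ.eventually hv] with s h1 h2 using h2 h1
  have hD : ∀ᶠ s in 𝓝 (0:ℝ), fderiv ℝ g (γ s) (deriv γ s) = 0 := by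
    filter_upwards [hz.eventually_nhds, tγ.eventually hg.eventually_analyticAt,
      hγ.eventually_analyticAt] with s h1 h2 h3
    have := h2.differentiableAt.hasFDerivAt.comp_hasDerivAt s h3.differentiableAt.hasDerivAt
    exact this.unique ((hasDerivAt_const s (0:ℝ)).congr_of_eventuallyEq h1)
  refine ⟨by simpa [hγ0, hγd] using hD.self_of_nhds, fun h0 => ?_⟩
  have h1 : HasFDerivAt (fderiv ℝ g) (fderiv ℝ (fderiv ℝ g) q) (γ 0) := by
    rw [hγ0]; exact hg.fderiv.differentiableAt.hasFDerivAt
  have h2 := h1.comp_hasDerivAt 0 hγ.differentiableAt.hasDerivAt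
  have h3 := h2.clm_apply hγ.deriv.differentiableAt.hasDerivAt
  have h4 := h3.unique ((hasDerivAt_const (0:ℝ) (0:ℝ)).congr_of_eventuallyEq hD)
  rw [hγd] at h4
  simpa [hγ0, h0, D2] using h4

lemma multiplier {r ρ : C2 → ℝ} {q : C2} (hr : AnalyticAt ℝ r q) (hr0 : r q = 0)
    (hd : fderiv ℝ r q ≠ 0) (hρ : AnalyticAt ℝ ρ q) (hv : ∀ᶠ x in 𝓝 q, r x = 0 → ρ x = 0)
    (hneg : ∀ᶠ x in 𝓝 q, r x < 0 → ρ x < 0) :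
    ∃ h : ℝ, 0 ≤ h ∧ fderiv ℝ ρ q = h • fderiv ℝ r q ∧
      ∀ t, tangentVec r q t → levi ρ q t = h * levi r q t := by
  obtain ⟨v0, hv0⟩ : ∃ v, fderiv ℝ r q v ≠ 0 := by
    by_contra h
    push Not at h
    exact hd (ContinuousLinearMap.ext h)
  set v := (fderiv ℝ r q v0)⁻¹ • v0 with hvd
  have hv1 : fderiv ℝ r q v = 1 := by rw [hvd, map_smul]; simp [hv0]
  have hmul : fderiv ℝ ρ q = fderiv ℝ ρ q v • fderiv ℝ r q := by
    refine ContinuousLinearMap.ext fun x => ?_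
    have h1 := (vanish_deriv hr hr0 hd hρ hv (t := x - fderiv ℝ r q x • v)
      (by rw [map_sub, map_smul, hv1]; simp)).1
    rw [map_sub, map_smul] at h1
    simp at h1 ⊢
    linarith
  refine ⟨fderiv ℝ ρ q v, ?_, hmul, ?_⟩
  · by_contra hneg'
    push Not at hneg'
    have hl : HasDerivAt (fun s : ℝ => q + s • v) v 0 := by
      simpa using ((hasDerivAt_id (0:ℝ)).smul_const v).const_add q
    have d1 : ∀ {g : C2 → ℝ}, AnalyticAt ℝ g q →
        HasDerivAt (fun s : ℝ => g (q + s • v)) (fderiv ℝ g q v) 0 := by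
      intro g hg
      have h1 : HasFDerivAt g (fderiv ℝ g q) ((fun s : ℝ => q + s • v) 0) := by
        simpa using hg.differentiableAt.hasFDerivAt
      exact h1.comp_hasDerivAt 0 hl
    have s1 := eventually_nhdsWithin_sign_eq_of_deriv_pos (f := fun s : ℝ => r (q + s • v)) (x₀ := 0)
      (by rw [(d1 hr).deriv, hv1]; norm_num) (by simp [hr0])
    have s2 := eventually_nhdsWithin_sign_eq_of_deriv_neg (f := fun s : ℝ => ρ (q + s • v)) (x₀ := 0)
      (by rw [(d1 hρ).deriv]; exact hneg') (by simpa using hv.self_of_nhds hr0)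
    have tl : Tendsto (fun s : ℝ => q + s • v) (𝓝 0) (𝓝 q) := by
      have := hl.continuousAt.tendsto; simpa using this
    have := (((s1.and s2).and (tl.eventually hneg)).filter_mono
      (nhdsWithin_le_nhds (s := Iio 0))).and self_mem_nhdsWithin
    obtain ⟨s, ⟨⟨h1, h2⟩, h3⟩, h4⟩ := this.exists
    have h4 : s < 0 := h4
    simp only [sub_zero, zero_sub] at h1 h2
    rw [sign_neg h4, sign_eq_neg_one_iff] at h1
    rw [sign_pos (neg_pos.2 h4), sign_eq_one_iff] at h2
    linarith [h3 h1]
  · intro t ht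
    rw [tangent_iff hr.differentiableAt] at ht
    set h := fderiv ℝ ρ q v
    have hga : AnalyticAt ℝ (fun x => ρ x - h * r x) q := hρ.sub (analyticAt_const.mul hr)
    have hgd : fderiv ℝ (fun x => ρ x - h * r x) q = 0 := by
      have := hρ.differentiableAt.hasFDerivAt.sub (hr.differentiableAt.hasFDerivAt.const_mul h)
      have h2 : fderiv ℝ (fun x => ρ x - h * r x) q = _ := this.fderiv
      rw [h2, hmul]; simp
    have hD : ∀ w, D2 (fun x => ρ x - h * r x) q w w = D2 ρ q w w - h * D2 r q w w := by
      intro w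
      have e1 : ∀ᶠ x in 𝓝 q, fderiv ℝ (fun x => ρ x - h * r x) x w =
          fderiv ℝ ρ x w - h * fderiv ℝ r x w := by
        filter_upwards [hρ.eventually_analyticAt, hr.eventually_analyticAt] with x h1 h2
        have := h1.differentiableAt.hasFDerivAt.sub (h2.differentiableAt.hasFDerivAt.const_mul h)
        have h3 : fderiv ℝ (fun x => ρ x - h * r x) x = _ := this.fderiv
        rw [h3]; simp
      have e2 := ((hasFDerivAt_D2 hρ w).sub ((hasFDerivAt_D2 hr w).const_mul h)).congr_of_eventuallyEq e1
      have e3 := congrArg (fun L : C2 →L[ℝ] ℝ => L w) ((hasFDerivAt_D2 hga w).unique e2)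
      simpa [D2] using e3
    have hvg : ∀ᶠ x in 𝓝 q, r x = 0 → ρ x - h * r x = 0 := by
      filter_upwards [hv] with x hx h0
      rw [hx h0, h0]; simp
    have a1 := (vanish_deriv hr hr0 hd hga hvg ht.1).2 hgd
    have a2 := (vanish_deriv hr hr0 hd hga hvg ht.2).2 hgd
    rw [hD] at a1 a2
    rw [levi_eq hρ, levi_eq hr, ← Complex.ofReal_mul]
    congr 1
    linarith


lemma zero_imp {r ρ : C2 → ℝ} {p v : C2} (hr : AnalyticAt ℝ r p) (hρ : AnalyticAt ℝ ρ p)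
    (hr0 : r p = 0) (hrv : fderiv ℝ r p v = 1) (hρv : 0 < fderiv ℝ ρ p v)
    (hz : ∀ᶠ x in 𝓝 p, r x = 0 → ρ x = 0) (hneg : ∀ᶠ x in 𝓝 p, r x < 0 → ρ x < 0) :
    ∀ᶠ x in 𝓝 p, ρ x = 0 → r x = 0 := by
  have c1 : ∀ᶠ x in 𝓝 p, 1 / 2 < fderiv ℝ r x v :=
    (hr.fderiv.continuousAt.clm_apply continuousAt_const).eventually_const_lt
      (by simp only [hrv]; norm_num)
  have c2 : ∀ᶠ x in 𝓝 p, 0 < fderiv ℝ ρ x v :=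
    (hρ.fderiv.continuousAt.clm_apply continuousAt_const).eventually_const_lt hρv
  obtain ⟨δ, hδ, hB⟩ := Metric.eventually_nhds_iff_ball.1
    ((c1.and c2).and ((hr.eventually_analyticAt.and hρ.eventually_analyticAt).and (hz.and hneg)))
  have c3 : ∀ᶠ x in 𝓝 p, 2 * r x * ‖v‖ < δ / 2 := by
    have : ContinuousAt (fun x => 2 * r x * ‖v‖) p :=
      (continuousAt_const.mul hr.continuousAt).mul continuousAt_const
    exact this.eventually_lt_const (by simp only [hr0]; linarith)
  filter_upwards [c3, ball_mem_nhds p (half_pos hδ)] with x hx3 hxb hρx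
  have hxB : x ∈ ball p δ := ball_subset_ball (by linarith) hxb
  rcases lt_trichotomy (r x) 0 with h | h | h
  · have := (hB x hxB).2.2.2 h; linarith
  · exact h
  exfalso
  have hin : ∀ s ∈ Icc 0 (2 * r x), x - s • v ∈ ball p δ := by
    intro s hs
    rw [mem_ball, dist_eq_norm] at hxb ⊢
    have e1 : x - s • v - p = (x - p) - s • v := by abel
    rw [e1]
    have e2 := norm_sub_le (x - p) (s • v)
    rw [norm_smul, Real.norm_eq_abs, abs_of_nonneg hs.1] at e2
    have e3 : s * ‖v‖ ≤ 2 * r x * ‖v‖ := mul_le_mul_of_nonneg_right hs.2 (norm_nonneg _)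
    linarith
  have hder : ∀ {g : C2 → ℝ}, ∀ s, AnalyticAt ℝ g (x - s • v) →
      HasDerivAt (fun s : ℝ => g (x - s • v)) (-(fderiv ℝ g (x - s • v) v)) s := by
    intro g s hg
    have hl : HasDerivAt (fun s : ℝ => x - s • v) (-v) s := by
      simpa using ((hasDerivAt_id s).smul_const v).const_sub x
    have h1 : HasFDerivAt g (fderiv ℝ g (x - s • v)) ((fun s : ℝ => x - s • v) s) :=
      hg.differentiableAt.hasFDerivAt
    have := h1.comp_hasDerivAt s hl
    rw [map_neg] at this
    exact this
  have hS : 0 < 2 * r x := by linarith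
  have hrd : ∀ s ∈ Icc 0 (2 * r x), HasDerivAt (fun s : ℝ => r (x - s • v))
      (-(fderiv ℝ r (x - s • v) v)) s := fun s hs => hder s (hB _ (hin s hs)).2.1.1
  have hρd : ∀ s ∈ Icc 0 (2 * r x), HasDerivAt (fun s : ℝ => ρ (x - s • v))
      (-(fderiv ℝ ρ (x - s • v) v)) s := fun s hs => hder s (hB _ (hin s hs)).2.1.2
  have hrc : ContinuousOn (fun s : ℝ => r (x - s • v)) (Icc 0 (2 * r x)) :=
    fun s hs => (hrd s hs).continuousAt.continuousWithinAt
  obtain ⟨c, hc, hce⟩ := exists_hasDerivAt_eq_slope (fun s : ℝ => r (x - s • v)) _ hS hrc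
    (fun s hs => hrd s (Ioo_subset_Icc_self hs))
  have hc1 := (hB _ (hin c (Ioo_subset_Icc_self hc))).1.1
  rw [eq_div_iff (by linarith)] at hce
  simp only [zero_smul, sub_zero] at hce
  have hend : r (x - (2 * r x) • v) ≤ 0 := by nlinarith
  obtain ⟨s0, hs0, hs0e⟩ := intermediate_value_Icc' hS.le hrc
    (show (0:ℝ) ∈ Icc _ _ from ⟨hend, by simpa using h.le⟩)
  have hs0e : r (x - s0 • v) = 0 := hs0e
  have hs0p : 0 < s0 := by
    rcases hs0.1.lt_or_eq with h' | h'
    · exact h'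
    · rw [← h'] at hs0e; simp at hs0e; linarith
  have hsub : Icc 0 s0 ⊆ Icc 0 (2 * r x) := Icc_subset_Icc_right hs0.2
  obtain ⟨c', hc', hce'⟩ := exists_hasDerivAt_eq_slope (fun s : ℝ => ρ (x - s • v)) _ hs0p
    (fun s hs => (hρd s (hsub hs)).continuousAt.continuousWithinAt)
    (fun s hs => hρd s (hsub (Ioo_subset_Icc_self hs)))
  have hc2 := (hB _ (hin c' (hsub (Ioo_subset_Icc_self hc')))).1.2
  have hρ0 := (hB _ (hin s0 hs0)).2.2.1 hs0e
  rw [hρ0] at hce'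
  simp [hρx] at hce'
  linarith

lemma E_bound {a : C2 → ℂ} (ha : AnalyticAt ℂ a 0) (ha0 : a 0 = 0)
    (hn : ¬ ∀ᶠ z in 𝓝 (0:ℂ), fderiv ℂ a (z, 0) (1, 0) = 0) :
    ∃ (C : ℝ) (n : ℕ), 0 < C ∧ ∀ᶠ x in 𝓝 (0 : C2), fderiv ℂ a x (1, 0) = 0 →
      ‖x.1‖ ^ n ≤ C * ‖x.2‖ ∧ ‖a x‖ ≤ C * ‖x.2‖ := by
  set k : C2 → ℂ := fun x => fderiv ℂ a x (1, 0) with hk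
  have hka : AnalyticAt ℂ k 0 :=
    ((ContinuousLinearMap.apply ℂ ℂ ((1, 0) : C2)).analyticAt _).comp ha.fderiv
  have hk1 : AnalyticAt ℂ (fun z : ℂ => k (z, 0)) 0 :=
    AnalyticAt.fun_comp (g := k) (f := fun z : ℂ => ((z, 0) : C2)) hka (by fun_prop)
  obtain ⟨n, g, hg, hg0, hgk⟩ := hk1.exists_eventuallyEq_pow_smul_nonzero_iff.2 hn
  have gn : 0 < ‖g 0‖ := norm_pos_iff.2 hg0
  have g1 : ∀ᶠ z in 𝓝 (0:ℂ), ‖g 0‖ / 2 < ‖g z‖ :=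
    hg.continuousAt.norm.eventually_const_lt (by linarith)
  have g2 : ∀ᶠ z in 𝓝 (0:ℂ), ‖g z‖ < 2 * ‖g 0‖ :=
    hg.continuousAt.norm.eventually_lt_const (by linarith)
  obtain ⟨K1, t1, ht1, hK1⟩ := (hka.contDiffAt (n := 1)).exists_lipschitzOnWith
  obtain ⟨K2, t2, ht2, hK2⟩ := (ha.contDiffAt (n := 1)).exists_lipschitzOnWith
  obtain ⟨ε1, hε1, hB1⟩ := Metric.eventually_nhds_iff_ball.1 ((g1.and g2).and hgk)
  obtain ⟨ε2, hε2, hB2⟩ := Metric.eventually_nhds_iff_ball.1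
    (((show ∀ᶠ x in 𝓝 (0:C2), x ∈ t1 from ht1).and (show ∀ᶠ x in 𝓝 (0:C2), x ∈ t2 from ht2)).and ha.eventually_analyticAt)
  set ε := min 1 (min ε1 ε2) with hεd
  have hε : 0 < ε := lt_min one_pos (lt_min hε1 hε2)
  have e1 : ε ≤ 1 := min_le_left _ _
  have e2 : ε ≤ ε1 := (min_le_right _ _).trans (min_le_left _ _)
  have e3 : ε ≤ ε2 := (min_le_right _ _).trans (min_le_right _ _)
  set m := ‖g 0‖ / 2 with hm
  have hm0 : 0 < m := half_pos gn
  have hkb : ∀ z : ℂ, ‖z‖ < ε → m * ‖z‖ ^ n ≤ ‖k (z, 0)‖ ∧ ‖k (z, 0)‖ ≤ 4 * m * ‖z‖ ^ n := by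
    intro z hz
    obtain ⟨⟨h1, h2⟩, h3⟩ := hB1 z (by simpa using lt_of_lt_of_le hz e2)
    rw [h3, norm_smul, norm_pow, sub_zero]
    have := pow_nonneg (norm_nonneg z) n
    constructor
    · nlinarith
    · have : 4 * m = 2 * ‖g 0‖ := by rw [hm]; ring
      rw [this]; nlinarith
  refine ⟨max (K1 / m) (4 * K1 + K2) + 1, n, ?_, ?_⟩
  · have : (0:ℝ) ≤ 4 * K1 + K2 := by positivity
    have := le_max_right ((K1:ℝ) / m) (4 * K1 + K2)
    linarith
  filter_upwards [ball_mem_nhds 0 hε] with x hx hkx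
  obtain ⟨z, w⟩ := x
  rw [mem_ball_zero_iff, Prod.norm_def, max_lt_iff] at hx
  obtain ⟨hz, hw⟩ := hx
  simp only at hz hw ⊢
  have mem : ∀ z' w' : ℂ, ‖z'‖ < ε → ‖w'‖ < ε → (z', w') ∈ ball (0:C2) ε2 := by
    intro z' w' h1 h2
    rw [mem_ball_zero_iff, Prod.norm_def]
    exact lt_of_lt_of_le (max_lt h1 h2) e3
  have n0 : ‖(0:ℂ)‖ < ε := by simpa using hε
  have A := hB2 _ (mem z w hz hw)
  have B := hB2 _ (mem z 0 hz n0)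
  have dst : ‖((z, w) : C2) - (z, 0)‖ = ‖w‖ := by simp [Prod.norm_def]
  have l1 := hK1.norm_sub_le A.1.1 B.1.1
  have l2 := hK2.norm_sub_le A.1.2 B.1.2
  rw [dst] at l1 l2
  have hkx : k (z, w) = 0 := hkx
  rw [hkx, zero_sub, norm_neg] at l1
  have hb := hkb z hz
  have q1 : m * ‖z‖ ^ n ≤ K1 * ‖w‖ := hb.1.trans l1
  have hlip : ‖a (z, 0) - a (0, 0)‖ ≤ 4 * m * ‖z‖ ^ n * ‖z - 0‖ := by
    refine Convex.norm_image_sub_le_of_norm_hasDerivWithin_le (f := fun ζ : ℂ => a (ζ, 0))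
      (f' := fun ζ => k (ζ, 0)) (s := closedBall 0 ‖z‖) ?_ ?_ (convex_closedBall _ _) ?_ ?_
    · intro ζ hζ
      have hζ' : ‖ζ‖ ≤ ‖z‖ := by simpa using hζ
      have h1 := (hB2 _ (mem ζ 0 (lt_of_le_of_lt hζ' hz) n0)).2.differentiableAt.hasFDerivAt
      have h2 : HasDerivAt (fun ζ : ℂ => ((ζ, 0) : C2)) (1, 0) ζ :=
        (hasDerivAt_id ζ).prodMk (hasDerivAt_const ζ 0)
      exact (HasFDerivAt.comp_hasDerivAt (f := fun ζ : ℂ => ((ζ, 0) : C2)) ζ h1 h2).hasDerivWithinAt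
    · intro ζ hζ
      have hζ' : ‖ζ‖ ≤ ‖z‖ := by simpa using hζ
      refine (hkb ζ (lt_of_le_of_lt hζ' hz)).2.trans ?_
      gcongr
    · simp
    · simp
  have ha00 : a (0, 0) = 0 := ha0
  rw [ha00, sub_zero, sub_zero] at hlip
  have hP := pow_nonneg (norm_nonneg z) n
  have q2 : ‖a (z, 0)‖ ≤ 4 * (m * ‖z‖ ^ n) := by
    have : 4 * m * ‖z‖ ^ n * ‖z‖ ≤ 4 * m * ‖z‖ ^ n * 1 := by
      gcongr; linarith
    linarith
  have q3 : ‖a (z, w)‖ ≤ (4 * K1 + K2) * ‖w‖ := by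
    have : ‖a (z, w)‖ ≤ ‖a (z, w) - a (z, 0)‖ + ‖a (z, 0)‖ := by
      simpa using norm_add_le (a (z, w) - a (z, 0)) (a (z, 0))
    linarith
  constructor
  · have : ‖z‖ ^ n ≤ K1 / m * ‖w‖ := by
      rw [div_mul_eq_mul_div, le_div_iff₀ hm0]; linarith
    refine this.trans (mul_le_mul_of_nonneg_right ?_ (norm_nonneg _))
    linarith [le_max_left ((K1:ℝ) / m) (4 * K1 + K2)]
  · refine q3.trans (mul_le_mul_of_nonneg_right ?_ (norm_nonneg _))
    linarith [le_max_right ((K1:ℝ) / m) (4 * K1 + K2)]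


lemma E0 {a : C2 → ℂ} {ρ : C2 → ℝ} {C0 : ℝ} (ha : AnalyticAt ℂ a 0) (ha0 : a 0 = 0)
    (hk0 : fderiv ℂ a 0 (1, 0) = 0) (hρ : ∀ᶠ x in 𝓝 (0 : C2), ContinuousAt ρ x) (hC0 : 0 ≤ C0)
    (hb : ∀ᶠ x in 𝓝 (0 : C2), |ρ x - x.2.re| ≤ C0 * (‖a x‖ + ‖x.2‖) ^ 2)
    (hE1 : ∀ᶠ x in 𝓝 (0 : C2), x ≠ 0 → fderiv ℂ a x (1, 0) = 0 → ρ x ≠ 0) : False := by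
  have hkan : ∀ {x : C2}, AnalyticAt ℂ a x → AnalyticAt ℂ (fun x => fderiv ℂ a x (1, 0)) x := by
    intro x hx
    exact ((ContinuousLinearMap.apply ℂ ℂ ((1, 0) : C2)).analyticAt _).comp hx.fderiv
  have hE2 : ¬∀ᶠ z in 𝓝 (0 : ℂ), fderiv ℂ a (z, 0) (1, 0) = 0 := by
    intro hz
    have hc : Tendsto (fun z : ℂ => ((z, 0) : C2)) (𝓝 0) (𝓝 0) := by
      have : Continuous (fun z : ℂ => ((z, 0) : C2)) := by fun_prop
      exact this.tendsto' _ _ rfl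
    obtain ⟨δ, hδ, hB⟩ := Metric.eventually_nhds_iff_ball.1
      (hz.and (hc.eventually (ha.eventually_analyticAt.and (hb.and hE1))))
    have hd : ∀ z ∈ ball (0 : ℂ) δ, HasDerivAt (fun z : ℂ => a (z, 0)) 0 z := by
      intro z hz
      have h1 := (hB z hz).2.1.differentiableAt.hasFDerivAt
      have h2 : HasDerivAt (fun z : ℂ => ((z, 0) : C2)) (1, 0) z :=
        (hasDerivAt_id z).prodMk (hasDerivAt_const z (0 : ℂ))
      have h3 := h1.comp_hasDerivAt z h2
      rw [(hB z hz).1] at h3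
      exact h3
    have hm : ((δ / 2 : ℝ) : ℂ) ∈ ball (0 : ℂ) δ := by
      rw [mem_ball_zero_iff, Complex.norm_real, Real.norm_eq_abs, abs_of_pos (by positivity)]
      linarith
    have hconst := isOpen_ball.is_const_of_deriv_eq_zero
      (convex_ball (0 : ℂ) δ).isPreconnected
      (fun z hz => (hd z hz).differentiableAt.differentiableWithinAt)
      (fun z hz => (hd z hz).deriv) hm (mem_ball_self hδ)
    have h0 : a (((δ / 2 : ℝ) : ℂ), 0) = 0 := by
      exact hconst.trans ha0
    have hx := (hB _ hm).2.2
    have h1 := hx.1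
    rw [h0] at h1
    simp only [Complex.zero_re, norm_zero, add_zero, sub_zero] at h1
    have h2 : ρ (((δ / 2 : ℝ) : ℂ), 0) = 0 := by
      rw [← abs_nonpos_iff]; linarith
    refine hx.2 ?_ (hB _ hm).1 h2
    intro h
    have := congrArg Prod.fst h
    simp at this
    linarith
  obtain ⟨C, n, hC, hEb⟩ := E_bound ha ha0 hE2
  obtain ⟨δ0, hδ0, hB⟩ := Metric.eventually_nhds_iff_ball.1
      ((hρ.and ha.eventually_analyticAt).and (hb.and (hE1.and hEb)))
  set δ := δ0 / 2 with hδdef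
  have hδ : 0 < δ := by positivity
  have hroot := root_persist (k := fun x : ℂ × ℂ => fderiv ℂ a x (1, 0)) (z0 := 0) (ξ0 := 0)
    (hkan ha) hk0 hE2 hδ
  have hpos : ∀ᶠ s in 𝓝[>] (0 : ℝ), 0 < s := self_mem_nhdsWithin
  have hof : Tendsto (fun s : ℝ => (s : ℂ)) (𝓝[>] 0) (𝓝 0) :=
    (Complex.continuous_ofReal.tendsto' 0 0 rfl).mono_left nhdsWithin_le_nhds
  have hlin : ∀ {A B : ℝ}, 0 < B → ∀ᶠ s in 𝓝[>] (0 : ℝ), A * s < B := by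
    intro A B hB
    have : Tendsto (fun s : ℝ => A * s) (𝓝[>] 0) (𝓝 0) :=
      ((continuous_const.mul continuous_id).tendsto' 0 0 (by simp)).mono_left nhdsWithin_le_nhds
    exact this.eventually_lt_const hB
  obtain ⟨s, hs, hsr, hs1, hs2, hs3⟩ := (hpos.and ((hof.eventually hroot).and
    ((hlin (A := C) (pow_pos hδ n)).and ((hlin (A := C0 * (C + 1) ^ 2) one_pos).and
      (hlin (A := 1) hδ0))))).exists
  rw [one_mul] at hs3
  set w : ℝ → ℂ := fun θ => s * Complex.exp (θ * I) with hw
  have hwc : Continuous w := by fun_prop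
  have hwn : ∀ θ, ‖w θ‖ = s := by
    intro θ
    simp [hw, Complex.norm_exp_ofReal_mul_I, abs_of_pos hs]
  have hin : ∀ θ z, ‖z‖ < δ0 → ((z, w θ) : C2) ∈ ball (0 : C2) δ0 := by
    intro θ z hz
    rw [mem_ball_zero_iff, Prod.norm_def]
    exact max_lt hz (by rw [hwn]; exact hs3)
  have hne : ∀ θ z, ((z, w θ) : C2) ≠ 0 := by
    intro θ z h
    have := congrArg (fun x : C2 => ‖x.2‖) h
    simp only [hwn, Prod.snd_zero, norm_zero] at this
    linarith
  have hb' : ∀ θ z, ‖z‖ < δ0 → fderiv ℂ a (z, w θ) (1, 0) = 0 →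
      |ρ (z, w θ) - (w θ).re| < s := by
    intro θ z hz hk
    have h1 := hB _ (hin θ z hz)
    have h2 := (h1.2.2.2 hk).2
    have h3 := h1.2.1
    simp only [hwn] at h2 h3
    have h4 : (‖a (z, w θ)‖ + s) ^ 2 ≤ (C * s + s) ^ 2 := by gcongr
    calc _ ≤ _ := h3
      _ ≤ C0 * (C * s + s) ^ 2 := by gcongr
      _ = (C0 * (C + 1) ^ 2 * s) * s := by ring
      _ < 1 * s := by gcongr
      _ = s := one_mul s
  set T : Set (ℝ × ℂ) := {x | x ∈ Icc 0 Real.pi ×ˢ closedBall (0 : ℂ) δ ∧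
    fderiv ℂ a (x.2, w x.1) (1, 0) = 0 ∧ 0 ≤ ρ (x.2, w x.1)} with hT
  have hmap : Continuous (fun x : ℝ × ℂ => ((x.2, w x.1) : C2)) := by fun_prop
  have hlt : ∀ x ∈ Icc 0 Real.pi ×ˢ closedBall (0 : ℂ) δ, ‖x.2‖ < δ0 := by
    intro x hx
    have := mem_closedBall_zero_iff.1 hx.2
    linarith
  have hTc : IsCompact T := by
    have hK : IsCompact (Icc 0 Real.pi ×ˢ closedBall (0 : ℂ) δ) :=
      isCompact_Icc.prod (isCompact_closedBall _ _)
    refine hK.of_isClosed_subset ?_ (fun x hx => hx.1)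
    have c1 : ContinuousOn (fun x : ℝ × ℂ => (fderiv ℂ a (x.2, w x.1) (1, 0), ρ (x.2, w x.1)))
        (Icc 0 Real.pi ×ˢ closedBall (0 : ℂ) δ) := by
      intro x hx
      have h1 := hB _ (hin x.1 x.2 (hlt x hx))
      have h2 : ContinuousAt (fun y : C2 => (fderiv ℂ a y (1, 0), ρ y)) (x.2, w x.1) :=
        (hkan h1.1.2).continuousAt.prodMk h1.1.1
      exact (ContinuousAt.comp (f := fun x : ℝ × ℂ => ((x.2, w x.1) : C2)) h2
        hmap.continuousAt).continuousWithinAt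
    have := c1.preimage_isClosed_of_isClosed hK.isClosed
      ((isClosed_singleton (x := (0 : ℂ))).prod (isClosed_Ici (a := (0 : ℝ))))
    convert this using 1
    ext x
    simp only [hT, mem_ofPred_eq, mem_inter_iff, mem_preimage, mem_prod, mem_singleton_iff, mem_Ici]
  have hS := hTc.image continuous_fst
  have hsub : Icc 0 Real.pi ⊆ Set.image Prod.fst T := by
    refine IsClosed.Icc_subset_of_forall_exists_gt (hS.isClosed.inter isClosed_Icc) ?_ ?_
    · obtain ⟨z, hz, hkz⟩ := hsr
      have hw0 : w 0 = s := by simp [hw]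
      rw [sub_zero] at hz
      refine ⟨(0, z), ⟨⟨⟨le_rfl, Real.pi_pos.le⟩, mem_closedBall_zero_iff.2 hz.le⟩, ?_, ?_⟩, rfl⟩
      · simp only [hw0]; exact hkz
      · have := hb' 0 z (by linarith) (by rw [hw0]; exact hkz)
        rw [abs_lt] at this
        have h2 : (w 0).re = s := by rw [hw0]; simp
        simp only
        linarith [this.1]
    · rintro θ ⟨⟨⟨θ', z0⟩, ⟨hx1, hx2, hx3⟩, rfl⟩, hθ⟩ y hy
      simp only at hx2 hx3 hθ hy ⊢
      have hzlt := hlt _ hx1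
      simp only at hzlt
      have hx := hB _ (hin θ' z0 hzlt)
      have hz0 : ‖z0‖ < δ := by
        have := (hx.2.2.2 hx2).1
        simp only [hwn] at this
        exact lt_of_pow_lt_pow_left₀ n hδ.le (by linarith)
      have hρpos : 0 < ρ (z0, w θ') :=
        lt_of_le_of_ne hx3 (Ne.symm (hx.2.2.1 (hne _ _) hx2))
      have hnv : ¬∀ᶠ z in 𝓝 z0, fderiv ℂ a (z, w θ') (1, 0) = 0 := by
        intro hev
        have hg : AnalyticOnNhd ℂ (fun z : ℂ => fderiv ℂ a (z, w θ') (1, 0)) (ball 0 δ0) := by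
          intro z hz
          have h1 := hkan (hB _ (hin θ' z (mem_ball_zero_iff.1 hz))).1.2
          have h2 : AnalyticAt ℂ (fun z : ℂ => ((z, w θ') : C2)) z :=
            analyticAt_id.prod analyticAt_const
          exact AnalyticAt.fun_comp (g := fun x : C2 => fderiv ℂ a x (1, 0)) h1 h2
        have hδn : ‖(δ : ℂ)‖ = δ := by
          rw [Complex.norm_real, Real.norm_eq_abs, abs_of_pos hδ]
        have hδm : (δ : ℂ) ∈ ball (0 : ℂ) δ0 := by
          rw [mem_ball_zero_iff, hδn]; linarith
        have h3 := hg.eqOn_zero_of_preconnected_of_eventuallyEq_zero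
          (convex_ball (0 : ℂ) δ0).isPreconnected (mem_ball_zero_iff.2 hzlt) hev hδm
        have h4 := ((hB _ (hin θ' _ (mem_ball_zero_iff.1 hδm))).2.2.2 h3).1
        simp only [hwn, hδn] at h4
        linarith
      obtain ⟨η, hη, hηB⟩ := Metric.eventually_nhds_iff_ball.1
        (hx.1.1.eventually_const_lt hρpos)
      have hrp := root_persist (k := fun x : ℂ × ℂ => fderiv ℂ a x (1, 0)) (z0 := z0)
        (ξ0 := w θ') (hkan hx.1.2) hx2 hnv (lt_min hη (sub_pos.2 hz0))
      have h1 : ∀ᶠ θ in 𝓝[>] θ', (∃ z, ‖z - z0‖ < min η (δ - ‖z0‖) ∧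
          fderiv ℂ a (z, w θ) (1, 0) = 0) ∧ w θ ∈ ball (w θ') η :=
        (hwc.continuousAt.eventually (hrp.and (ball_mem_nhds _ hη))).filter_mono
          nhdsWithin_le_nhds
      have h2 : ∀ᶠ θ in 𝓝[>] θ', θ ∈ Ioo θ' (min y Real.pi) :=
        Ioo_mem_nhdsGT (lt_min hy hθ.2)
      obtain ⟨θ, ⟨⟨z, hz, hkz⟩, hwb⟩, hθi⟩ := (h1.and h2).exists
      refine ⟨θ, ⟨(θ, z), ⟨⟨⟨?_, ?_⟩, ?_⟩, hkz, ?_⟩, rfl⟩, hθi.1, ?_⟩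
      · exact hθ.1.trans hθi.1.le
      · exact (hθi.2.trans_le (min_le_right _ _)).le
      · rw [mem_closedBall_zero_iff]
        have e1 : z = (z - z0) + z0 := by abel
        have e2 := norm_add_le (z - z0) z0
        rw [← e1] at e2
        have e3 := hz.trans_le (min_le_right _ _)
        linarith
      · refine (hηB (z, w θ) ?_).le
        rw [mem_ball, Prod.dist_eq]
        refine max_lt ?_ hwb
        rw [dist_eq_norm]
        exact hz.trans_le (min_le_left _ _)
      · exact (hθi.2.trans_le (min_le_left _ _)).le
  obtain ⟨⟨θ, z⟩, ⟨h1, h2, h3⟩, h4⟩ := hsub ⟨Real.pi_pos.le, le_rfl⟩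
  simp only at h4
  subst h4
  have h5 := hb' _ z (hlt _ h1) h2
  have h6 : (w Real.pi).re = -s := by simp [hw, Complex.exp_pi_mul_I]
  simp only at h3
  rw [abs_lt, h6] at h5
  linarith [h5.2]


lemma taylor2 {r' : C2 → ℝ} {q : C2} (hr' : AnalyticAt ℝ r' q) :
    ∃ C : ℝ, 0 ≤ C ∧ ∀ᶠ y in 𝓝 q, |r' y - r' q - fderiv ℝ r' q (y - q)| ≤ C * ‖y - q‖ ^ 2 := by
  obtain ⟨P, hP⟩ := hr'
  have h1 := hP.isBigO_sub_partialSum_pow 2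
  obtain ⟨C, hC, h2⟩ := h1.exists_nonneg
  refine ⟨C, hC, ?_⟩
  have h3 : Tendsto (fun y : C2 => y - q) (𝓝 q) (𝓝 0) :=
    (continuous_id.sub continuous_const).tendsto' _ _ (by simp)
  filter_upwards [h3.eventually h2.bound] with y hy
  have e1 : P.partialSum 2 (y - q) = r' q + fderiv ℝ r' q (y - q) := by
    rw [hP.fderiv_eq, ← hP.coeff_zero (fun _ => 0)]
    simp only [FormalMultilinearSeries.partialSum, Finset.sum_range_succ, Finset.sum_range_zero,
      zero_add, continuousMultilinearCurryFin1_apply]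
    congr 1
    exact congrArg (P 0) (funext fun i => i.elim0)
  simp only [e1, Real.norm_eq_abs, add_sub_cancel, abs_pow, abs_norm] at hy
  rw [sub_sub]
  exact hy

lemma lemE {F : C2 → C2} {r' : C2 → ℝ} {p : C2} (hF : AnalyticAt ℂ F p)
    (hr' : AnalyticAt ℝ r' (F p)) (h0 : r' (F p) = 0)
    (hd : fderiv ℝ (fun x => r' (F x)) p ≠ 0)
    (hsing : ∀ᶠ x in 𝓝 p, x ≠ p → (∃ v, v ≠ 0 ∧ fderiv ℂ F x v = 0) → r' (F x) ≠ 0) :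
    ∀ v, fderiv ℂ F p v = 0 → v = 0 := by
  obtain ⟨CT, hCT0, hCT⟩ := taylor2 hr'
  intro k0 hk0
  by_contra hk0n
  set A := fderiv ℂ F p with hA
  set ℓ := fderiv ℝ r' (F p) with hℓ
  set b1 : ℂ := ℓ (1, 0) - I * ℓ (I, 0) with hb1
  set b2 : ℂ := ℓ (0, 1) - I * ℓ (0, I) with hb2
  set β : C2 →L[ℂ] ℂ :=
    b1 • ContinuousLinearMap.fst ℂ ℂ ℂ + b2 • ContinuousLinearMap.snd ℂ ℂ ℂ with hβ
  have hβa : ∀ y, β y = b1 * y.1 + b2 * y.2 := fun y => by simp [hβ]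
  have hβre : ∀ y, (β y).re = ℓ y := by
    intro y
    have e : y = y.1.re • ((1, 0) : C2) + y.1.im • ((I, 0) : C2) + y.2.re • ((0, 1) : C2) +
        y.2.im • ((0, I) : C2) := by
      ext <;> simp
    conv_rhs => rw [e]
    rw [hβa]
    simp only [map_add, map_smul, smul_eq_mul, hb1, hb2]
    simp
    ring
  have hdF : fderiv ℝ (fun x => r' (F x)) p = ℓ.comp (A.restrictScalars ℝ) :=
    (hr'.differentiableAt.hasFDerivAt.comp p
      (hF.differentiableAt.hasFDerivAt.restrictScalars ℝ)).fderiv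
  obtain ⟨v0, hv0⟩ : ∃ v0, ℓ (A v0) ≠ 0 := by
    by_contra! h
    apply hd
    rw [hdF]
    exact ContinuousLinearMap.ext fun v => h v
  have hbv0 : β (A v0) ≠ 0 := by
    intro h
    apply hv0
    rw [← hβre, h, Complex.zero_re]
  set v : C2 := (β (A v0))⁻¹ • v0 with hv
  set e : C2 := A v with he
  have hβe : β e = 1 := by
    rw [he, hv, map_smul, map_smul, smul_eq_mul, inv_mul_cancel₀ hbv0]
  set g : C2 := (-b2, b1) with hg
  set α : C2 →L[ℂ] ℂ :=
    e.1 • ContinuousLinearMap.snd ℂ ℂ ℂ - e.2 • ContinuousLinearMap.fst ℂ ℂ ℂ with hα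
  have hαa : ∀ y, α y = e.1 * y.2 - e.2 * y.1 := fun y => by simp [hα]
  have hdec : ∀ y, y = β y • e + α y • g := by
    intro y
    have h1 := hβe
    rw [hβa] at h1
    rw [hβa, hαa]
    ext
    · simp only [hg, Prod.fst_add, Prod.smul_fst, smul_eq_mul]
      linear_combination (-y.1) * h1
    · simp only [hg, Prod.snd_add, Prod.smul_snd, smul_eq_mul]
      linear_combination (-y.2) * h1
  set Δ : ℂ := k0.1 * v.2 - k0.2 * v.1 with hΔ
  have hΔ0 : Δ ≠ 0 := by
    intro h
    rw [hΔ] at h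
    have e1 : v.2 • k0 - k0.2 • v = 0 := by
      ext
      · simp; linear_combination h
      · simp; ring
    have e2 : k0.1 • v - v.1 • k0 = 0 := by
      ext
      · simp; ring
      · simp; linear_combination h
    have e3 := congrArg (fun x => β (A x)) e1
    have e4 := congrArg (fun x => β (A x)) e2
    simp only [map_sub, map_smul, hk0, ← he, hβe, map_zero, smul_eq_mul, mul_one, mul_zero,
      zero_sub, sub_zero, neg_eq_zero] at e3 e4
    exact hk0n (Prod.ext e4 e3)
  set lam : C2 →L[ℂ] ℂ := (v.2 / Δ) • ContinuousLinearMap.fst ℂ ℂ ℂ -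
    (v.1 / Δ) • ContinuousLinearMap.snd ℂ ℂ ℂ with hlam
  have hlama : ∀ y, lam y * Δ = v.2 * y.1 - v.1 * y.2 := by
    intro y
    have : lam y = v.2 / Δ * y.1 - v.1 / Δ * y.2 := by simp [hlam]
    rw [this]
    field_simp
  set Φ : C2 → C2 := fun x => (lam (x - p), β (F x - F p)) with hΦ
  have hΦa : AnalyticAt ℂ Φ p := by
    have h1 : AnalyticAt ℂ (fun x => lam (x - p)) p :=
      (lam.analyticAt _).comp (analyticAt_id.sub analyticAt_const)
    have h2 : AnalyticAt ℂ (fun x => β (F x - F p)) p :=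
      AnalyticAt.fun_comp (g := β) (β.analyticAt _) (hF.sub analyticAt_const)
    exact h1.prod h2
  have hΦd : ∀ u, fderiv ℂ Φ p u = (lam u, β (A u)) := by
    intro u
    have h1 : HasFDerivAt (fun x => lam (x - p)) lam p := by
      exact lam.hasFDerivAt.comp p ((hasFDerivAt_id p).sub_const p)
    have h2 : HasFDerivAt (fun x => β (F x - F p)) (β.comp A) p :=
      β.hasFDerivAt.comp p (hF.differentiableAt.hasFDerivAt.sub_const (F p))
    rw [(h1.prodMk h2).fderiv]
    rfl
  have hΦp : Φ p = 0 := by simp [hΦ]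
  obtain ⟨Θ, hΘa, hΘp, hΘΦ, hΦΘ⟩ := inv_fn hΦa (by
    intro u hu
    rw [hΦd] at hu
    have h1 := congrArg Prod.fst hu
    have h2 := congrArg Prod.snd hu
    simp only [Prod.fst_zero, Prod.snd_zero] at h1 h2
    have h3 := hlama u
    rw [h1, zero_mul] at h3
    have h4 : Δ • u = (k0.1 * u.2 - k0.2 * u.1) • v := by
      ext
      · simp only [Prod.smul_fst, smul_eq_mul, hΔ]; linear_combination (-k0.1) * h3
      · simp only [Prod.smul_snd, smul_eq_mul, hΔ]; linear_combination (-k0.2) * h3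
    have h5 := congrArg (fun x => β (A x)) h4
    simp only [map_smul, h2, ← he, hβe, smul_eq_mul, mul_zero, mul_one] at h5
    rw [← h5, zero_smul] at h4
    exact (smul_eq_zero.1 h4).resolve_left hΔ0)
  rw [hΦp] at hΘa hΘp hΦΘ
  have hΘc : Tendsto Θ (𝓝 0) (𝓝 p) := by
    have := hΘa.continuousAt.tendsto
    rwa [hΘp] at this
  set G : C2 → C2 := fun y => F (Θ y) with hG
  have hGa : AnalyticAt ℂ G 0 := AnalyticAt.fun_comp (by rw [hΘp]; exact hF) hΘa
  have hG0 : G 0 = F p := by simp only [hG, hΘp]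
  set a : C2 → ℂ := fun y => α (G y - F p) with ha
  have haa : AnalyticAt ℂ a 0 :=
    AnalyticAt.fun_comp (g := α) (α.analyticAt _) (hGa.sub analyticAt_const)
  have ha0 : a 0 = 0 := by simp [ha, hG0]
  have hβG : ∀ᶠ y in 𝓝 (0 : C2), β (G y - F p) = y.2 := by
    filter_upwards [hΦΘ] with y hy
    exact congrArg Prod.snd hy
  have hdera : ∀ {y}, AnalyticAt ℂ G y → fderiv ℂ a y (1, 0) = α (fderiv ℂ G y (1, 0)) := by
    intro y hy
    have : HasFDerivAt a (α.comp (fderiv ℂ G y)) y :=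
      α.hasFDerivAt.comp y (hy.differentiableAt.hasFDerivAt.sub_const (F p))
    rw [this.fderiv]
    rfl
  have hFΘ : ∀ᶠ y in 𝓝 (0 : C2), AnalyticAt ℂ F (Θ y) := hΘc.eventually hF.eventually_analyticAt
  refine E0 (a := a) (ρ := fun y => r' (G y)) haa ha0 ?_ ?_ (C0 := ?C0) ?_ ?_ ?_
  case C0 => exact CT * (‖e‖ + ‖g‖) ^ 2
  · rw [hdera hGa]
    have h1 : fderiv ℂ Θ 0 (1, 0) = k0 := by
      have h2 : HasFDerivAt (fun x => Θ (Φ x)) ((fderiv ℂ Θ 0).comp (fderiv ℂ Φ p)) p := by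
        have h3 : HasFDerivAt Θ (fderiv ℂ Θ 0) (Φ p) := by
          rw [hΦp]; exact hΘa.differentiableAt.hasFDerivAt
        exact h3.comp p hΦa.differentiableAt.hasFDerivAt
      have h4 := h2.unique ((hasFDerivAt_id p).congr_of_eventuallyEq hΘΦ)
      have h5 := congrArg (fun L : C2 →L[ℂ] C2 => L k0) h4
      simp only [ContinuousLinearMap.comp_apply, hΦd, hk0, map_zero] at h5
      have h6 : lam k0 = 1 := by
        have := hlama k0
        apply mul_right_cancel₀ hΔ0
        rw [this, hΔ]; ring
      rw [h6] at h5
      exact h5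
    have h2 : HasFDerivAt G (A.comp (fderiv ℂ Θ 0)) 0 := by
      have h3 : HasFDerivAt F A (Θ 0) := by
        rw [hΘp]; exact hF.differentiableAt.hasFDerivAt
      exact h3.comp 0 hΘa.differentiableAt.hasFDerivAt
    rw [h2.fderiv, ContinuousLinearMap.comp_apply, h1, hk0, map_zero]
  · have : Tendsto G (𝓝 0) (𝓝 (F p)) := by
      have := hGa.continuousAt.tendsto
      rwa [hG0] at this
    filter_upwards [this.eventually hr'.eventually_analyticAt, hGa.eventually_analyticAt]
      with y h1 h2
    exact ContinuousAt.comp (g := r') h1.continuousAt h2.continuousAt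
  · have := hCT0
    positivity
  · have hT := hCT
    have hC := hCT0
    have : Tendsto G (𝓝 0) (𝓝 (F p)) := by
      have := hGa.continuousAt.tendsto
      rwa [hG0] at this
    filter_upwards [this.eventually hT, hβG] with y h1 h2
    rw [← hβre, h2, h0, sub_zero] at h1
    have h3 : ‖G y - F p‖ ≤ (‖e‖ + ‖g‖) * (‖a y‖ + ‖y.2‖) := by
      have h4 := hdec (G y - F p)
      rw [h2] at h4
      have h5 := norm_add_le (y.2 • e) (a y • g)
      rw [h4]
      refine h5.trans ?_
      rw [norm_smul, norm_smul]
      nlinarith [norm_nonneg e, norm_nonneg g, norm_nonneg (a y), norm_nonneg y.2,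
        mul_nonneg (norm_nonneg e) (norm_nonneg (a y)), mul_nonneg (norm_nonneg g) (norm_nonneg y.2)]
    calc _ ≤ _ := h1
      _ ≤ CT * ((‖e‖ + ‖g‖) * (‖a y‖ + ‖y.2‖)) ^ 2 := by gcongr
      _ = _ := by ring
  · filter_upwards [hΘc.eventually hsing, hΦΘ.eventually_nhds, hβG.eventually_nhds,
      hGa.eventually_analyticAt, hFΘ, hΘa.eventually_analyticAt,
      hΘc.eventually hΦa.eventually_analyticAt] with y h1 h2 h3 h4 h5 h6 h7 hy0 hk
    rw [hdera h4] at hk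
    have h8 : β (fderiv ℂ G y (1, 0)) = 0 := by
      have e1 : HasFDerivAt (fun y => β (G y - F p)) (β.comp (fderiv ℂ G y)) y :=
        β.hasFDerivAt.comp y (h4.differentiableAt.hasFDerivAt.sub_const (F p))
      have e2 := e1.unique ((hasFDerivAt_snd (𝕜 := ℂ) (p := y)).congr_of_eventuallyEq h3)
      have e3 := congrArg (fun L : C2 →L[ℂ] ℂ => L (1, 0)) e2
      exact e3
    have h9 : fderiv ℂ G y (1, 0) = 0 := by
      rw [hdec (fderiv ℂ G y (1, 0)), h8, hk, zero_smul, zero_smul, add_zero]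
    have h10 : HasFDerivAt G ((fderiv ℂ F (Θ y)).comp (fderiv ℂ Θ y)) y :=
      h5.differentiableAt.hasFDerivAt.comp y h6.differentiableAt.hasFDerivAt
    rw [h10.fderiv] at h9
    refine h1 ?_ ⟨fderiv ℂ Θ y (1, 0), ?_, h9⟩
    · intro h
      apply hy0
      rw [← h2.self_of_nhds, h, hΦp]
    · intro h
      have e1 : HasFDerivAt (fun y => Φ (Θ y)) ((fderiv ℂ Φ (Θ y)).comp (fderiv ℂ Θ y)) y :=
        h7.differentiableAt.hasFDerivAt.comp y h6.differentiableAt.hasFDerivAt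
      have e2 := e1.unique ((hasFDerivAt_id y).congr_of_eventuallyEq h2)
      have e3 := congrArg (fun L : C2 →L[ℂ] C2 => (L (1, 0)).1) e2
      simp [h] at e3


lemma levi_smul (ρ : C2 → ℝ) (p t : C2) (c : ℂ) :
    levi ρ p (c • t) = c * (starRingEnd ℂ) c * levi ρ p t := by
  simp only [levi, Prod.smul_fst, Prod.smul_snd, smul_eq_mul, map_mul]
  ring

lemma tangent_line {r : C2 → ℝ} {q v t : C2} (hr : DifferentiableAt ℝ r q)
    (hd : fderiv ℝ r q ≠ 0) (hv : tangentVec r q v) (hv0 : v ≠ 0) (ht : tangentVec r q t) :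
    ∃ c : ℂ, t = c • v := by
  have hne : ¬ (wd1 (oc r) q = 0 ∧ wd2 (oc r) q = 0) := by
    rintro ⟨h1, h2⟩
    apply hd
    refine ContinuousLinearMap.ext fun u => ?_
    exact ((tangent_iff hr u).1 (by simp [tangentVec, h1, h2])).1
  unfold tangentVec at hv ht
  have hdet : v.1 * t.2 = v.2 * t.1 := by
    by_contra hc
    apply hne
    have hc' : v.1 * t.2 - v.2 * t.1 ≠ 0 := sub_ne_zero.2 hc
    constructor
    · apply (mul_eq_zero.1 (_ : wd1 (oc r) q * (v.1 * t.2 - v.2 * t.1) = 0)).resolve_right hc'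
      linear_combination t.2 * hv - v.2 * ht
    · apply (mul_eq_zero.1 (_ : wd2 (oc r) q * (v.1 * t.2 - v.2 * t.1) = 0)).resolve_right hc'
      linear_combination v.1 * ht - t.1 * hv
  by_cases h1 : v.1 = 0
  · have h2 : v.2 ≠ 0 := fun h2 => hv0 (Prod.ext h1 h2)
    refine ⟨t.2 / v.2, ?_⟩
    rw [h1, zero_mul] at hdet
    ext
    · simp only [Prod.smul_fst, smul_eq_mul, h1, mul_zero]
      exact (mul_eq_zero.1 hdet.symm).resolve_left h2
    · simp only [Prod.smul_snd, smul_eq_mul]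
      field_simp
  · refine ⟨t.1 / v.1, ?_⟩
    ext
    · simp only [Prod.smul_fst, smul_eq_mul]
      field_simp
    · simp only [Prod.smul_snd, smul_eq_mul]
      field_simp
      linear_combination hdet

/-- Pointwise transfer of the Levi form. -/
lemma transfer {r r' : C2 → ℝ} {F : C2 → C2} {q : C2} {h : ℝ} (hr : AnalyticAt ℝ r q)
    (hF : AnalyticAt ℂ F q) (hr' : AnalyticAt ℝ r' (F q)) (hh : 0 < h)
    (hfd : fderiv ℝ (fun x => r' (F x)) q = h • fderiv ℝ r q)
    (hl : ∀ t, tangentVec r q t → levi (fun x => r' (F x)) q t = h * levi r q t)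
    (hinj : ∀ v, fderiv ℂ F q v = 0 → v = 0) :
    (PseudoconvexAt r q → PseudoconvexAt r' (F q)) ∧
    (LeviDegenerateAt r q ↔ LeviDegenerateAt r' (F q)) := by
  have hdF : ∀ t, fderiv ℝ r' (F q) (fderiv ℂ F q t) = h * fderiv ℝ r q t := by
    intro t
    have h1 : fderiv ℝ (fun x => r' (F x)) q =
        (fderiv ℝ r' (F q)).comp ((fderiv ℂ F q).restrictScalars ℝ) :=
      (hr'.differentiableAt.hasFDerivAt.comp q
        (hF.differentiableAt.hasFDerivAt.restrictScalars ℝ)).fderiv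
    have h2 := congrArg (fun L : C2 →L[ℝ] ℝ => L t) (h1.symm.trans hfd)
    exact h2
  have htan : ∀ t, tangentVec r' (F q) (fderiv ℂ F q t) ↔ tangentVec r q t := by
    intro t
    rw [tangent_iff hr'.differentiableAt, tangent_iff hr.differentiableAt, ← map_smul, hdF, hdF]
    simp [hh.ne']
  have hlev : ∀ t, tangentVec r q t → levi r' (F q) (fderiv ℂ F q t) = h * levi r q t := by
    intro t ht
    rw [← levi_comp hF hr', hl t ht]
  have hsurj : Function.Surjective (fderiv ℂ F q) := by
    have h1 : Function.Injective (fderiv ℂ F q : C2 →ₗ[ℂ] C2) := by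
      rw [← LinearMap.ker_eq_bot, LinearMap.ker_eq_bot']
      exact hinj
    exact LinearMap.injective_iff_surjective.1 h1
  refine ⟨?_, ?_, ?_⟩
  · intro hp t' ht'
    obtain ⟨t, rfl⟩ := hsurj t'
    have ht := (htan t).1 ht'
    rw [hlev t ht, Complex.re_ofReal_mul]
    exact mul_nonneg hh.le (hp t ht)
  · intro hp t' ht'
    obtain ⟨t, rfl⟩ := hsurj t'
    have ht := (htan t).1 ht'
    rw [hlev t ht, hp t ht, mul_zero]
  · intro hp t ht
    have h1 := hp _ ((htan t).2 ht)
    rw [hlev t ht] at h1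
    exact (mul_eq_zero.1 h1).resolve_left (by exact_mod_cast hh.ne')

lemma local_main {r r' : C2 → ℝ} {F : C2 → C2} {p : C2} (hr : AnalyticAt ℝ r p) (hr0 : r p = 0)
    (hd : fderiv ℝ r p ≠ 0) (hF : AnalyticAt ℂ F p) (hr' : AnalyticAt ℝ r' (F p))
    (hd' : fderiv ℝ r' (F p) ≠ 0) (hz : ∀ᶠ x in 𝓝 p, r x = 0 → r' (F x) = 0)
    (hneg : ∀ᶠ x in 𝓝 p, r x < 0 → r' (F x) < 0)
    (hn : ¬∀ᶠ x in 𝓝 p, r' (F x) = 0)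
    (hft : ∀ φ : ℂ → C2, AnalyticAt ℂ φ 0 → φ 0 = p → (∀ᶠ z in 𝓝 0, r (φ z) = 0) →
      ∀ᶠ z in 𝓝 0, φ z = p)
    (hps : ∀ᶠ x in 𝓝 p, r x = 0 → PseudoconvexAt r x) (hdeg : LeviDegenerateAt r p)
    (hnd : ∀ᶠ x in 𝓝 p, r x = 0 → x ≠ p → ¬ LeviDegenerateAt r x) :
    LeviDegenerateAt r' (F p) ∧ ∀ᶠ y in 𝓝 (F p), r' y = 0 →
      PseudoconvexAt r' y ∧ (y ≠ F p → ¬ LeviDegenerateAt r' y) := by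
  have hρd := propC hr hr0 hd hF hr' hd' hz hn hft
  have hρ : AnalyticAt ℝ (fun x => r' (F x)) p :=
    AnalyticAt.fun_comp hr' (hF.restrictScalars)
  have hmul : ∀ᶠ q in 𝓝 p, r q = 0 → ∃ h : ℝ, 0 < h ∧
      fderiv ℝ (fun x => r' (F x)) q = h • fderiv ℝ r q ∧
      ∀ t, tangentVec r q t → levi (fun x => r' (F x)) q t = h * levi r q t := by
    filter_upwards [hr.eventually_analyticAt, hρ.eventually_analyticAt, hz.eventually_nhds,
      hneg.eventually_nhds, hr.fderiv.continuousAt.eventually_ne hd,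
      hρ.fderiv.continuousAt.eventually_ne hρd] with q h1 h2 h3 h4 h5 h6 h7
    obtain ⟨h, hh, e1, e2⟩ := multiplier h1 h7 h5 h2 h3 h4
    refine ⟨h, lt_of_le_of_ne hh ?_, e1, e2⟩
    rintro rfl
    exact h6 (by rw [e1, zero_smul])
  have hzi : ∀ᶠ x in 𝓝 p, r' (F x) = 0 → r x = 0 := by
    obtain ⟨h, hh, e1, -⟩ := hmul.self_of_nhds hr0
    obtain ⟨v0, hv0⟩ : ∃ v0, fderiv ℝ r p v0 ≠ 0 := by
      by_contra! hc
      exact hd (ContinuousLinearMap.ext hc)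
    have hv : fderiv ℝ r p ((fderiv ℝ r p v0)⁻¹ • v0) = 1 := by
      rw [map_smul, smul_eq_mul, inv_mul_cancel₀ hv0]
    refine zero_imp hr hρ hr0 hv ?_ hz hneg
    rw [e1]
    change 0 < h * fderiv ℝ r p ((fderiv ℝ r p v0)⁻¹ • v0)
    rw [hv, mul_one]
    exact hh
  have hFr' : ∀ᶠ q in 𝓝 p, AnalyticAt ℝ r' (F q) :=
    hF.continuousAt.eventually hr'.eventually_analyticAt
  have hinj : ∀ᶠ q in 𝓝 p, r q = 0 → q ≠ p → ∀ v, fderiv ℂ F q v = 0 → v = 0 := by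
    filter_upwards [hmul, hnd, hr.eventually_analyticAt, hF.eventually_analyticAt, hFr',
      hr.fderiv.continuousAt.eventually_ne hd] with q h1 h2 h3 h4 h5 h6 hq0 hqp v hv
    by_contra hv0
    obtain ⟨h, hh, e1, e2⟩ := h1 hq0
    have hdF : fderiv ℝ (fun x => r' (F x)) q =
        (fderiv ℝ r' (F q)).comp ((fderiv ℂ F q).restrictScalars ℝ) :=
      (h5.differentiableAt.hasFDerivAt.comp q
        (h4.differentiableAt.hasFDerivAt.restrictScalars ℝ)).fderiv
    have e3 : ∀ u, fderiv ℂ F q u = 0 → fderiv ℝ r q u = 0 := by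
      intro u hu
      have e4 : fderiv ℝ r' (F q) (fderiv ℂ F q u) = h * fderiv ℝ r q u :=
        congrArg (fun L : C2 →L[ℝ] ℝ => L u) (hdF.symm.trans e1)
      rw [hu, map_zero] at e4
      exact (mul_eq_zero.1 e4.symm).resolve_left hh.ne'
    have htv : tangentVec r q v := by
      rw [tangent_iff h3.differentiableAt]
      exact ⟨e3 v hv, e3 _ (by rw [map_smul, hv, smul_zero])⟩
    have hlv : levi r q v = 0 := by
      have e5 := e2 v htv
      rw [levi_comp h4 h5, hv] at e5
      have e6 : levi r' (F q) 0 = 0 := by simp [levi]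
      rw [e6] at e5
      exact (mul_eq_zero.1 e5.symm).resolve_left (by exact_mod_cast hh.ne')
    apply h2 hq0 hqp
    intro t ht
    obtain ⟨c, rfl⟩ := tangent_line h3.differentiableAt h6 htv hv0 ht
    rw [levi_smul, hlv, mul_zero]
  have hinjp : ∀ v, fderiv ℂ F p v = 0 → v = 0 := by
    refine lemE hF hr' (hz.self_of_nhds hr0) hρd ?_
    filter_upwards [hinj, hzi] with x h1 h2 hxp hx hx0
    obtain ⟨v, hv0, hv⟩ := hx
    exact hv0 (h1 (h2 hx0) hxp v hv)
  obtain ⟨Θ, hΘa, hΘp, -, hFΘ⟩ := inv_fn hF hinjp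
  have hΘc : Tendsto Θ (𝓝 (F p)) (𝓝 p) := by
    have := hΘa.continuousAt.tendsto
    rwa [hΘp] at this
  constructor
  · obtain ⟨h, hh, e1, e2⟩ := hmul.self_of_nhds hr0
    exact (transfer hr hF hr' hh e1 e2 hinjp).2.1 hdeg
  · filter_upwards [hFΘ, hΘc.eventually (hmul.and (hzi.and (hinj.and (hps.and (hnd.and
      (hr.eventually_analyticAt.and (hF.eventually_analyticAt.and hFr')))))))] with y hy hq hy0
    obtain ⟨h1, h2, h3, h4, h5, h6, h7, h8⟩ := hq
    have hq0 : r (Θ y) = 0 := h2 (by rw [hy]; exact hy0)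
    obtain ⟨h, hh, e1, e2⟩ := h1 hq0
    have hi : ∀ v, fderiv ℂ F (Θ y) v = 0 → v = 0 := by
      by_cases hqp : Θ y = p
      · rw [hqp]; exact hinjp
      · exact h3 hq0 hqp
    have ht := transfer h6 h7 h8 hh e1 e2 hi
    rw [hy] at ht
    refine ⟨ht.1 (h4 hq0), fun hyp hdg => ?_⟩
    refine h5 hq0 ?_ (ht.2.2 hdg)
    intro hqp
    apply hyp
    rw [← hy, hqp]


/-- Part of Theorem 1.2: isolated Levi-degenerate points are preserved. -/
theorem stmt4
    (D D' M M' : Set C2) (f : C2 → C2)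
    (Ω : Set C2) (r : C2 → ℝ) (Ω' : Set C2) (r' : C2 → ℝ)
    -- `D`, `D'` are bounded domains in `ℂ²`
    (hD : IsOpen D) (hDconn : IsConnected D) (hDbd : Bornology.IsBounded D)
    (hD' : IsOpen D') (hD'conn : IsConnected D') (hD'bd : Bornology.IsBounded D')
    -- `f : D → D'` is proper holomorphic
    (hf : DifferentiableOn ℂ f D) (hfm : Set.MapsTo f D D')
    (hfp : ∀ K : Set C2, K ⊆ D' → IsCompact K → IsCompact (D ∩ f ⁻¹' K))
    -- `M` is a nonempty relatively open piece of `∂D`, `M'` a relatively open piece of `∂D'`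
    (hMne : M.Nonempty) (hMsub : M ⊆ frontier D)
    (hMopen : ∃ O : Set C2, IsOpen O ∧ M = frontier D ∩ O)
    (hM'sub : M' ⊆ frontier D')
    (hM'open : ∃ O : Set C2, IsOpen O ∧ M' = frontier D' ∩ O)
    -- hypothesis (i): `∂D` is smooth real-analytic of finite type near `closure M`
    (hΩ : IsOpen Ω) (hMΩ : closure M ⊆ Ω)
    (hr : AnalyticOnNhd ℝ r Ω) (hrgrad : ∀ p ∈ Ω, fderiv ℝ r p ≠ 0)
    (hrbd : frontier D ∩ Ω = {p : C2 | p ∈ Ω ∧ r p = 0})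
    (hrD : D ∩ Ω = {p : C2 | p ∈ Ω ∧ r p < 0})
    (hft : ∀ φ : ℂ → C2, DifferentiableOn ℂ φ (Metric.ball (0 : ℂ) 1) →
      (∀ ζ ∈ Metric.ball (0 : ℂ) 1, φ ζ ∈ frontier D ∩ Ω) →
      ∀ a ∈ Metric.ball (0 : ℂ) 1, ∀ b ∈ Metric.ball (0 : ℂ) 1, φ a = φ b)
    -- hypothesis (ii): `∂D'` is smooth real-analytic of finite type near `closure M'`
    (hΩ' : IsOpen Ω') (hM'Ω' : closure M' ⊆ Ω')
    (hr' : AnalyticOnNhd ℝ r' Ω') (hr'grad : ∀ p ∈ Ω', fderiv ℝ r' p ≠ 0)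
    (hr'bd : frontier D' ∩ Ω' = {p : C2 | p ∈ Ω' ∧ r' p = 0})
    (hr'D : D' ∩ Ω' = {p : C2 | p ∈ Ω' ∧ r' p < 0})
    (hft' : ∀ φ : ℂ → C2, DifferentiableOn ℂ φ (Metric.ball (0 : ℂ) 1) →
      (∀ ζ ∈ Metric.ball (0 : ℂ) 1, φ ζ ∈ frontier D' ∩ Ω') →
      ∀ a ∈ Metric.ball (0 : ℂ) 1, ∀ b ∈ Metric.ball (0 : ℂ) 1, φ a = φ b)
    -- hypothesis (iii): the cluster set of `M` under `f` is contained in `M'`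
    (hcl : ∀ p ∈ M, ∀ z : ℕ → C2, (∀ j, z j ∈ D) → Filter.Tendsto z Filter.atTop (nhds p) →
      ∀ w' : C2, Filter.Tendsto (fun j => f (z j)) Filter.atTop (nhds w') → w' ∈ M')
    (p : C2) (hpM : p ∈ M)
    (W : Set C2) (hW : IsOpen W) (hpW : p ∈ W)
    (F : C2 → C2) (hF : DifferentiableOn ℂ F W) (hFf : ∀ z ∈ W ∩ D, F z = f z)
    (hnbhd : ∃ O : Set C2, IsOpen O ∧ p ∈ O ∧
      (∀ q ∈ M ∩ O, PseudoconvexAt r q) ∧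
      LeviDegenerateAt r p ∧
      (∀ q ∈ M ∩ O, q ≠ p → ¬ LeviDegenerateAt r q)) :
    F p ∈ M' ∧ LeviDegenerateAt r' (F p) ∧
      ∃ O' : Set C2, IsOpen O' ∧ F p ∈ O' ∧
        (∀ q ∈ M' ∩ O', PseudoconvexAt r' q) ∧
        (∀ q ∈ M' ∩ O', q ≠ F p → ¬ LeviDegenerateAt r' q) := by
  obtain ⟨O, hO, hMO⟩ := hMopen
  obtain ⟨O', hO', hMO'⟩ := hM'open
  obtain ⟨N, hN, hpN, hps, hdeg, hnd⟩ := hnbhd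
  have hFan : ∀ x ∈ W, AnalyticAt ℂ F x := fun x hx =>
    osgood2 (by
      filter_upwards [hW.mem_nhds hx] with y hy
      exact hF.differentiableAt (hW.mem_nhds hy))
  have hclF : ∀ q ∈ M, q ∈ W → F q ∈ M' := by
    intro q hq hqW
    obtain ⟨z, hzD, hzq⟩ := mem_closure_iff_seq_limit.1 (frontier_subset_closure (hMsub hq))
    obtain ⟨n0, hn0⟩ := eventually_atTop.1 (hzq.eventually (hW.mem_nhds hqW))
    have hz2 : Tendsto (fun j => z (j + n0)) atTop (𝓝 q) := hzq.comp (tendsto_add_atTop_nat n0)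
    refine hcl q hq (fun j => z (j + n0)) (fun j => hzD _) hz2 (F q) ?_
    have h1 := (hFan q hqW).continuousAt.tendsto.comp hz2
    refine h1.congr fun j => ?_
    exact hFf _ ⟨hn0 _ (Nat.le_add_left _ _), hzD _⟩
  have hFp : F p ∈ M' := hclF p hpM hpW
  have hFpΩ : F p ∈ Ω' := hM'Ω' (subset_closure hFp)
  have hpΩ : p ∈ Ω := hMΩ (subset_closure hpM)
  have hr0M : ∀ q ∈ M, r q = 0 := by
    intro q hq
    have h1 : q ∈ frontier D ∩ Ω := ⟨hMsub hq, hMΩ (subset_closure hq)⟩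
    rw [hrbd] at h1
    exact h1.2
  have hr0M' : ∀ q ∈ M', r' q = 0 := by
    intro q hq
    have h1 : q ∈ frontier D' ∩ Ω' := ⟨hM'sub hq, hM'Ω' (subset_closure hq)⟩
    rw [hr'bd] at h1
    exact h1.2
  have hpO : p ∈ O := by
    have h1 := hpM
    rw [hMO] at h1
    exact h1.2
  have hMr : ∀ᶠ x in 𝓝 p, r x = 0 → x ∈ M := by
    filter_upwards [hO.mem_nhds hpO, hΩ.mem_nhds hpΩ] with x hx1 hx2 hx0
    have h1 : x ∈ frontier D ∩ Ω := by rw [hrbd]; exact ⟨hx2, hx0⟩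
    rw [hMO]
    exact ⟨h1.1, hx1⟩
  have hpr : r p = 0 := hr0M p hpM
  have hFc := (hFan p hpW).continuousAt
  have hDneg : ∀ᶠ x in 𝓝 p, x ∈ D → r' (F x) < 0 := by
    filter_upwards [hFc.eventually (hΩ'.mem_nhds hFpΩ), hW.mem_nhds hpW] with x hx1 hx2 hxD
    have h1 : F x ∈ D' ∩ Ω' := ⟨by rw [hFf x ⟨hx2, hxD⟩]; exact hfm hxD, hx1⟩
    rw [hr'D] at h1
    exact h1.2
  have hlm := local_main (r := r) (r' := r') (F := F) (p := p) (hr p hpΩ) hpr (hrgrad p hpΩ)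
    (hFan p hpW) (hr' _ hFpΩ) (hr'grad _ hFpΩ)
    (by
      filter_upwards [hMr, hW.mem_nhds hpW] with x hx1 hx2 hx0
      exact hr0M' _ (hclF x (hx1 hx0) hx2))
    (by
      filter_upwards [hDneg, hΩ.mem_nhds hpΩ] with x hx1 hx2 hx0
      have h1 : x ∈ D ∩ Ω := by rw [hrD]; exact ⟨hx2, hx0⟩
      exact hx1 h1.1)
    (by
      intro hev
      have hpc : p ∈ closure D := frontier_subset_closure (hMsub hpM)
      obtain ⟨x, ⟨hx1, hx2⟩, hxD⟩ := mem_closure_iff_nhds.1 hpc _ (hev.and hDneg)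
      have h1 := hx2 hxD
      rw [hx1] at h1
      exact lt_irrefl _ h1)
    (by
      intro φ hφ hφ0 hφr
      have hφΩ : ∀ᶠ z in 𝓝 (0 : ℂ), φ z ∈ Ω := by
        refine hφ.continuousAt.eventually ?_
        rw [hφ0]
        exact hΩ.mem_nhds hpΩ
      obtain ⟨δ, hδ, hB⟩ := Metric.eventually_nhds_iff_ball.1
        (hφ.eventually_analyticAt.and (hφr.and hφΩ))
      have hsc : ∀ ζ ∈ ball (0 : ℂ) 1, (δ : ℂ) * ζ ∈ ball (0 : ℂ) δ := by
        intro ζ hζ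
        rw [mem_ball_zero_iff] at hζ ⊢
        rw [norm_mul, Complex.norm_real, Real.norm_eq_abs, abs_of_pos hδ]
        nlinarith
      have hk := hft (fun ζ => φ (δ * ζ))
        (by
          intro ζ hζ
          have h1 := (hB _ (hsc ζ hζ)).1.differentiableAt
          have h2 : DifferentiableAt ℂ (fun ζ : ℂ => (δ : ℂ) * ζ) ζ := by fun_prop
          exact (DifferentiableAt.comp (g := φ) ζ h1 h2).differentiableWithinAt)
        (by
          intro ζ hζ
          rw [hrbd]
          exact ⟨(hB _ (hsc ζ hζ)).2.2, (hB _ (hsc ζ hζ)).2.1⟩)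
      filter_upwards [ball_mem_nhds (0 : ℂ) hδ] with z hz
      have hδc : (δ : ℂ) ≠ 0 := by exact_mod_cast hδ.ne'
      have hz1 : z / δ ∈ ball (0 : ℂ) 1 := by
        rw [mem_ball_zero_iff] at hz ⊢
        rw [norm_div, Complex.norm_real, Real.norm_eq_abs, abs_of_pos hδ]
        exact (div_lt_one hδ).2 hz
      have h1 := hk (z / δ) hz1 0 (mem_ball_self one_pos)
      simp only [mul_zero, mul_div_cancel₀ z hδc] at h1
      rw [h1, hφ0])
    (by
      filter_upwards [hMr, hN.mem_nhds hpN] with x hx1 hx2 hx0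
      exact hps x ⟨hx1 hx0, hx2⟩)
    hdeg
    (by
      filter_upwards [hMr, hN.mem_nhds hpN] with x hx1 hx2 hx0
      exact hnd x ⟨hx1 hx0, hx2⟩)
  obtain ⟨V, hV1, hV2, hV3⟩ := _root_.eventually_nhds_iff.1 hlm.2
  refine ⟨hFp, hlm.1, V, hV2, hV3, ?_, ?_⟩
  · rintro q ⟨hqM, hqV⟩
    exact (hV1 q hqV (hr0M' q hqM)).1
  · rintro q ⟨hqM, hqV⟩
    exact (hV1 q hqV (hr0M' q hqM)).2
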